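/- Assume Conditions (a) and (b) and Condition P. Then, as n → ∞, (1/n)·log( |𝒞c_{n(n)}| / (ℓ_n − 1)!! ) → −K(p), i.e. |𝒞c_{n(n)}| = e^{−K(p)n+o(n)}·|𝒞_{n(n)}|. If additionally Condition (c) holds, then also (1/n)·log( |𝒮c_{n(n)}| / (ℓ_n − 1)!! ) → −K(p). -/

import Mathlib

namespace PaperCM

noncomputable section

/-- Number of vertices of a type sequence. -/
def numV (m : ℕ →₀ ℕ) : ℕ := m.sum fun _ c => c

/-- Total degree of a type sequence. -/
def totalDeg (m : ℕ →₀ ℕ) : ℕ := m.sum fun i c => i * c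

/-- The nondecreasing degree sequence associated with a type sequence:
`degOf m i` is the least `j` with `m 1 + ⋯ + m j ≥ i + 1` (vertices `0`-indexed). -/
def degOf (m : ℕ →₀ ℕ) (i : ℕ) : ℕ :=
  sInf {j : ℕ | i < ∑ k ∈ Finset.Icc 1 j, m k}

/-- The half-edges of a type sequence: pairs `(v, j)` with `j < d_v`. -/
abbrev HalfEdges (m : ℕ →₀ ℕ) := Σ v : Fin (numV m), Fin (degOf m (v : ℕ))

/-- A configuration: a perfect matching of the half-edges, encoded as a
fixed-point free involution. -/
def IsConfig (m : ℕ →₀ ℕ) (f : HalfEdges m → HalfEdges m) : Prop :=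
  Function.Involutive f ∧ ∀ x, f x ≠ x

/-- Adjacency in the multigraph induced by a configuration. -/
def adj (m : ℕ →₀ ℕ) (f : HalfEdges m → HalfEdges m) (u v : Fin (numV m)) : Prop :=
  ∃ (j : Fin (degOf m (u : ℕ))) (j' : Fin (degOf m (v : ℕ))), f ⟨u, j⟩ = ⟨v, j'⟩

/-- The multigraph of the configuration is connected. -/
def IsConn (m : ℕ →₀ ℕ) (f : HalfEdges m → HalfEdges m) : Prop :=
  ∀ u v : Fin (numV m), Relation.ReflTransGen (adj m f) u v

/-- The configuration is simple: no self-loops and no multiple edges. -/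
def IsSimple (m : ℕ →₀ ℕ) (f : HalfEdges m → HalfEdges m) : Prop :=
  (∀ x : HalfEdges m, (f x).1 ≠ x.1) ∧
    ∀ x y : HalfEdges m, x.1 = y.1 → (f x).1 = (f y).1 → x = y ∨ x = f y

/-- The vertex set of the component of `v`. -/
def component (m : ℕ →₀ ℕ) (f : HalfEdges m → HalfEdges m) (v : Fin (numV m)) :
    Set (Fin (numV m)) :=
  {u | Relation.ReflTransGen (adj m f) v u}

/-- The type of the component of `v`: the number of its vertices of each degree. -/
def compType (m : ℕ →₀ ℕ) (f : HalfEdges m → HalfEdges m) (v : Fin (numV m)) (i : ℕ) : ℕ :=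
  Set.ncard {u : Fin (numV m) | u ∈ component m f v ∧ degOf m (u : ℕ) = i}

/-- The configuration has a component with type `m'`. -/
def HasCompOfType (m : ℕ →₀ ℕ) (f : HalfEdges m → HalfEdges m) (m' : ℕ →₀ ℕ) : Prop :=
  ∃ v : Fin (numV m), ∀ i, compType m f v i = m' i

/-- `v` is the minimal representative of its component. -/
def IsRep (m : ℕ →₀ ℕ) (f : HalfEdges m → HalfEdges m) (v : Fin (numV m)) : Prop :=
  ∀ u ∈ component m f v, v ≤ u

/-- Number of components of the configuration whose type lies in `𝒩`. -/
def numCompIn (m : ℕ →₀ ℕ) (f : HalfEdges m → HalfEdges m) (𝒩 : Set (ℕ →₀ ℕ)) : ℕ :=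
  Set.ncard {v : Fin (numV m) | IsRep m f v ∧ ∃ m' ∈ 𝒩, ∀ i, compType m f v i = m' i}

/-- `|𝒞_m|`: the number of configurations with type `m`. -/
def cC (m : ℕ →₀ ℕ) : ℕ := Set.ncard {f | IsConfig m f}
/-- `|𝒞c_m|`: the number of connected configurations with type `m`. -/
def cCc (m : ℕ →₀ ℕ) : ℕ := Set.ncard {f | IsConfig m f ∧ IsConn m f}
/-- `|𝒮_m|`: the number of simple configurations with type `m`. -/
def cS (m : ℕ →₀ ℕ) : ℕ := Set.ncard {f | IsConfig m f ∧ IsSimple m f}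
/-- `|𝒮c_m|`: the number of connected simple configurations with type `m`. -/
def cSc (m : ℕ →₀ ℕ) : ℕ := Set.ncard {f | IsConfig m f ∧ IsSimple m f ∧ IsConn m f}
/-- `|𝒞_m^{m'}|`: configurations with type `m` having a component of type `m'`. -/
def cCcomp (m m' : ℕ →₀ ℕ) : ℕ := Set.ncard {f | IsConfig m f ∧ HasCompOfType m f m'}
/-- `|𝒮_m^{m'}|`. -/
def cScomp (m m' : ℕ →₀ ℕ) : ℕ :=
  Set.ncard {f | IsConfig m f ∧ IsSimple m f ∧ HasCompOfType m f m'}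
/-- `|𝒞_m^{𝒩}|`: configurations with type `m` having a component whose type lies in `𝒩`. -/
def cCcompSet (m : ℕ →₀ ℕ) (𝒩 : Set (ℕ →₀ ℕ)) : ℕ :=
  Set.ncard {f | IsConfig m f ∧ ∃ m' ∈ 𝒩, HasCompOfType m f m'}
/-- `|𝒮_m^{𝒩}|`. -/
def cScompSet (m : ℕ →₀ ℕ) (𝒩 : Set (ℕ →₀ ℕ)) : ℕ :=
  Set.ncard {f | IsConfig m f ∧ IsSimple m f ∧ ∃ m' ∈ 𝒩, HasCompOfType m f m'}

/-- The type sequence `n(n) = (n_i(n))_{i ≥ 1}` of the degree sequence `d(n)`. -/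
def typeOf (d : (n : ℕ) → Fin n → ℕ) (n : ℕ) : ℕ →₀ ℕ :=
  ∑ j : Fin n, Finsupp.single (d n j) 1

/-- The total degree `ℓ_n = Σ_i i·n_i = Σ_j d_j(n)`. -/
def ℓTot (d : (n : ℕ) → Fin n → ℕ) (n : ℕ) : ℕ := ∑ j : Fin n, d n j

/-- The set `𝒩^ε(n)` of type sequences approximating `n` from below. -/
def Neps (ε : ℝ) (nn : ℕ →₀ ℕ) : Set (ℕ →₀ ℕ) :=
  {m | m ≤ nn ∧ (1 - ε) * (totalDeg nn : ℝ) < (totalDeg m : ℝ)}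

/-- `β(p)`: the solution in `(0,1)` of the fixed-point equation
`Σ_k k p_k = (1-β²) Σ_k k p_k/(1-β^k)`. -/
def betaOf (p : ℕ → ℝ) : ℝ :=
  sInf {β : ℝ | β ∈ Set.Ioo 0 1 ∧
    ∑' k : ℕ, (k : ℝ) * p k = (1 - β ^ 2) * ∑' k : ℕ, (k : ℝ) * p k / (1 - β ^ k)}

/-- The exponential rate `K(p)`. -/
def Kof (p : ℕ → ℝ) : ℝ :=
  (∑' k : ℕ, (k : ℝ) * p k) / 2 * Real.log (1 - betaOf p ^ 2)
    - ∑' k : ℕ, p k * Real.log (1 - betaOf p ^ k)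

end

end PaperCM

namespace PaperCM

set_option linter.unusedSectionVars false

open Relation

/-- A fixed-point free involution, i.e. a perfect matching. -/
def Cfg {H : Type*} (f : H → H) : Prop := Function.Involutive f ∧ ∀ x, f x ≠ x

/-- Adjacency of the vertices `u`, `v` in the multigraph of `f`, where `π` sends a half-edge to its
vertex. -/
def Adj {H V : Type*} (π : H → V) (f : H → H) (u v : V) : Prop := ∃ x, π x = u ∧ π (f x) = v

/-- The multigraph of `f` is connected. -/
def Conn {H V : Type*} (π : H → V) (f : H → H) : Prop := ∀ u v, ReflTransGen (Adj π f) u v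

/-- The multigraph of `f` has no loops and no multiple edges. -/
def Smp {H V : Type*} (π : H → V) (f : H → H) : Prop :=
  (∀ x, π (f x) ≠ π x) ∧ ∀ x y, π x = π y → π (f x) = π (f y) → x = y

/-- Match the half-edges `a` and `b`. -/
def match2 {H : Type*} [DecidableEq H] (f : H → H) (a b : H) (x : H) : H :=
  if x = a then b else if x = b then a else f x

section Extend

variable {H V : Type*} [Fintype H] [DecidableEq H] [Fintype V] [DecidableEq V]

/-- The ordered pairs of distinct adjacent vertices. -/
def adjPairs (π : H → V) (f : H → H) : Finset (V × V) :=
  (Finset.univ.filter fun x => π (f x) ≠ π x).image fun x => (π x, π (f x))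

theorem mem_adjPairs {π : H → V} {f : H → H} {u v : V} :
    (u, v) ∈ adjPairs π f ↔ u ≠ v ∧ ∃ x, π x = u ∧ π (f x) = v := by
  simp only [adjPairs, Finset.mem_image, Finset.mem_filter, Finset.mem_univ, true_and,
    Prod.mk.injEq]
  constructor
  · rintro ⟨x, h, rfl, rfl⟩
    exact ⟨Ne.symm h, x, rfl, rfl⟩
  · rintro ⟨h, x, rfl, rfl⟩
    exact ⟨x, Ne.symm h, rfl, rfl⟩

theorem adjPairs_symm {π : H → V} {f : H → H} (hf : Function.Involutive f) {u v : V}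
    (h : (u, v) ∈ adjPairs π f) : (v, u) ∈ adjPairs π f := by
  rw [mem_adjPairs] at h ⊢
  obtain ⟨h, x, rfl, rfl⟩ := h
  exact ⟨Ne.symm h, f x, rfl, by rw [hf x]⟩

theorem Adj.symm {π : H → V} {f : H → H} (hf : Function.Involutive f) {u v : V}
    (h : Adj π f u v) : Adj π f v u := by
  obtain ⟨x, rfl, rfl⟩ := h
  exact ⟨f x, rfl, by rw [hf x]⟩

theorem reach_symm {π : H → V} {f : H → H} (hf : Function.Involutive f) {u v : V}
    (h : ReflTransGen (Adj π f) u v) : ReflTransGen (Adj π f) v u := by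
  induction h with
  | refl => exact .refl
  | tail _ h ih => exact .head (h.symm hf) ih

theorem conn_of_root {π : H → V} {f : H → H} (hf : Function.Involutive f) (r : V)
    (h : ∀ v, ReflTransGen (Adj π f) r v) : Conn π f := fun u v =>
  (reach_symm hf (h u)).trans (h v)

theorem adj_sub {π : H → V} {f g : H → H} (h : ∀ x, f x ≠ x → g x = f x) {u v : V}
    (huv : ReflTransGen (Adj π f) u v) : ReflTransGen (Adj π g) u v := by
  induction huv with
  | refl => exact .refl
  | tail _ h' ih =>
    obtain ⟨x, rfl, rfl⟩ := h'
    by_cases hx : f x = x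
    · rwa [hx]
    · exact ih.tail ⟨x, rfl, by rw [h x hx]⟩

theorem adjPairs_mono {π : H → V} {f g : H → H} (h : ∀ x, f x ≠ x → g x = f x) :
    adjPairs π f ⊆ adjPairs π g := by
  rintro ⟨u, v⟩ huv
  rw [mem_adjPairs] at huv ⊢
  obtain ⟨hne, x, rfl, rfl⟩ := huv
  refine ⟨hne, x, rfl, ?_⟩
  rw [h x]
  intro hx
  exact hne (by rw [hx])

theorem match2_extends {f : H → H} {a b : H} (ha : f a = a) (hb : f b = b) (x : H)
    (hx : f x ≠ x) : match2 f a b x = f x := by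
  unfold match2
  rw [if_neg, if_neg]
  · rintro rfl; exact hx hb
  · rintro rfl; exact hx ha

theorem match2_involutive {f : H → H} (hf : Function.Involutive f) {a b : H} (ha : f a = a)
    (hb : f b = b) : Function.Involutive (match2 f a b) := by
  intro x
  have hfa : ∀ x, f x = a ↔ x = a := fun x =>
    ⟨fun h => by rw [← hf x, h, ha], fun h => by rw [h, ha]⟩
  have hfb : ∀ x, f x = b ↔ x = b := fun x =>
    ⟨fun h => by rw [← hf x, h, hb], fun h => by rw [h, hb]⟩
  unfold match2
  by_cases h1 : x = a
  · by_cases h3 : b = a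
    · simp [h1, h3]
    · simp [h1, h3]
  · by_cases h2 : x = b
    · simp [h2]
    · simp [h1, h2, hfa, hfb, hf x]

theorem match2_fixed {f : H → H} {a b : H} (hab : a ≠ b) :
    (Finset.univ.filter fun x => match2 f a b x = x) =
      ((Finset.univ.filter fun x => f x = x).erase a).erase b := by
  ext x
  rw [Finset.mem_filter, Finset.mem_erase, Finset.mem_erase, Finset.mem_filter]
  simp only [Finset.mem_univ, true_and]
  unfold match2
  split_ifs with h1 h2
  · simp [h1, Ne.symm hab]
  · simp [h2, hab]
  · simp [h1, h2]

theorem card_fixed_match2 {f : H → H} {a b : H} (hab : a ≠ b) (ha : f a = a) (hb : f b = b) :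
    (Finset.univ.filter fun x => match2 f a b x = x).card + 2 =
      (Finset.univ.filter fun x => f x = x).card := by
  rw [match2_fixed hab]
  have h1 : a ∈ (Finset.univ.filter fun x => f x = x) := by simp [ha]
  have h2 : b ∈ (Finset.univ.filter fun x => f x = x).erase a := by simp [hb, Ne.symm hab]
  have h3 := Finset.card_erase_add_one h1
  have h4 := Finset.card_erase_add_one h2
  omega

/-- The completions of the partial matching `f₀` to a connected perfect matching that is simple up
to a defect `K`. -/
noncomputable def completions (π : H → V) (K : ℕ) (f₀ : H → H) : Finset (H → H) := by
  classical
  exact Finset.univ.filter fun f => Cfg f ∧ Conn π f ∧ (∀ x, f₀ x ≠ x → f x = f₀ x) ∧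
    Fintype.card H ≤ (adjPairs π f).card + K

theorem mem_completions {π : H → V} {K : ℕ} {f₀ f : H → H} :
    f ∈ completions π K f₀ ↔ Cfg f ∧ Conn π f ∧ (∀ x, f₀ x ≠ x → f x = f₀ x) ∧
    Fintype.card H ≤ (adjPairs π f).card + K := by
  simp [completions]

theorem card_neighbour_halfEdges_le {π : H → V} {T : ℕ}
    (hT : ∀ v, (Finset.univ.filter fun x => π x = v).card ≤ T) (f : H → H) (u : V) :
    (Finset.univ.filter fun y => ∃ x, π x = u ∧ π (f x) = π y).card ≤ T * T := by
  have : (Finset.univ.filter fun y => ∃ x, π x = u ∧ π (f x) = π y) ⊆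
      (Finset.univ.filter fun x => π x = u).biUnion fun x =>
        Finset.univ.filter fun y => π y = π (f x) := by
    intro y hy
    simp only [Finset.mem_filter, Finset.mem_univ, true_and, Finset.mem_biUnion] at hy ⊢
    obtain ⟨x, h1, h2⟩ := hy
    exact ⟨x, h1, h2.symm⟩
  refine (Finset.card_le_card this).trans ?_
  refine (Finset.card_biUnion_le_card_mul _ _ T fun x _ => hT _).trans ?_
  exact Nat.mul_le_mul_right _ (hT u)

theorem completions_card {π : H → V} {T K : ℕ} (hK : Even K) (hTK : T + T * T + 1 ≤ K)
    (h2 : ∀ v, 2 ≤ (Finset.univ.filter fun x => π x = v).card)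
    (hT : ∀ v, (Finset.univ.filter fun x => π x = v).card ≤ T) (r : V) :
    ∀ (R : ℕ) (f₀ : H → H) (S : Finset V), Function.Involutive f₀ →
      (∀ x, f₀ x ≠ x → π x ∈ S) → (∀ u ∈ S, ReflTransGen (Adj π f₀) r u) →
      (Finset.univ.filter fun x => f₀ x = x).card = 2 * R →
      (R = 0 ∨ ∃ x, f₀ x = x ∧ π x ∈ S) →
      Fintype.card H ≤ (adjPairs π f₀).card + max (2 * R) K →
      (2 * R - K).doubleFactorial ≤ (completions π K f₀).card := by
  intro R
  induction R with
  | zero =>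
    intro f₀ S hinv hS hr hR _ hφ
    have hfix : ∀ x, f₀ x ≠ x := by
      intro x hx
      rw [Nat.mul_zero, Finset.card_eq_zero] at hR
      exact Finset.notMem_empty x (hR ▸ by simp [hx])
    have : f₀ ∈ completions π K f₀ := by
      rw [mem_completions]
      refine ⟨⟨hinv, hfix⟩, conn_of_root hinv r fun v => hr v ?_, fun _ _ => rfl, by simpa using hφ⟩
      obtain ⟨x, hx⟩ := Finset.card_pos.1 (lt_of_lt_of_le two_pos (h2 v))
      have hx' : π x = v := by simpa using hx
      exact hx' ▸ hS x (hfix x)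
    simpa using Finset.card_pos.2 ⟨_, this⟩
  | succ R ih =>
    intro f₀ S hinv hS hr hR hact hφ
    obtain ⟨a, ha, haS⟩ : ∃ x, f₀ x = x ∧ π x ∈ S := by simpa using hact
    classical
    set F := Finset.univ.filter fun x => f₀ x = x with hF
    have haF : a ∈ F := by simp [hF, ha]
    let okc : H → Prop := fun y => R = 0 ∨ π y ∉ S ∨ ∃ z ∈ F, π z ∈ S ∧ z ≠ a ∧ z ≠ y
    let oks : H → Prop := fun y => π y ≠ π a ∧ (π a, π y) ∉ adjPairs π f₀
    let Y := F.filter fun y => y ≠ a ∧ okc y ∧ (K < 2 * (R + 1) → oks y)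
    have hstep : ∀ y ∈ Y, (2 * R - K).doubleFactorial ≤
        (completions π K (match2 f₀ a y)).card := by
      intro y hy
      simp only [Y, hF, Finset.mem_filter, Finset.mem_univ, true_and] at hy
      obtain ⟨hyf, hya, hc, hs⟩ := hy
      have hext := match2_extends ha hyf
      have hcard := card_fixed_match2 (Ne.symm hya) ha hyf
      rw [← hF, hR] at hcard
      have hma : match2 f₀ a y a = y := by simp [match2]
      have hmy : match2 f₀ a y y = a := by simp [match2, hya]
      refine ih (match2 f₀ a y) (insert (π y) S) (match2_involutive hinv ha hyf) ?_ ?_ (by omega)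
        ?_ ?_
      · intro x hx
        rw [Finset.mem_insert]
        by_cases h1 : x = y
        · exact .inl (by rw [h1])
        · right
          by_cases h3 : x = a
          · rwa [h3]
          · apply hS
            simpa [match2, h1, h3] using hx
      · intro u hu
        rw [Finset.mem_insert] at hu
        obtain rfl | hu := hu
        · exact (adj_sub hext (hr _ haS)).tail ⟨a, rfl, by rw [hma]⟩
        · exact adj_sub hext (hr u hu)
      · have key : ∀ z, f₀ z = z → z ≠ a → z ≠ y → match2 f₀ a y z = z := by
          intro z h1 h3 h4
          simp [match2, h1, h3, h4]
        obtain h | h | ⟨z, hz, hzS, hza, hzy⟩ := hc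
        · exact .inl h
        · right
          obtain ⟨z, hz, hzy⟩ := Finset.exists_mem_ne (h2 (π y)) y
          have hz' : π z = π y := by simpa using hz
          refine ⟨z, key z ?_ ?_ hzy, by simp [hz']⟩
          · by_contra hne
            exact h (hz' ▸ hS z hne)
          · rintro rfl
            exact h (hz' ▸ haS)
        · right
          exact ⟨z, key z (by simpa [hF] using hz) hza hzy, by simp [hzS]⟩
      · have hmono := adjPairs_mono (π := π) hext
        by_cases hKR : K < 2 * (R + 1)
        · obtain ⟨hne, hnot⟩ := hs hKR
          have hsub : insert (π a, π y) (insert (π y, π a) (adjPairs π f₀)) ⊆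
              adjPairs π (match2 f₀ a y) := by
            intro q hq
            rw [Finset.mem_insert, Finset.mem_insert] at hq
            obtain rfl | rfl | hq := hq
            · exact mem_adjPairs.2 ⟨hne.symm, a, rfl, by rw [hma]⟩
            · exact mem_adjPairs.2 ⟨hne, y, rfl, by rw [hmy]⟩
            · exact hmono hq
          have := Finset.card_le_card hsub
          rw [Finset.card_insert_of_notMem, Finset.card_insert_of_notMem] at this
          · obtain ⟨k, hk⟩ := hK
            rw [max_eq_left (by omega)] at hφ ⊢
            omega
          · exact fun h => hnot (adjPairs_symm hinv h)
          · rw [Finset.mem_insert, not_or]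
            refine ⟨?_, hnot⟩
            intro h
            exact hne (Prod.ext_iff.1 h).2
        · have := Finset.card_le_card hmono
          rw [max_eq_right (by omega)] at hφ ⊢
          omega
    have hYcard : K < 2 * (R + 1) → 2 * (R + 1) ≤ Y.card + K := by
      intro hKR
      let A₁ := Finset.univ.filter fun y => π y = π a
      let A₂ := Finset.univ.filter fun y => ∃ x, π x = π a ∧ π (f₀ x) = π y
      let A₃ := F.filter fun y => y ≠ a ∧ ¬ okc y
      have hA₃ : A₃.card ≤ 1 := by
        rw [Finset.card_le_one]
        intro y hy z hz
        simp only [A₃, okc, Finset.mem_filter, not_or, not_exists, not_and, not_not] at hy hz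
        by_contra hne
        exact hne ((hy.2.2.2.2 z hz.1 hz.2.2.2.1 hz.2.1).symm)
      have hsub : F ⊆ Y ∪ (A₁ ∪ A₂ ∪ A₃) := by
        intro y hy
        by_contra hcon
        simp only [Y, A₁, A₂, A₃, Finset.mem_union, Finset.mem_filter, Finset.mem_univ, true_and,
          not_or, hy] at hcon
        obtain ⟨h1, ⟨h3, h4⟩, h5⟩ := hcon
        have hya : y ≠ a := fun h => h3 (by rw [h])
        have hc : okc y := by
          by_contra hc
          exact h5 ⟨hya, hc⟩
        exact h1 ⟨hya, hc, fun _ => ⟨h3, fun hm => h4 (mem_adjPairs.1 hm).2⟩⟩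
      have h1 := Finset.card_le_card hsub
      have h3 := Finset.card_union_le Y (A₁ ∪ A₂ ∪ A₃)
      have h4 := Finset.card_union_le (A₁ ∪ A₂) A₃
      have h5 := Finset.card_union_le A₁ A₂
      have h6 : A₁.card ≤ T := hT _
      have h7 : A₂.card ≤ T * T := card_neighbour_halfEdges_le hT f₀ (π a)
      omega
    have hYpos : 1 ≤ Y.card := by
      by_cases hKR : K < 2 * (R + 1)
      · have := hYcard hKR
        obtain ⟨k, hk⟩ := hK
        omega
      · rw [Nat.one_le_iff_ne_zero, Finset.card_ne_zero]
        obtain ⟨y, hy, hya⟩ := Finset.exists_mem_ne (by omega : 1 < F.card) a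
        by_cases hex : ∃ z ∈ F, π z ∉ S
        · obtain ⟨z, hz, hzS⟩ := hex
          exact ⟨z, Finset.mem_filter.2 ⟨hz, fun h => hzS (h ▸ haS), .inr (.inl hzS),
            fun h => absurd h hKR⟩⟩
        · push Not at hex
          refine ⟨y, Finset.mem_filter.2 ⟨hy, hya, ?_, fun h => absurd h hKR⟩⟩
          by_cases hR0 : R = 0
          · exact .inl hR0
          · right; right
            have : ¬ F ⊆ {a, y} := by
              intro h
              have := (Finset.card_le_card h).trans Finset.card_le_two
              omega
            obtain ⟨z, hz, hz'⟩ := Finset.not_subset.1 this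
            simp only [Finset.mem_insert, Finset.mem_singleton, not_or] at hz'
            exact ⟨z, hz, hex z hz, hz'⟩
    have hsum : ∑ y ∈ Y, (completions π K (match2 f₀ a y)).card ≤ (completions π K f₀).card := by
      rw [← Finset.card_biUnion]
      · apply Finset.card_le_card
        intro f hf
        rw [Finset.mem_biUnion] at hf
        obtain ⟨y, hy, hf⟩ := hf
        rw [mem_completions] at hf ⊢
        have hyf : f₀ y = y := by
          have := (Finset.mem_filter.1 hy).1
          simpa [hF] using this
        refine ⟨hf.1, hf.2.1, fun x hx => ?_, hf.2.2.2⟩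
        have := match2_extends ha hyf x hx
        rw [← this]
        exact hf.2.2.1 x (by rwa [this])
      · intro y hy z hz hne
        rw [Function.onFun, Finset.disjoint_left]
        intro f hf hf'
        rw [mem_completions] at hf hf'
        have hya := (Finset.mem_filter.1 hy).2.1
        have hza := (Finset.mem_filter.1 hz).2.1
        have e1 := hf.2.2.1 a (by simpa [match2] using hya)
        have e2 := hf'.2.2.1 a (by simpa [match2] using hza)
        rw [e1] at e2
        exact hne (by simpa [match2] using e2)
    have hmul : Y.card * (2 * R - K).doubleFactorial ≤ (completions π K f₀).card := by
      refine le_trans ?_ hsum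
      rw [← smul_eq_mul]
      exact Finset.card_nsmul_le_sum _ _ _ hstep
    refine le_trans ?_ hmul
    by_cases hKR : K < 2 * (R + 1)
    · obtain ⟨k, hk⟩ := hK
      have e : 2 * (R + 1) - K = (2 * R - K) + 2 := by omega
      rw [e, Nat.doubleFactorial_add_two]
      have := hYcard hKR
      exact Nat.mul_le_mul_right _ (by omega)
    · have e : 2 * (R + 1) - K = 0 := by omega
      have e' : 2 * R - K = 0 := by omega
      simpa [e, e'] using hYpos

end Extend

end PaperCM

namespace PaperCM

set_option linter.unusedSectionVars false

open Relation

section Switch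

variable {H V : Type*} [Fintype H] [DecidableEq H] [Fintype V] [DecidableEq V]

/-- Conjugation by the transposition of `a` and `b`. -/
def conjSwap (f : H → H) (a b : H) (x : H) : H := Equiv.swap a b (f (Equiv.swap a b x))

theorem conjSwap_conjSwap (f : H → H) (a b : H) : conjSwap (conjSwap f a b) a b = f := by
  funext x
  simp [conjSwap]

theorem Cfg.conjSwap {f : H → H} (hf : Cfg f) (a b : H) : Cfg (conjSwap f a b) := by
  refine ⟨fun x => by simp [PaperCM.conjSwap, hf.1 _], fun x h => ?_⟩
  apply hf.2 (Equiv.swap a b x)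
  apply (Equiv.swap a b).injective
  simpa [PaperCM.conjSwap] using h

/-- The neighbours of `u`. -/
def nbrs (π : H → V) (f : H → H) (u : V) : Finset V :=
  (Finset.univ.filter fun x => π x = u).image fun x => π (f x)

theorem mem_nbrs {π : H → V} {f : H → H} {u w : V} :
    w ∈ nbrs π f u ↔ ∃ x, π x = u ∧ π (f x) = w := by
  simp [nbrs]

theorem exists_far {π : H → V} {T : ℕ} (hT : ∀ v, (Finset.univ.filter fun x => π x = v).card ≤ T)
    (hV : 2 * (1 + T + T * T) < Fintype.card V) (f : H → H) (u v : V) :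
    ∃ w, w ≠ u ∧ w ≠ v ∧ w ∉ nbrs π f u ∧ w ∉ nbrs π f v ∧
      (∀ t ∈ nbrs π f u, w ∉ nbrs π f t) ∧ ∀ t ∈ nbrs π f v, w ∉ nbrs π f t := by
  let B : V → Finset V := fun u => {u} ∪ nbrs π f u ∪ (nbrs π f u).biUnion (nbrs π f)
  have hN : ∀ u, (nbrs π f u).card ≤ T := fun u => Finset.card_image_le.trans (hT u)
  have hB : ∀ u, (B u).card ≤ 1 + T + T * T := by
    intro u
    have h1 := Finset.card_union_le ({u} ∪ nbrs π f u) ((nbrs π f u).biUnion (nbrs π f))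
    have h2 := Finset.card_union_le {u} (nbrs π f u)
    have h3 := Finset.card_biUnion_le_card_mul (nbrs π f u) (nbrs π f) T fun x _ => hN x
    have h4 := Nat.mul_le_mul_right T (hN u)
    have h5 := hN u
    rw [Finset.card_singleton] at h2
    change (({u} ∪ nbrs π f u) ∪ ((nbrs π f u).biUnion (nbrs π f))).card ≤ _
    omega
  have : ∃ w, w ∉ B u ∪ B v := by
    by_contra hcon
    push Not at hcon
    have h1 : (Finset.univ : Finset V) ⊆ B u ∪ B v := fun w _ => hcon w
    have h2 := Finset.card_le_card h1
    have h3 := Finset.card_union_le (B u) (B v)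
    have h4 := hB u
    have h5 := hB v
    rw [Finset.card_univ] at h2
    omega
  obtain ⟨w, hw⟩ := this
  simp only [B, Finset.mem_union, Finset.mem_singleton, Finset.mem_biUnion, not_or, not_exists,
    not_and] at hw
  exact ⟨w, hw.1.1.1, hw.2.1.1, hw.1.1.2, hw.2.1.2, hw.1.2, hw.2.2⟩

theorem exists_leaving {π : H → V} {f : H → H} {w u : V} (h : ReflTransGen (Adj π f) w u)
    (hne : w ≠ u) : ∃ y, π y = w ∧ π (f y) ≠ w := by
  induction h using ReflTransGen.head_induction_on with
  | refl => exact absurd rfl hne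
  | @head a c hac _ ih =>
    obtain ⟨y, hy, hy'⟩ := hac
    by_cases h : c = a
    · subst h
      exact ih hne
    · exact ⟨y, hy, by rw [hy']; exact h⟩

theorem exists_bad {π : H → V} {f : H → H} (h : (adjPairs π f).card < Fintype.card H) :
    ∃ x, π (f x) = π x ∨ π (f x) ≠ π x ∧ ∃ z, z ≠ x ∧ π z = π x ∧ π (f z) = π (f x) := by
  by_contra hcon
  push Not at hcon
  refine h.ne ?_
  rw [adjPairs, Finset.card_image_of_injOn, ← Finset.card_univ]
  · congr 1
    exact Finset.filter_true_of_mem fun x _ => (hcon x).1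
  · intro x _ y _ hxy
    by_contra hne
    simp only [Prod.mk.injEq] at hxy
    exact (hcon y).2 (hcon y).1 x hne hxy.1 hxy.2

theorem exists_switch {π : H → V} {T : ℕ} {f : H → H} (hf : Cfg f) (hc : Conn π f)
    (hT : ∀ v, (Finset.univ.filter fun x => π x = v).card ≤ T)
    (hV : 2 * (1 + T + T * T) < Fintype.card V) (h : (adjPairs π f).card < Fintype.card H) :
    ∃ a b, Conn π (conjSwap f a b) ∧ (adjPairs π f).card < (adjPairs π (conjSwap f a b)).card := by
  obtain ⟨x, hx⟩ := exists_bad h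
  obtain ⟨w, hwu, hwv, hwNu, hwNv, hw2u, hw2v⟩ := exists_far hT hV f (π x) (π (f x))
  obtain ⟨y, rfl, hy'⟩ := exists_leaving (hc w (π x)) hwu
  have hff := hf.1
  have hyu : π (f y) ≠ π x := fun e => hwNu (mem_nbrs.2 ⟨f y, e, by rw [hff y]⟩)
  have hyv : π (f y) ≠ π (f x) := fun e => hwNv (mem_nbrs.2 ⟨f y, e, by rw [hff y]⟩)
  have hyNu : π (f y) ∉ nbrs π f (π x) := fun e => hw2u _ e (mem_nbrs.2 ⟨f y, rfl, by rw [hff y]⟩)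
  have hyNv : π (f y) ∉ nbrs π f (π (f x)) :=
    fun e => hw2v _ e (mem_nbrs.2 ⟨f y, rfl, by rw [hff y]⟩)
  refine ⟨f x, y, ?_⟩
  set g := conjSwap f (f x) y with hg
  have hgc : Cfg g := hf.conjSwap _ _
  have gx : g x = y := by
    rw [hg, conjSwap, Equiv.swap_apply_of_ne_of_ne (hf.2 x).symm (fun e => hwu (by rw [e])),
      Equiv.swap_apply_left]
  have gy : g y = x := by rw [← gx, hgc.1]
  have gy' : g (f y) = f x := by
    rw [hg, conjSwap, Equiv.swap_apply_of_ne_of_ne (fun e => hyv (by rw [e])) (hf.2 y), hff y,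
      Equiv.swap_apply_right]
  have gx' : g (f x) = f y := by rw [← gy', hgc.1]
  have gz : ∀ z, z ≠ x → z ≠ f x → z ≠ y → z ≠ f y → g z = f z := by
    intro z h1 h2 h3 h4
    rw [hg, conjSwap, Equiv.swap_apply_of_ne_of_ne h2 h3, Equiv.swap_apply_of_ne_of_ne]
    · exact fun e => h1 (hff.injective e)
    · intro e
      exact h4 (by rw [← e, hff])
  have huv : ReflTransGen (Adj π g) (π x) (π (f x)) := by
    obtain hl | ⟨hl, z, hzx, hz, hz'⟩ := hx
    · rw [hl]
    · refine .single ⟨z, hz, ?_⟩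
      rw [gz z hzx, hz']
      · rintro rfl
        exact hl hz
      · rintro rfl
        exact hwu hz
      · rintro rfl
        exact hyu hz
  have hxy : Adj π g (π x) (π y) := ⟨x, rfl, by rw [gx]⟩
  have hxy' : Adj π g (π (f x)) (π (f y)) := ⟨f x, rfl, by rw [gx']⟩
  have hyy : ReflTransGen (Adj π g) (π y) (π (f y)) :=
    ((ReflTransGen.single (hxy.symm hgc.1)).trans huv).tail hxy'
  refine ⟨?_, ?_⟩
  · have step : ∀ z, ReflTransGen (Adj π g) (π z) (π (f z)) := by
      intro z
      by_cases h1 : z = x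
      · rwa [h1]
      by_cases h2 : z = f x
      · rw [h2, hff]
        exact reach_symm hgc.1 huv
      by_cases h3 : z = y
      · rwa [h3]
      by_cases h4 : z = f y
      · rw [h4, hff]
        exact reach_symm hgc.1 hyy
      exact .single ⟨z, rfl, by rw [gz z h1 h2 h3 h4]⟩
    intro a b
    induction hc a b with
    | refl => exact .refl
    | tail _ h ih =>
      obtain ⟨z, rfl, rfl⟩ := h
      exact ih.trans (step z)
  · set P := adjPairs π f with hP
    have m1 : (π x, π y) ∉ P := fun e => hwNu (mem_nbrs.2 (mem_adjPairs.1 e).2)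
    have m2 : (π y, π x) ∉ P := fun e => m1 (adjPairs_symm hff e)
    have m3 : (π (f x), π (f y)) ∉ P := fun e => hyNv (mem_nbrs.2 (mem_adjPairs.1 e).2)
    have hsub : insert (π x, π y) (insert (π y, π x) (insert (π (f x), π (f y))
        ((P.erase (π y, π (f y))).erase (π (f y), π y)))) ⊆ adjPairs π g := by
      intro q hq
      simp only [Finset.mem_insert, Finset.mem_erase] at hq
      obtain rfl | rfl | rfl | ⟨h1, h2, h3⟩ := hq
      · exact mem_adjPairs.2 ⟨hwu.symm, x, rfl, by rw [gx]⟩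
      · exact mem_adjPairs.2 ⟨hwu, y, rfl, by rw [gy]⟩
      · exact mem_adjPairs.2 ⟨hyv.symm, f x, rfl, by rw [gx']⟩
      · obtain ⟨s, t⟩ := q
        obtain ⟨hst, z, rfl, rfl⟩ := mem_adjPairs.1 h3
        have n3 : z ≠ y := by rintro rfl; exact h2 rfl
        have n4 : z ≠ f y := by rintro rfl; exact h1 (by rw [hff])
        obtain hl | ⟨hl, z', hzx, hz, hz'⟩ := hx
        · have n1 : z ≠ x := by rintro rfl; exact hst hl.symm
          have n2 : z ≠ f x := by rintro rfl; exact hst (by rw [hff, hl])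
          exact mem_adjPairs.2 ⟨hst, z, rfl, by rw [gz z n1 n2 n3 n4]⟩
        · have gz' : g z' = f z' := by
            apply gz z' hzx
            · rintro rfl
              exact hl hz
            · rintro rfl
              exact hwu hz
            · rintro rfl
              exact hyu hz
          have key : (π x, π (f x)) ∈ adjPairs π g :=
            mem_adjPairs.2 ⟨hl.symm, z', hz, by rw [gz', hz']⟩
          by_cases n1 : z = x
          · rwa [n1]
          by_cases n2 : z = f x
          · rw [n2, hff]
            exact adjPairs_symm hgc.1 key
          exact mem_adjPairs.2 ⟨hst, z, rfl, by rw [gz z n1 n2 n3 n4]⟩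
    have hle := Finset.card_le_card hsub
    have e1 := Finset.pred_card_le_card_erase (s := P) (a := (π y, π (f y)))
    have e2 := Finset.pred_card_le_card_erase (s := P.erase (π y, π (f y))) (a := (π (f y), π y))
    rw [Finset.card_insert_of_notMem, Finset.card_insert_of_notMem,
      Finset.card_insert_of_notMem] at hle
    · omega
    · simp [m3]
    · simp [m2, hwv]
    · simp [m1, hwu.symm, hyu.symm, Ne.symm hy']

theorem card_conn_defect_le {π : H → V} {T : ℕ}
    (hT : ∀ v, (Finset.univ.filter fun x => π x = v).card ≤ T)
    (hV : 2 * (1 + T + T * T) < Fintype.card V) (K : ℕ) :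
    Nat.card {f : H → H // Cfg f ∧ Conn π f ∧ Fintype.card H ≤ (adjPairs π f).card + K} ≤
      (Fintype.card H ^ 2 + 1) ^ K * Nat.card {f : H → H // Cfg f ∧ Conn π f ∧ Smp π f} := by
  induction K with
  | zero =>
    rw [pow_zero, one_mul]
    refine Nat.card_le_card_of_injective
      (fun f => ⟨f.1, f.2.1, f.2.2.1, ?_⟩) (fun f g h => Subtype.ext (by simpa using h))
    obtain ⟨f, hf, hc, hd⟩ := f
    have hcard : ((Finset.univ : Finset H).image fun x => (π x, π (f x))).card =
        (Finset.univ : Finset H).card := by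
      refine le_antisymm Finset.card_image_le ?_
      rw [Finset.card_univ]
      exact hd.trans (Finset.card_le_card (Finset.image_subset_image (Finset.filter_subset _ _)))
    have hfil : (Finset.univ.filter fun x => π (f x) ≠ π x) = Finset.univ := by
      rw [← Finset.card_eq_iff_eq_univ]
      exact le_antisymm (Finset.card_le_univ _) (hd.trans Finset.card_image_le)
    refine ⟨fun x => ?_, fun x y h1 h2 => ?_⟩
    · have : x ∈ (Finset.univ.filter fun x => π (f x) ≠ π x) := by
        rw [hfil]; exact Finset.mem_univ x
      simpa using this
    · exact Finset.card_image_iff.1 hcard (by simp) (by simp) (by simp [h1, h2])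
  | succ K ih =>
    set X := {f : H → H // Cfg f ∧ Conn π f ∧ Fintype.card H ≤ (adjPairs π f).card + K}
    set Y := {f : H → H // Cfg f ∧ Conn π f ∧ Fintype.card H ≤ (adjPairs π f).card + (K + 1)}
    have hex : ∀ f : Y, ∃ q : Option (H × H) × X,
        f.1 = match q.1 with
          | none => q.2.1
          | some (a, b) => conjSwap q.2.1 a b := by
      rintro ⟨f, hf, hc, hd⟩
      by_cases h : (adjPairs π f).card < Fintype.card H
      · obtain ⟨a, b, h1, h2⟩ := exists_switch hf hc hT hV h
        exact ⟨⟨some (a, b), ⟨conjSwap f a b, hf.conjSwap a b, h1, by omega⟩⟩,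
          (conjSwap_conjSwap f a b).symm⟩
      · exact ⟨⟨none, ⟨f, hf, hc, by omega⟩⟩, rfl⟩
    choose F hF using hex
    have hinj : Function.Injective F := fun f g h => Subtype.ext (by rw [hF f, hF g, h])
    have := Nat.card_le_card_of_injective F hinj
    rw [Nat.card_prod, Nat.card_eq_fintype_card (α := Option (H × H)), Fintype.card_option,
      Fintype.card_prod, ← sq] at this
    rw [pow_succ, mul_comm (_ ^ K), mul_assoc]
    exact this.trans (Nat.mul_le_mul_left _ ih)

/-- A lower bound for the number of simple connected perfect matchings when all degrees lie
between `2` and `T`. -/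
theorem core_count {π : H → V} {T M : ℕ}
    (h2 : ∀ v, 2 ≤ (Finset.univ.filter fun x => π x = v).card)
    (hT : ∀ v, (Finset.univ.filter fun x => π x = v).card ≤ T)
    (hV : 2 * (1 + T + T * T) < Fintype.card V) (hM : Fintype.card H = 2 * M) :
    (2 * M - 2 * (1 + T + T * T)).doubleFactorial ≤ ((2 * M) ^ 2 + 1) ^ (2 * (1 + T + T * T)) *
      Nat.card {f : H → H // Cfg f ∧ Conn π f ∧ Smp π f} := by
  set K := 2 * (1 + T + T * T) with hKdef
  obtain ⟨r⟩ : Nonempty V := Fintype.card_pos_iff.1 (by omega)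
  have hid : adjPairs π id = ∅ := by simp [adjPairs]
  have h := completions_card (K := K) (even_two_mul _) (by omega) h2 hT r M id {r}
    (fun x => rfl) (fun x hx => absurd rfl hx) (fun u hu => by rw [Finset.mem_singleton.1 hu])
    (by simp [hM]) (by
      right
      obtain ⟨x, hx⟩ := Finset.card_pos.1 (lt_of_lt_of_le two_pos (h2 r))
      exact ⟨x, rfl, by simpa using hx⟩) (by rw [hM]; exact (le_max_left (2 * M) K).trans (Nat.le_add_left _ _))
  refine h.trans ?_
  rw [← hM]
  refine le_trans ?_ (card_conn_defect_le hT hV K)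
  rw [← Nat.card_eq_finsetCard]
  refine Nat.card_le_card_of_injective (fun f => ⟨f.1, ?_⟩)
    (fun f g h => Subtype.ext (by simpa using h))
  have := mem_completions.1 f.2
  exact ⟨this.1, this.2.1, this.2.2.2⟩

end Switch

end PaperCM

namespace PaperCM

section Forest

/-- `s` attaches `D` to `W` in an acyclic way, given the owners `par` of the slots `D`. -/
def IsForest {D W : Type*} (par : D → Option W) (s : W → D) : Prop :=
  Function.Injective s ∧ ∃ rank : W → ℕ, ∀ w w', par (s w) = some w' → rank w' < rank w

open Classical in
/-- The owner map after gluing `w₀` to the slot `d₀`. -/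
noncomputable def contractPar {D W : Type*} (par : D → Option W) (d₀ : D) (w₀ : W)
    (d : {d // d ≠ d₀}) : Option {w // w ≠ w₀} :=
  (if par d = some w₀ then par d₀ else par d).bind
    fun w => if h : w ≠ w₀ then some ⟨w, h⟩ else none

theorem contractPar_eq_some {D W : Type*} {par : D → Option W} {d₀ : D} {w₀ : W}
    {d : {d // d ≠ d₀}} {w : {w // w ≠ w₀}} :
    contractPar par d₀ w₀ d = some w ↔
      (par d = some w₀ ∧ par d₀ = some w.1) ∨ par d = some w.1 := by
  classical
  obtain ⟨w, hw⟩ := w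
  unfold contractPar
  by_cases h : par d = some w₀
  · simp only [h, if_true, Option.bind_eq_some_iff, true_and, Option.some.injEq]
    constructor
    · rintro ⟨a, h1, h2⟩
      split_ifs at h2
      cases h2
      exact Or.inl h1
    · rintro (h1 | h1)
      · exact ⟨w, h1, by simp [hw]⟩
      · exact absurd h1.symm hw
  · simp only [h, if_false, Option.bind_eq_some_iff, false_and, false_or]
    constructor
    · rintro ⟨a, h1, h2⟩
      split_ifs at h2
      cases h2
      exact h1
    · intro h1
      exact ⟨w, h1, by simp [hw]⟩

open Classical in
/-- Extend an attachment of the contracted slots by `w₀ ↦ d₀`. -/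
noncomputable def expandForest {D W : Type*} (d₀ : D) (w₀ : W)
    (s : {w // w ≠ w₀} → {d // d ≠ d₀}) (w : W) : D :=
  if h : w ≠ w₀ then s ⟨w, h⟩ else d₀

theorem expandForest_isForest {D W : Type*} {par : D → Option W} {d₀ : D} {w₀ : W}
    (h₀ : par d₀ ≠ some w₀) {s : {w // w ≠ w₀} → {d // d ≠ d₀}}
    (hs : IsForest (contractPar par d₀ w₀) s) : IsForest par (expandForest d₀ w₀ s) := by
  classical
  obtain ⟨hinj, rank, hr⟩ := hs
  refine ⟨fun a b hab => ?_, fun w => if h : w ≠ w₀ then 2 * rank ⟨w, h⟩ + 2 else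
    ((par d₀).elim 1 fun u => if h : u ≠ w₀ then 2 * rank ⟨u, h⟩ + 3 else 0), fun w w' hw => ?_⟩
  · unfold expandForest at hab
    split_ifs at hab with h1 h2 h2
    · exact congrArg Subtype.val (hinj (Subtype.ext hab))
    · exact absurd hab (s _).2
    · exact absurd hab.symm (s _).2
    · rw [not_not.1 h1, not_not.1 h2]
  · unfold expandForest at hw
    by_cases h1 : w ≠ w₀
    · rw [dif_pos h1] at hw
      by_cases h2 : w' ≠ w₀
      · have := hr ⟨w, h1⟩ ⟨w', h2⟩ (contractPar_eq_some.2 (Or.inr hw))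
        simp only [h1, h2, ne_eq, not_false_eq_true, dif_pos]
        omega
      · rw [not_not] at h2
        subst h2
        simp only [h1, ne_eq, not_false_eq_true, dif_pos, not_true, dif_neg]
        cases h3 : par d₀ with
        | none => simp
        | some u =>
          have hu : u ≠ w' := fun h => h₀ (by rw [h3, h])
          have := hr ⟨w, h1⟩ ⟨u, hu⟩ (contractPar_eq_some.2 (Or.inl ⟨hw, h3⟩))
          simp only [Option.elim_some, hu, not_false_eq_true, dif_pos]
          omega
    · rw [dif_neg h1] at hw
      have h2 : w' ≠ w₀ := fun h => h₀ (by rw [hw, h])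
      simp [h1, h2, hw]

theorem forest_count (N : ℕ) : ∀ {D W : Type} [Fintype D] [Fintype W] (par : D → Option W) (t : D),
    par t = none → Fintype.card D = N + 1 → Fintype.card W = N + 1 →
    N.factorial ≤ Nat.card {s : W → D // IsForest par s} := by
  classical
  induction N with
  | zero =>
    intro D W _ _ par t ht hD hW
    have := Fintype.card_le_one_iff_subsingleton.1 hW.le
    rw [Nat.factorial_zero, Nat.succ_le_iff, Nat.card_pos_iff]
    refine ⟨⟨⟨fun _ => t, fun _ _ _ => Subsingleton.elim _ _, fun _ => 0, ?_⟩⟩, inferInstance⟩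
    intro w w' h
    rw [ht] at h
    cases h
  | succ N ih =>
    intro D W _ _ par t ht hD hW
    obtain ⟨d₀, hd₀⟩ := Fintype.exists_ne_of_one_lt_card (by omega : 1 < Fintype.card D) t
    let A := {w₀ : W // par d₀ ≠ some w₀}
    have hA : N + 1 ≤ Fintype.card A := by
      have h1 : Fintype.card {w₀ : W // par d₀ = some w₀} ≤ 1 :=
        Fintype.card_le_one_iff.2 fun a b => Subtype.ext
          (Option.some_injective _ (a.2.symm.trans b.2))
      have h2 := Fintype.card_subtype_compl (fun w₀ : W => par d₀ = some w₀)
      change Fintype.card A = _ at h2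
      omega
    have hW' : ∀ w₀ : W, Fintype.card {w // w ≠ w₀} = N + 1 := fun w₀ => by
      have := Fintype.card_subtype_compl (fun w : W => w = w₀)
      rw [Fintype.card_subtype_eq] at this
      exact this.trans (by omega)
    have hD' : Fintype.card {d // d ≠ d₀} = N + 1 := by
      have := Fintype.card_subtype_compl (fun w : D => w = d₀)
      rw [Fintype.card_subtype_eq] at this
      exact this.trans (by omega)
    have hih : ∀ w₀ : A, N.factorial ≤ Nat.card {s // IsForest (contractPar par d₀ w₀.1) s} := by
      intro w₀
      refine ih _ ⟨t, hd₀.symm⟩ ?_ hD' (hW' _)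
      rw [Option.eq_none_iff_forall_ne_some]
      intro w hw
      rcases contractPar_eq_some.1 hw with h | h
      · simp [ht] at h
      · simp [ht] at h
    have hsig : (N + 1).factorial ≤
        Nat.card (Σ w₀ : A, {s // IsForest (contractPar par d₀ w₀.1) s}) := by
      rw [Nat.card_sigma, Nat.factorial_succ]
      calc (N + 1) * N.factorial ≤ ∑ _ : A, N.factorial := by
            rw [Finset.sum_const, smul_eq_mul]
            exact Nat.mul_le_mul_right _ hA
        _ ≤ _ := Finset.sum_le_sum fun w₀ _ => hih w₀
    refine hsig.trans (Nat.card_le_card_of_injective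
      (fun q => ⟨expandForest d₀ q.1.1 q.2.1, expandForest_isForest q.1.2 q.2.2⟩) ?_)
    rintro ⟨⟨w, hw⟩, s, hs⟩ ⟨⟨w', hw'⟩, s', hs'⟩ h
    rw [Subtype.mk.injEq] at h
    have hww : w = w' := by
      by_contra hne
      have := congrFun h w
      simp only [expandForest, ne_eq, not_true, dif_neg, hne, not_false_eq_true, dif_pos] at this
      exact (s' _).2 this.symm
    subst hww
    have : s = s' := by
      funext a
      have := congrFun h a.1
      simp only [expandForest, a.2, ne_eq, not_false_eq_true, dif_pos] at this
      exact Subtype.ext this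
    subst this
    rfl

end Forest

end PaperCM

namespace PaperCM

set_option linter.unusedSectionVars false

open Relation

section Glue

/-- `v` carries exactly one half-edge of `up`. -/
def Sg {H V : Type*} (π : H → V) (up : H → Prop) (v : V) : Prop := ∃! x, π x = v ∧ up x

/-- `up` marks the half-edges towards the core in a matching whose core has degrees in `[2, T]`
and whose tree part consists of `N + 1` vertices. -/
structure Valid {H V : Type*} (π : H → V) (T N : ℕ) (up : H → Prop) : Prop where
  ex : ∀ v, ∃ x, π x = v ∧ up x
  le : ∀ v, ¬ Sg π up v → Nat.card {x // π x = v ∧ up x} ≤ T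
  card_down : Nat.card {x // ¬ up x} = N + 1
  card_single : Nat.card {v // Sg π up v} = N + 1
  core_down : ∃ x, ¬ up x ∧ ¬ Sg π up (π x)
  big : 2 * (1 + T + T * T) < Nat.card {v // ¬ Sg π up v}

/-- The matching `f` is oriented towards its core by `up`. -/
def Compat {H V : Type*} (π : H → V) (up : H → Prop) (f : H → H) : Prop :=
  (∀ x, up x → Sg π up (π x) → ¬ up (f x)) ∧
    ∃ rank : V → ℕ, ∀ x, ¬ up x → up (f x) ∧ Sg π up (π (f x)) ∧ rank (π x) < rank (π (f x))

theorem Compat.down_sub {H V : Type*} [Finite V] {π : H → V} {up up' : H → Prop} {f : H → H}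
    (hf : Cfg f) (h : Compat π up f) (h' : Compat π up' f) (hex : ∀ v, ∃ x, π x = v ∧ up' x)
    (x : H) (hx : ¬ up x) : ¬ up' x := by
  obtain ⟨-, rank, hr⟩ := h
  obtain ⟨B, hB⟩ : ∃ B, ∀ v, rank v ≤ B := by
    obtain ⟨B, hB⟩ := (Set.finite_range rank).bddAbove
    exact ⟨B, fun v => hB ⟨v, rfl⟩⟩
  obtain ⟨m, hm⟩ : ∃ m, B - rank (π x) = m := ⟨_, rfl⟩
  induction m using Nat.strong_induction_on generalizing x with
  | _ m ih =>
  obtain ⟨h1, ⟨y, -, hy⟩, h3⟩ := hr x hx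
  have hy1 : f x = y := hy _ ⟨rfl, h1⟩
  have key : ∀ z, π z = π (f x) → up' z → z = f x := by
    intro z hz hz'
    by_contra hne
    have hdz : ¬ up z := fun hu => hne ((hy z ⟨hz, hu⟩).trans hy1.symm)
    have hb := hB (π z)
    refine ih (B - rank (π z)) ?_ z hdz rfl hz'
    rw [hz] at hb ⊢
    omega
  obtain ⟨z, hz, hz'⟩ := hex (π (f x))
  have hzx := key z hz hz'
  rw [hzx] at hz'
  have := h'.1 (f x) hz' ⟨f x, ⟨rfl, hz'⟩, fun w hw => key w hw.1 hw.2⟩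
  rwa [hf.1 x] at this

theorem Compat.unique {H V : Type*} [Finite V] {π : H → V} {up up' : H → Prop} {f : H → H}
    (hf : Cfg f) (h : Compat π up f) (h' : Compat π up' f) (hex : ∀ v, ∃ x, π x = v ∧ up x)
    (hex' : ∀ v, ∃ x, π x = v ∧ up' x) : up = up' := by
  funext x
  exact propext ⟨fun hx => by_contra fun hn => h'.down_sub hf h hex x hn hx,
    fun hx => by_contra fun hn => h.down_sub hf h' hex' x hn hx⟩

variable {H V : Type} {π : H → V} {up : H → Prop}

/-- The core half-edges. -/
abbrev CoreH (π : H → V) (up : H → Prop) := {x // up x ∧ ¬ Sg π up (π x)}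

/-- The core vertices. -/
abbrev CoreV (π : H → V) (up : H → Prop) := {v // ¬ Sg π up v}

/-- The vertex of a core half-edge. -/
def coreπ (π : H → V) (up : H → Prop) (x : CoreH π up) : CoreV π up := ⟨π x.1, x.2.2⟩

open Classical in
/-- The tree vertex carrying a down half-edge. -/
noncomputable def downPar (π : H → V) (up : H → Prop) (d : {x // ¬ up x}) :
    Option {v // Sg π up v} :=
  if h : Sg π up (π d.1) then some ⟨π d.1, h⟩ else none

/-- The up half-edge of a tree vertex. -/
noncomputable def hub (w : {v // Sg π up v}) : H := w.2.choose

theorem hub_vertex (w : {v // Sg π up v}) : π (hub w) = w.1 := w.2.choose_spec.1.1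

theorem hub_up (w : {v // Sg π up v}) : up (hub w) := w.2.choose_spec.1.2

theorem eq_hub (w : {v // Sg π up v}) {x : H} (h1 : π x = w.1) (h2 : up x) : x = hub w :=
  w.2.choose_spec.2 x ⟨h1, h2⟩

theorem hub_single (w : {v // Sg π up v}) : Sg π up (π (hub w)) := by
  rw [hub_vertex w]
  exact w.2

open Classical in
/-- Glue a core matching and a forest. -/
noncomputable def glue (g : CoreH π up → CoreH π up) (s : {v // Sg π up v} ≃ {x // ¬ up x})
    (x : H) : H :=
  if hu : up x then (if hs : Sg π up (π x) then (s ⟨π x, hs⟩).1 else (g ⟨x, hu, hs⟩).1)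
  else hub (s.symm ⟨x, hu⟩)

variable {g : CoreH π up → CoreH π up} {s : {v // Sg π up v} ≃ {x // ¬ up x}}

theorem glue_hub (w : {v // Sg π up v}) : glue g s (hub w) = s w := by
  unfold glue
  rw [dif_pos (hub_up w), dif_pos (hub_single w)]
  congr 2
  exact Subtype.ext (hub_vertex w)

theorem glue_core (c : CoreH π up) : glue g s c.1 = g c := by
  unfold glue
  rw [dif_pos c.2.1, dif_neg c.2.2]

theorem glue_down (w : {v // Sg π up v}) : glue g s (s w).1 = hub w := by
  unfold glue
  rw [dif_neg (s w).2]
  congr 1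
  exact s.symm_apply_apply w

theorem glue_cases (s : {v // Sg π up v} ≃ {x // ¬ up x}) (x : H) :
    (∃ w : {v // Sg π up v}, x = hub w) ∨ (∃ c : CoreH π up, x = c.1) ∨
      ∃ w : {v // Sg π up v}, x = (s w).1 := by
  by_cases hu : up x
  · by_cases hs : Sg π up (π x)
    · exact Or.inl ⟨⟨π x, hs⟩, eq_hub _ rfl hu⟩
    · exact Or.inr (Or.inl ⟨⟨x, hu, hs⟩, rfl⟩)
  · exact Or.inr (Or.inr ⟨s.symm ⟨x, hu⟩, by simp⟩)

theorem downPar_eq_some {d : {x // ¬ up x}} {w : {v // Sg π up v}} :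
    downPar π up d = some w ↔ π d.1 = w.1 := by
  unfold downPar
  split_ifs with h
  · rw [Option.some.injEq, Subtype.ext_iff]
  · simp only [false_iff]
    intro h'
    exact h (h' ▸ w.2)

theorem glue_cfg (hg : Cfg g) : Cfg (glue g s) := by
  refine ⟨fun x => ?_, fun x hx => ?_⟩
  · rcases glue_cases s x with ⟨w, rfl⟩ | ⟨c, rfl⟩ | ⟨w, rfl⟩
    · rw [glue_hub, glue_down]
    · rw [glue_core, glue_core, hg.1]
    · rw [glue_down, glue_hub]
  · rcases glue_cases s x with ⟨w, rfl⟩ | ⟨c, rfl⟩ | ⟨w, rfl⟩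
    · rw [glue_hub] at hx
      exact (s w).2 (hx ▸ hub_up w)
    · rw [glue_core] at hx
      exact hg.2 c (Subtype.ext hx)
    · rw [glue_down] at hx
      exact (s w).2 (hx ▸ hub_up w)

theorem glue_smp (hg : Smp (coreπ π up) g) (hs : IsForest (downPar π up) s) :
    Smp π (glue g s) := by
  obtain ⟨-, rank, hr⟩ := hs
  have hlt : ∀ w w' : {v // Sg π up v}, π (s w).1 = w'.1 → rank w' < rank w :=
    fun w w' h => hr w w' (downPar_eq_some.2 h)
  have hne : ∀ w : {v // Sg π up v}, π (s w).1 ≠ w.1 := fun w h => (hlt w w h).false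
  refine ⟨fun x => ?_, fun x y h1 h2 => ?_⟩
  · rcases glue_cases s x with ⟨w, rfl⟩ | ⟨c, rfl⟩ | ⟨w, rfl⟩
    · rw [glue_hub, hub_vertex w]
      exact hne w
    · rw [glue_core]
      exact fun h => hg.1 c (Subtype.ext h)
    · rw [glue_down, hub_vertex w]
      exact (hne w).symm
  · rcases glue_cases s x with ⟨w, rfl⟩ | ⟨c, rfl⟩ | ⟨w, rfl⟩ <;>
      rcases glue_cases s y with ⟨w', rfl⟩ | ⟨c', rfl⟩ | ⟨w', rfl⟩ <;>
      simp only [glue_hub, glue_core, glue_down, hub_vertex] at h1 h2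
    · rw [Subtype.ext h1]
    · exact absurd (h1 ▸ w.2) c'.2.2
    · exact absurd (hlt _ _ h2) (hlt _ _ h1.symm).le.not_gt
    · exact absurd (h1.symm ▸ w'.2) c.2.2
    · exact congrArg Subtype.val (hg.2 c c' (Subtype.ext h1) (Subtype.ext h2))
    · exact absurd (h2.symm ▸ w'.2) (g c).2.2
    · exact absurd (hlt _ _ h1) (hlt _ _ h2.symm).le.not_gt
    · exact absurd (h2 ▸ w.2) (g c').2.2
    · rw [Subtype.ext h2]

theorem glue_conn [Fintype H] [Fintype V] (hg : Cfg g) (hc : Conn (coreπ π up) g) (hs : IsForest (downPar π up) s) :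
    Conn π (glue g s) := by
  classical
  have hcfg := (glue_cfg (s := s) hg).1
  obtain ⟨-, rank, hr⟩ := hs
  have hcore : ∀ u v : CoreV π up, ReflTransGen (Adj π (glue g s)) u.1 v.1 := by
    intro u v
    refine ReflTransGen.lift Subtype.val ?_ _ _ (hc u v)
    rintro _ _ ⟨x, rfl, rfl⟩
    exact ⟨x.1, rfl, by rw [glue_core]; rfl⟩
  have hreach : ∀ m, ∀ w : {v // Sg π up v}, rank w = m →
      ∃ c : CoreV π up, ReflTransGen (Adj π (glue g s)) w.1 c.1 := by
    intro m
    induction m using Nat.strong_induction_on with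
    | _ m ih =>
    rintro w rfl
    have hadj : Adj π (glue g s) w.1 (π (s w).1) := ⟨hub w, hub_vertex w, by rw [glue_hub]⟩
    by_cases h : Sg π up (π (s w).1)
    · obtain ⟨c, hc'⟩ := ih _ (hr w ⟨_, h⟩ (downPar_eq_some.2 rfl)) ⟨_, h⟩ rfl
      exact ⟨c, .head hadj hc'⟩
    · exact ⟨⟨_, h⟩, .single hadj⟩
  have hreach' : ∀ v, ∃ c : CoreV π up, ReflTransGen (Adj π (glue g s)) v c.1 := by
    intro v
    by_cases h : Sg π up v
    · exact hreach _ ⟨v, h⟩ rfl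
    · exact ⟨⟨v, h⟩, .refl⟩
  intro u v
  obtain ⟨c, h1⟩ := hreach' u
  obtain ⟨c', h2⟩ := hreach' v
  exact (h1.trans (hcore c c')).trans (reach_symm hcfg h2)

theorem glue_compat (hs : IsForest (downPar π up) s) : Compat π up (glue g s) := by
  classical
  obtain ⟨-, rank, hr⟩ := hs
  refine ⟨fun x hx hx' => ?_, fun v => if h : Sg π up v then rank ⟨v, h⟩ + 1 else 0,
    fun x hx => ?_⟩
  · obtain ⟨w, rfl⟩ : ∃ w : {v // Sg π up v}, x = hub w := ⟨⟨_, hx'⟩, eq_hub _ rfl hx⟩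
    rw [glue_hub]
    exact (s w).2
  · obtain ⟨w, rfl⟩ : ∃ w : {v // Sg π up v}, x = (s w).1 := ⟨s.symm ⟨x, hx⟩, by simp⟩
    rw [glue_down]
    refine ⟨hub_up w, hub_single w, ?_⟩
    simp only [hub_vertex w, w.2, dif_pos]
    split_ifs with h
    · exact Nat.succ_lt_succ (hr w ⟨_, h⟩ (downPar_eq_some.2 rfl))
    · omega

theorem glue_injective {g g' : CoreH π up → CoreH π up}
    {s s' : {v // Sg π up v} ≃ {x // ¬ up x}} (h : glue g s = glue g' s') : g = g' ∧ s = s' := by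
  constructor
  · funext c
    have := congrFun h c.1
    rw [glue_core, glue_core] at this
    exact Subtype.ext this
  · refine Equiv.ext fun w => ?_
    have := congrFun h (hub w)
    rw [glue_hub, glue_hub] at this
    exact Subtype.ext this

theorem valid_count [Fintype H] [Fintype V] {T N M : ℕ} (hv : Valid π T N up)
    (hM : 2 * M + 2 * (N + 1) = Fintype.card H) :
    (2 * M - 2 * (1 + T + T * T)).doubleFactorial * N.factorial ≤
      ((2 * M) ^ 2 + 1) ^ (2 * (1 + T + T * T)) *
      Nat.card {f : H → H // (Cfg f ∧ Conn π f ∧ Smp π f) ∧ Compat π up f} := by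
  classical
  have cD := hv.card_down
  have cW := hv.card_single
  have hfor := forest_count N (downPar π up) (D := {x // ¬ up x}) (W := {v // Sg π up v})
  have hcore := core_count (π := coreπ π up) (T := T) (M := M)
  set K := 2 * (1 + T + T * T)
  have fib : ∀ v : CoreV π up, (Finset.univ.filter fun x => coreπ π up x = v).card =
      Nat.card {x // π x = v.1 ∧ up x} := by
    intro v
    rw [← Nat.card_eq_finsetCard]
    refine Nat.card_congr ⟨fun x => ⟨x.1.1, ?_, x.1.2.1⟩, fun x => ⟨⟨x.1, x.2.2, ?_⟩, ?_⟩,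
      fun _ => rfl, fun _ => rfl⟩
    · have := (Finset.mem_filter.1 x.2).2
      exact congrArg Subtype.val this
    · rw [x.2.1]
      exact v.2
    · simp only [Finset.mem_filter, Finset.mem_univ, true_and]
      exact Subtype.ext x.2.1
  have h1 := hcore (fun v => by
    rw [fib]
    have : 1 < Nat.card {x // π x = v.1 ∧ up x} := by
      rw [Finite.one_lt_card_iff_nontrivial]
      obtain ⟨x, hx⟩ := hv.ex v.1
      by_contra hn
      rw [not_nontrivial_iff_subsingleton] at hn
      exact v.2 ⟨x, hx, fun y hy => congrArg Subtype.val
        (Subsingleton.elim (⟨y, hy⟩ : {x // π x = v.1 ∧ up x}) ⟨x, hx⟩)⟩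
    exact this) (fun v => by
    rw [fib]
    exact hv.le _ v.2) (by
    rw [← Nat.card_eq_fintype_card]
    exact hv.big) (by
    have e1 := Fintype.card_subtype_compl up
    have e2 : Fintype.card {x // up x} = Fintype.card (CoreH π up) +
        Fintype.card {v // Sg π up v} := by
      have e3 := Fintype.card_congr (Equiv.sumCompl (fun x : {x // up x} => Sg π up (π x.1)))
      rw [Fintype.card_sum] at e3
      rw [← e3, add_comm]
      congr 1
      · exact Fintype.card_congr (Equiv.subtypeSubtypeEquivSubtypeInter up
          fun x => ¬ Sg π up (π x))
      · refine Fintype.card_congr ⟨fun x => ⟨_, x.2⟩, fun w => ⟨⟨hub w, hub_up w⟩, hub_single w⟩,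
          fun x => ?_, fun w => ?_⟩
        · exact Subtype.ext (Subtype.ext (eq_hub ⟨_, x.2⟩ rfl x.1.2).symm)
        · exact Subtype.ext (hub_vertex w)
    have e4 := Fintype.card_subtype_le up
    rw [Nat.card_eq_fintype_card] at cD cW
    omega)
  obtain ⟨x₀, hx₀, hx₀'⟩ := hv.core_down
  have h2 := hfor ⟨x₀, hx₀⟩ (by unfold downPar; rw [dif_neg hx₀'])
    (by rw [← cD, Nat.card_eq_fintype_card]) (by rw [← cW, Nat.card_eq_fintype_card])
  have hbij : ∀ s : {s // IsForest (downPar π up) s}, Function.Bijective s.1 := fun s =>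
    (Fintype.bijective_iff_injective_and_card _).2 ⟨s.2.1, by
      rw [← Nat.card_eq_fintype_card, ← Nat.card_eq_fintype_card, cD, cW]⟩
  refine (Nat.mul_le_mul h1 h2).trans ?_
  rw [mul_assoc]
  refine Nat.mul_le_mul_left _ ?_
  rw [← Nat.card_prod]
  refine Nat.card_le_card_of_injective
    (fun q => ⟨glue q.1.1 (Equiv.ofBijective q.2.1 (hbij q.2)),
      ⟨glue_cfg q.1.2.1, glue_conn q.1.2.1 q.1.2.2.1 q.2.2, glue_smp q.1.2.2.2 q.2.2⟩,
      glue_compat q.2.2⟩) ?_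
  rintro ⟨⟨g, hg⟩, s⟩ ⟨⟨g', hg'⟩, s'⟩ h
  obtain ⟨h3, h4⟩ := glue_injective (congrArg Subtype.val h)
  have : s = s' := Subtype.ext (congrArg (fun e : _ ≃ _ => (e : _ → _)) h4)
  subst this
  have h3 : g = g' := h3
  subst h3
  rfl

/-- Summing the contributions of a family of distinct orientations. -/
theorem family_count [Fintype H] [Fintype V] {T N M : ℕ} {I : Type} [Finite I]
    (ups : I → H → Prop) (hups : Function.Injective ups) (hv : ∀ i, Valid π T N (ups i))
    (hM : 2 * M + 2 * (N + 1) = Fintype.card H) :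
    Nat.card I * ((2 * M - 2 * (1 + T + T * T)).doubleFactorial * N.factorial) ≤
      ((2 * M) ^ 2 + 1) ^ (2 * (1 + T + T * T)) *
      Nat.card {f : H → H // Cfg f ∧ Conn π f ∧ Smp π f} := by
  classical
  have := Fintype.ofFinite I
  calc _ = ∑ _ : I, (2 * M - 2 * (1 + T + T * T)).doubleFactorial * N.factorial := by
        rw [Finset.sum_const, smul_eq_mul, Finset.card_univ, Nat.card_eq_fintype_card]
    _ ≤ ∑ i : I, ((2 * M) ^ 2 + 1) ^ (2 * (1 + T + T * T)) *
        Nat.card {f : H → H // (Cfg f ∧ Conn π f ∧ Smp π f) ∧ Compat π (ups i) f} :=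
      Finset.sum_le_sum fun i _ => valid_count (hv i) hM
    _ = ((2 * M) ^ 2 + 1) ^ (2 * (1 + T + T * T)) * Nat.card
        (Σ i : I, {f : H → H // (Cfg f ∧ Conn π f ∧ Smp π f) ∧ Compat π (ups i) f}) := by
      rw [Nat.card_sigma, Finset.mul_sum]
    _ ≤ _ := by
      refine Nat.mul_le_mul_left _ (Nat.card_le_card_of_injective (fun q => ⟨q.2.1, q.2.2.1⟩) ?_)
      rintro ⟨i, f, hf, hc⟩ ⟨j, f', hf', hc'⟩ h
      obtain rfl : f = f' := congrArg Subtype.val h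
      obtain rfl : i = j := hups (Compat.unique hf.1 hc hc' (hv i).ex (hv j).ex)
      rfl

end Glue

end PaperCM

namespace PaperCM

set_option linter.unusedSectionVars false

open Equiv

section Labels

/-- The number of permutations preserving a labelling. -/
theorem card_perm_comp_eq {V ι : Type*} [Finite V] (f : V → ι) (S : Finset ι)
    (hS : ∀ v, f v ∈ S) :
    Nat.card {g : Perm V // f ∘ g = f} = ∏ i ∈ S, (Nat.card {a // f a = i}).factorial := by
  classical
  cases nonempty_fintype V
  rw [Nat.card_eq_fintype_card, DomMulAct.stabilizer_card']
  simp only [Nat.card_eq_fintype_card]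
  refine Finset.prod_subset (fun i hi => ?_) fun i _ hi => ?_
  · obtain ⟨v, -, rfl⟩ := Finset.mem_image.1 hi
    exact hS v
  · have : IsEmpty {a // f a = i} := ⟨fun a => hi (Finset.mem_image.2 ⟨a.1, Finset.mem_univ _, a.2⟩)⟩
    rw [Fintype.card_eq_zero, Nat.factorial_zero]

variable {V : Type} [Fintype V] {deg : V → ℕ}

/-- The half-edges selected by a label. -/
def labelUp (deg : V → ℕ) (φ : V → Finset ℕ) (x : Σ v, Fin (deg v)) : Prop := (x.2 : ℕ) ∈ φ x.1

/-- The labels all select nonempty sets of half-edges. -/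
def GoodLabel (deg : V → ℕ) (φ : V → Finset ℕ) : Prop :=
  ∀ v, φ v ⊆ Finset.range (deg v) ∧ (φ v).Nonempty

/-- The numerical conditions on a labelling that make it valid. -/
structure ValidLabel (deg : V → ℕ) (T N : ℕ) (φ : V → Finset ℕ) : Prop where
  good : GoodLabel deg φ
  le : ∀ v, (φ v).card ≠ 1 → (φ v).card ≤ T
  card_down : ∑ v, (deg v - (φ v).card) = N + 1
  card_single : Nat.card {v // (φ v).card = 1} = N + 1
  core_down : ∃ v, (φ v).card ≠ 1 ∧ (φ v).card < deg v
  big : 2 * (1 + T + T * T) < Nat.card {v // (φ v).card ≠ 1}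

theorem ValidLabel.comp {T N : ℕ} {φ : V → Finset ℕ} (h : ValidLabel deg T N φ) {e : Perm V}
    (he : deg ∘ e = deg) : ValidLabel deg T N (φ ∘ e) := by
  have he' : ∀ v, deg (e v) = deg v := congrFun he
  refine ⟨fun v => ?_, fun v hv => h.le _ hv, ?_, ?_, ?_, ?_⟩
  · rw [← he']
    exact h.good (e v)
  · rw [← h.card_down, ← Equiv.sum_comp e fun v => deg v - (φ v).card]
    exact Finset.sum_congr rfl fun v _ => by rw [he', Function.comp]
  · rw [← h.card_single]
    exact Nat.card_congr (e.subtypeEquiv fun v => Iff.rfl)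
  · obtain ⟨v, hv⟩ := h.core_down
    refine ⟨e.symm v, ?_⟩
    rw [← he' (e.symm v), Function.comp, e.apply_symm_apply]
    exact hv
  · refine h.big.trans_eq ?_
    exact Nat.card_congr (e.symm.subtypeEquiv fun v => by simp)

/-- The selected half-edges at a vertex. -/
noncomputable def labelEquiv {φ : V → Finset ℕ} (h : GoodLabel deg φ) (v : V) :
    {x : Σ v, Fin (deg v) // x.1 = v ∧ labelUp deg φ x} ≃ {i // i ∈ φ v} where
  toFun x := ⟨x.1.2, by
    obtain ⟨x, rfl, h2⟩ := x
    exact h2⟩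
  invFun i := ⟨⟨v, i.1, Finset.mem_range.1 ((h v).1 i.2)⟩, rfl, i.2⟩
  left_inv := by
    rintro ⟨⟨w, i⟩, rfl, h2⟩
    rfl
  right_inv i := rfl

theorem card_label {φ : V → Finset ℕ} (h : GoodLabel deg φ) (v : V) :
    Nat.card {x : Σ v, Fin (deg v) // x.1 = v ∧ labelUp deg φ x} = (φ v).card := by
  rw [Nat.card_congr (labelEquiv h v), Nat.card_eq_fintype_card, Fintype.card_coe]

theorem sg_label {φ : V → Finset ℕ} (h : GoodLabel deg φ) (v : V) :
    Sg Sigma.fst (labelUp deg φ) v ↔ (φ v).card = 1 := by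
  rw [← card_label h, Nat.card_eq_one_iff_unique, Sg]
  constructor
  · rintro ⟨x, hx, hu⟩
    exact ⟨⟨fun a b => Subtype.ext ((hu _ a.2).trans (hu _ b.2).symm)⟩, ⟨⟨x, hx⟩⟩⟩
  · rintro ⟨⟨hs⟩, ⟨x⟩⟩
    exact ⟨x.1, x.2, fun y hy => congrArg Subtype.val (hs ⟨y, hy⟩ x)⟩

theorem ValidLabel.valid {T N : ℕ} {φ : V → Finset ℕ} (h : ValidLabel deg T N φ) :
    Valid Sigma.fst T N (labelUp deg φ) := by
  classical
  have hsg := sg_label h.good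
  refine ⟨fun v => ?_, fun v hv => ?_, ?_, ?_, ?_, ?_⟩
  · obtain ⟨i, hi⟩ := (h.good v).2
    exact ⟨_, ((labelEquiv h.good v).symm ⟨i, hi⟩).2⟩
  · rw [card_label h.good]
    exact h.le v fun h' => hv ((hsg v).2 h')
  · rw [← h.card_down]
    have e : {x : Σ v, Fin (deg v) // ¬ labelUp deg φ x} ≃
        Σ v, {i : ℕ // i ∈ Finset.range (deg v) \ φ v} :=
      { toFun := fun x => ⟨x.1.1, x.1.2, Finset.mem_sdiff.2 ⟨Finset.mem_range.2 x.1.2.2, x.2⟩⟩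
        invFun := fun x => ⟨⟨x.1, x.2.1, Finset.mem_range.1 (Finset.mem_sdiff.1 x.2.2).1⟩,
          (Finset.mem_sdiff.1 x.2.2).2⟩
        left_inv := fun _ => rfl
        right_inv := fun _ => rfl }
    rw [Nat.card_congr e, Nat.card_sigma]
    refine Finset.sum_congr rfl fun v _ => ?_
    rw [Nat.card_eq_fintype_card, Fintype.card_coe, Finset.card_sdiff_of_subset (h.good v).1,
      Finset.card_range]
  · rw [← h.card_single]
    exact Nat.card_congr (Equiv.subtypeEquivRight hsg)
  · obtain ⟨v, h1, h2⟩ := h.core_down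
    obtain ⟨i, hi, hi'⟩ : ∃ i ∈ Finset.range (deg v), i ∉ φ v := by
      by_contra hcon
      push Not at hcon
      have := Finset.card_le_card (s := Finset.range (deg v)) hcon
      rw [Finset.card_range] at this
      omega
    exact ⟨⟨v, i, Finset.mem_range.1 hi⟩, hi', fun h' => h1 ((hsg v).1 h')⟩
  · refine h.big.trans_eq ?_
    exact Nat.card_congr (Equiv.subtypeEquivRight fun v => not_congr (hsg v).symm)

theorem labelUp_injective {φ φ' : V → Finset ℕ} (h : GoodLabel deg φ) (h' : GoodLabel deg φ')
    (he : labelUp deg φ = labelUp deg φ') : φ = φ' := by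
  funext v
  ext i
  constructor <;> intro hi
  · exact (congrFun he ⟨v, i, Finset.mem_range.1 ((h v).1 hi)⟩).mp hi
  · exact (congrFun he ⟨v, i, Finset.mem_range.1 ((h' v).1 hi)⟩).mpr hi

/-- The lower bound for simple connected matchings obtained from one valid labelling. -/
theorem label_count {T N M : ℕ} {φ : V → Finset ℕ} (h : ValidLabel deg T N φ)
    (hM : 2 * M + 2 * (N + 1) = ∑ v, deg v) (S : Finset ℕ) (hS : ∀ v, deg v ∈ S)
    (S' : Finset (ℕ × Finset ℕ)) (hS' : ∀ v, (deg v, φ v) ∈ S') :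
    (∏ k ∈ S, (Nat.card {v // deg v = k}).factorial) *
      ((2 * M - 2 * (1 + T + T * T)).doubleFactorial * N.factorial) ≤
    (∏ q ∈ S', (Nat.card {v // (deg v, φ v) = q}).factorial) *
      (((2 * M) ^ 2 + 1) ^ (2 * (1 + T + T * T)) *
      Nat.card {f : (Σ v, Fin (deg v)) → (Σ v, Fin (deg v)) //
        Cfg f ∧ Conn Sigma.fst f ∧ Smp Sigma.fst f}) := by
  classical
  let I := {ψ : V → Finset ℕ // ∃ e : Perm V, deg ∘ e = deg ∧ ψ = φ ∘ e}
  have hfin : Finite I := by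
    let F : {e : Perm V // deg ∘ e = deg} → I := fun e => ⟨φ ∘ e.1, e.1, e.2, rfl⟩
    refine Finite.of_surjective F ?_
    rintro ⟨_, e, he, rfl⟩
    exact ⟨⟨e, he⟩, rfl⟩
  have hval : ∀ i : I, ValidLabel deg T N i.1 := by
    rintro ⟨_, e, he, rfl⟩
    exact h.comp he
  have hcount := family_count (π := Sigma.fst) (M := M) (fun i : I => labelUp deg i.1)
    (fun i j hij => Subtype.ext (labelUp_injective (hval i).good (hval j).good hij))
    (fun i => (hval i).valid) (by rw [hM, Fintype.card_sigma]; simp)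
  have horb : (∏ k ∈ S, (Nat.card {v // deg v = k}).factorial) ≤
      (∏ q ∈ S', (Nat.card {v // (deg v, φ v) = q}).factorial) * Nat.card I := by
    rw [← card_perm_comp_eq deg S hS, ← card_perm_comp_eq (fun v => (deg v, φ v)) S' hS',
      ← Nat.card_prod]
    choose E hE hE' using fun i : I => i.2
    let F : {e : Perm V // deg ∘ e = deg} → I := fun e => ⟨φ ∘ e.1, e.1, e.2, rfl⟩
    have hd : ∀ i v, deg ((E i).symm v) = deg v := fun i v => by
      have := congrFun (hE i) ((E i).symm v)
      simpa using this.symm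
    refine Nat.card_le_card_of_injective (fun e => (⟨(E (F e)).symm.trans e.1, ?_⟩, F e)) ?_
    · funext v
      have h1 : φ (e.1 ((E (F e)).symm v)) = φ v := by
        have h2 : φ ∘ e.1 = φ ∘ E (F e) := hE' (F e)
        have := congrFun h2 ((E (F e)).symm v)
        simpa using this
      have h2 : deg (e.1 ((E (F e)).symm v)) = deg v := (congrFun e.2 _).trans (hd _ v)
      exact Prod.ext h2 h1
    · rintro ⟨e, he⟩ ⟨e', he'⟩ hee
      obtain ⟨h1, h2⟩ := Prod.ext_iff.1 hee
      have h1 := congrArg Subtype.val h1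
      simp only at h1 h2
      rw [h2] at h1
      refine Subtype.ext (Equiv.ext fun v => ?_)
      have := congrArg (fun q : Perm V => q (E (F ⟨e', he'⟩) v)) h1
      simpa using this
  calc _ ≤ (∏ q ∈ S', (Nat.card {v // (deg v, φ v) = q}).factorial) * Nat.card I *
      ((2 * M - 2 * (1 + T + T * T)).doubleFactorial * N.factorial) :=
        Nat.mul_le_mul_right _ horb
    _ ≤ _ := by
      rw [mul_assoc]
      exact Nat.mul_le_mul_left _ hcount

end Labels

end PaperCM

namespace PaperCM

set_option linter.unusedSectionVars false

open Equiv Relation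

section CardCfg

theorem card_cfg {H : Type*} [Fintype H] {h : ℕ} (hH : Fintype.card H = 2 * h) :
    Nat.card {f : H → H // Cfg f} = (2 * h - 1).doubleFactorial := by
  classical
  have key : ∀ g : Perm H, Cfg g ↔ g.cycleType = Multiset.replicate h 2 := by
    intro g
    constructor
    · rintro ⟨h1, h2⟩
      have hg : g ^ 2 = 1 := Equiv.ext fun x => by rw [sq]; exact h1 x
      have hall : ∀ n ∈ g.cycleType, n = 2 := fun n hn =>
        le_antisymm (Nat.le_of_dvd two_pos ((Perm.dvd_of_mem_cycleType hn).trans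
          (orderOf_dvd_of_pow_eq_one hg))) (Perm.two_le_of_mem_cycleType hn)
      have hs : g.support = Finset.univ := by
        ext x
        simp [h2 x]
      have hsum := Perm.sum_cycleType g
      rw [hs, Finset.card_univ, hH, Multiset.eq_replicate_of_mem hall, Multiset.sum_replicate,
        smul_eq_mul] at hsum
      rw [Multiset.eq_replicate_of_mem hall]
      congr 1
      omega
    · intro hg
      have hsum := Perm.sum_cycleType g
      have hl := Perm.lcm_cycleType g
      rw [hg] at hsum hl
      rw [Multiset.sum_replicate, smul_eq_mul, mul_comm, ← hH, ← Finset.card_univ] at hsum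
      have hs := Finset.eq_univ_of_card _ hsum.symm
      have hd : orderOf g ∣ 2 := by
        rw [← hl]
        exact Multiset.lcm_dvd.2 fun b hb => (Multiset.eq_of_mem_replicate hb).dvd
      refine ⟨fun x => ?_, fun x => ?_⟩
      · have := congrArg (fun q : Perm H => q x) (orderOf_dvd_iff_pow_eq_one.1 hd)
        simpa [sq] using this
      · have : x ∈ g.support := by rw [hs]; exact Finset.mem_univ x
        exact Perm.mem_support.1 this
  have e : {f : H → H // Cfg f} ≃ {g : Perm H // g.cycleType = Multiset.replicate h 2} :=
    { toFun := fun f => ⟨f.2.1.toPerm, (key _).1 f.2⟩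
      invFun := fun g => ⟨g.1, (key _).2 g.2⟩
      left_inv := fun f => rfl
      right_inv := fun g => Subtype.ext (Equiv.ext fun x => rfl) }
  rw [Nat.card_congr e, Nat.card_eq_fintype_card, Fintype.card_subtype, Perm.card_of_cycleType,
    if_pos]
  · rw [Multiset.sum_replicate, Multiset.prod_replicate, smul_eq_mul, hH, mul_comm h 2,
      Nat.sub_self, Nat.factorial_zero, one_mul]
    rcases Nat.eq_zero_or_pos h with rfl | hpos
    · simp
    · rw [Multiset.toFinset_replicate, if_neg hpos.ne', Finset.prod_singleton,
        Multiset.count_replicate_self, ← Nat.doubleFactorial_two_mul]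
      obtain ⟨m, rfl⟩ : ∃ m, h = m + 1 := ⟨h - 1, by omega⟩
      have h3 := Nat.factorial_eq_mul_doubleFactorial (2 * m + 1)
      have h4 : 2 * (m + 1) = 2 * m + 1 + 1 := by ring
      rw [h4, h3, Nat.mul_div_cancel_left _ (Nat.doubleFactorial_pos _)]
      rfl
  · refine ⟨?_, fun a ha => (Multiset.eq_of_mem_replicate ha).ge⟩
    rw [Multiset.sum_replicate, smul_eq_mul, hH, mul_comm]

end CardCfg

section Upper

variable {V R : Type} [Fintype V] [Fintype R] {dV : V → ℕ} {dR : R → ℕ}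

/-- Half-edges of a degree function. -/
abbrev HE {V : Type} (d : V → ℕ) := Σ v, Fin (d v)

/-- The left half-edges. -/
def inlH (x : HE dV) : HE (Sum.elim dV dR) := ⟨.inl x.1, x.2⟩

/-- The right half-edges. -/
def inrH (x : HE dR) : HE (Sum.elim dV dR) := ⟨.inr x.1, x.2⟩

theorem inlH_injective : Function.Injective (inlH : HE dV → HE (Sum.elim dV dR)) := by
  rintro ⟨v, i⟩ ⟨v', i'⟩ h
  cases h
  rfl

theorem inrH_injective : Function.Injective (inrH : HE dR → HE (Sum.elim dV dR)) := by
  rintro ⟨v, i⟩ ⟨v', i'⟩ h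
  cases h
  rfl

/-- The disjoint union of two matchings. -/
def sumMap (g₁ : HE dV → HE dV) (g₂ : HE dR → HE dR) : HE (Sum.elim dV dR) → HE (Sum.elim dV dR)
  | ⟨.inl v, i⟩ => inlH (g₁ ⟨v, i⟩)
  | ⟨.inr r, i⟩ => inrH (g₂ ⟨r, i⟩)

theorem sumMap_inl (g₁ : HE dV → HE dV) (g₂ : HE dR → HE dR) (x : HE dV) :
    sumMap g₁ g₂ (inlH x) = inlH (g₁ x) := rfl

theorem sumMap_inr (g₁ : HE dV → HE dV) (g₂ : HE dR → HE dR) (x : HE dR) :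
    sumMap g₁ g₂ (inrH x) = inrH (g₂ x) := rfl

theorem inlH_or_inrH (x : HE (Sum.elim dV dR)) : (∃ y, x = inlH y) ∨ ∃ y, x = inrH y := by
  obtain ⟨v | r, i⟩ := x
  · exact Or.inl ⟨⟨v, i⟩, rfl⟩
  · exact Or.inr ⟨⟨r, i⟩, rfl⟩

theorem sumMap_cfg {g₁ : HE dV → HE dV} {g₂ : HE dR → HE dR} (h₁ : Cfg g₁) (h₂ : Cfg g₂) :
    Cfg (sumMap g₁ g₂) := by
  refine ⟨fun x => ?_, fun x => ?_⟩ <;> obtain ⟨y, rfl⟩ | ⟨y, rfl⟩ := inlH_or_inrH x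
  · rw [sumMap_inl, sumMap_inl, h₁.1]
  · rw [sumMap_inr, sumMap_inr, h₂.1]
  · rw [sumMap_inl]
    exact fun h => h₁.2 y (inlH_injective h)
  · rw [sumMap_inr]
    exact fun h => h₂.2 y (inrH_injective h)

theorem sumMap_injective {g₁ g₁' : HE dV → HE dV} {g₂ g₂' : HE dR → HE dR}
    (h : sumMap g₁ g₂ = sumMap g₁' g₂') : g₁ = g₁' ∧ g₂ = g₂' :=
  ⟨funext fun x => inlH_injective (congrFun h (inlH x)),
    funext fun x => inrH_injective (congrFun h (inrH x))⟩

/-- The action on half-edges of a degree-preserving permutation. -/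
def liftPerm {W : Type} {d : W → ℕ} (e : Perm W) (he : d ∘ e = d) : HE d ≃ HE d :=
  Equiv.sigmaCongr e fun w => finCongr (congrFun he w).symm

theorem liftPerm_fst {W : Type} {d : W → ℕ} (e : Perm W) (he : d ∘ e = d) (x : HE d) :
    (liftPerm e he x).1 = e x.1 := rfl

/-- Transport a matching along a degree-preserving permutation. -/
def conjCfg {W : Type} {d : W → ℕ} (e : Perm W) (he : d ∘ e = d) (g : HE d → HE d) (x : HE d) :
    HE d := liftPerm e he (g ((liftPerm e he).symm x))

theorem conjCfg_cfg {W : Type} {d : W → ℕ} {e : Perm W} {he : d ∘ e = d} {g : HE d → HE d}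
    (hg : Cfg g) : Cfg (conjCfg e he g) := by
  refine ⟨fun x => ?_, fun x h => ?_⟩
  · simp only [conjCfg, Equiv.symm_apply_apply, hg.1 _, Equiv.apply_symm_apply]
  · unfold conjCfg at h
    exact hg.2 _ ((liftPerm e he).injective (h.trans ((liftPerm e he).apply_symm_apply x).symm))

theorem conjCfg_injective {W : Type} {d : W → ℕ} {e : Perm W} {he : d ∘ e = d}
    {g g' : HE d → HE d} (h : conjCfg e he g = conjCfg e he g') : g = g' := by
  funext x
  have := congrFun h (liftPerm e he x)
  simpa [conjCfg] using this

theorem conjCfg_component {e : Perm (V ⊕ R)} {he : Sum.elim dV dR ∘ e = Sum.elim dV dR}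
    {g₁ : HE dV → HE dV} {g₂ : HE dR → HE dR} (hc : Conn Sigma.fst g₁) (v₀ : V) (w : V ⊕ R) :
    (e.symm w).isLeft = true ↔
      ReflTransGen (Adj Sigma.fst (conjCfg e he (sumMap g₁ g₂))) (e (.inl v₀)) w := by
  constructor
  · intro h
    obtain ⟨v, hv⟩ := Sum.isLeft_iff.1 h
    rw [Equiv.symm_apply_eq] at hv
    rw [hv]
    refine ReflTransGen.lift (fun v => e (.inl v)) ?_ _ _ (hc v₀ v)
    rintro _ _ ⟨x, rfl, rfl⟩
    refine ⟨liftPerm e he ⟨.inl x.1, x.2⟩, rfl, ?_⟩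
    rw [conjCfg, Equiv.symm_apply_apply, liftPerm_fst]
    rfl
  · intro h
    induction h with
    | refl => simp
    | tail _ h ih =>
      obtain ⟨x, rfl, rfl⟩ := h
      obtain ⟨y, rfl⟩ := (liftPerm e he).surjective x
      rw [liftPerm_fst, Equiv.symm_apply_apply] at ih
      rw [conjCfg, Equiv.symm_apply_apply, liftPerm_fst, Equiv.symm_apply_apply]
      obtain ⟨v | r, i⟩ := y
      · rfl
      · cases ih

theorem upper_count (v₀ : V) (S : Finset ℕ)
    (hS : ∀ v, Sum.elim dV dR v ∈ S) :
    Nat.card {g : HE dV → HE dV // Cfg g ∧ Conn Sigma.fst g} * Nat.card {g : HE dR → HE dR // Cfg g}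
      * ∏ k ∈ S, (Nat.card {w // Sum.elim dV dR w = k}).factorial ≤
    Nat.card {f : HE (Sum.elim dV dR) → HE (Sum.elim dV dR) // Cfg f} * Nat.card (V ⊕ R) *
      ∏ k ∈ S, ((Nat.card {v // dV v = k}).factorial * (Nat.card {v // dR v = k}).factorial) := by
  classical
  set d := Sum.elim dV dR with hd
  have hstab : ∏ k ∈ S, ((Nat.card {v // dV v = k}).factorial *
      (Nat.card {v // dR v = k}).factorial) = Nat.card {e : Perm (V ⊕ R) //
        (fun w => (d w, w.isLeft)) ∘ e = fun w => (d w, w.isLeft)} := by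
    rw [card_perm_comp_eq _ (S ×ˢ Finset.univ) fun w => Finset.mem_product.2
      ⟨hS w, Finset.mem_univ _⟩, Finset.prod_product]
    refine Finset.prod_congr rfl fun k _ => ?_
    rw [Fintype.prod_bool]
    congr 2
    · refine Nat.card_congr ⟨fun v => ⟨.inl v.1, Prod.ext v.2 rfl⟩, fun w => ?_, ?_, ?_⟩
      · rcases w with ⟨w | w, hw⟩
        · exact ⟨w, congrArg Prod.fst hw⟩
        · exact absurd (congrArg Prod.snd hw) (by simp)
      · exact fun _ => rfl
      · rintro ⟨w | w, hw⟩
        · rfl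
        · exact absurd (congrArg Prod.snd hw) (by simp)
    · refine Nat.card_congr ⟨fun v => ⟨.inr v.1, Prod.ext v.2 rfl⟩, fun w => ?_, ?_, ?_⟩
      · rcases w with ⟨w | w, hw⟩
        · exact absurd (congrArg Prod.snd hw) (by simp)
        · exact ⟨w, congrArg Prod.fst hw⟩
      · exact fun _ => rfl
      · rintro ⟨w | w, hw⟩
        · exact absurd (congrArg Prod.snd hw) (by simp)
        · rfl
  rw [← card_perm_comp_eq d S hS, hstab, ← Nat.card_prod, ← Nat.card_prod, ← Nat.card_prod,
    ← Nat.card_prod]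
  let B := {b : V ⊕ R → Bool // ∃ e : Perm (V ⊕ R), d ∘ e = d ∧ b = fun w => (e.symm w).isLeft}
  choose E hE hE' using fun b : B => b.2
  let F : {e : Perm (V ⊕ R) // d ∘ e = d} → B := fun e => ⟨fun w => (e.1.symm w).isLeft, e.1, e.2, rfl⟩
  refine Nat.card_le_card_of_injective (fun q => ((⟨conjCfg q.2.1 q.2.2 (sumMap q.1.1.1 q.1.2.1),
    conjCfg_cfg (sumMap_cfg q.1.1.2.1 q.1.2.2)⟩, q.2.1 (.inl v₀)),
    ⟨q.2.1.trans (E (F q.2)).symm, ?_⟩)) ?_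
  · funext w
    have h1 := congrFun (hE' (F q.2)) (q.2.1 w)
    simp only [F, Equiv.symm_apply_apply] at h1
    have h2 := congrFun (hE (F q.2)) ((E (F q.2)).symm (q.2.1 w))
    simp only [Function.comp, Equiv.apply_symm_apply] at h2
    exact Prod.ext (h2.symm.trans (congrFun q.2.2 w)) h1.symm
  · rintro ⟨⟨⟨g₁, hg₁, hc⟩, g₂, hg₂⟩, e, he⟩ ⟨⟨⟨g₁', hg₁', hc'⟩, g₂', hg₂'⟩, e', he'⟩ h
    simp only [Prod.mk.injEq, Subtype.mk.injEq] at h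
    obtain ⟨⟨h1, h2⟩, h3⟩ := h
    have hF : F ⟨e, he⟩ = F ⟨e', he'⟩ := by
      refine Subtype.ext (funext fun w => ?_)
      rw [Bool.eq_iff_iff]
      refine (conjCfg_component (he := he) (g₂ := g₂) hc v₀ w).trans ?_
      rw [h1, h2]
      exact (conjCfg_component hc' v₀ w).symm
    rw [hF] at h3
    have he'' : e = e' := by
      refine Equiv.ext fun w => ?_
      have := congrArg (fun q : Perm (V ⊕ R) => q w) h3
      simpa using this
    subst he''
    obtain ⟨h4, h5⟩ := sumMap_injective (conjCfg_injective h1)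
    subst h4 h5
    rfl

end Upper

end PaperCM

namespace PaperCM

set_option linter.unusedSectionVars false

open Filter Topology

section Asymptotics

theorem doubleFactorial_odd_le (a : ℕ) :
    (2 * a - 1).doubleFactorial ≤ 2 ^ a * a.factorial ∧
      2 ^ a * a.factorial ≤ (2 * a + 1) * (2 * a - 1).doubleFactorial := by
  induction a with
  | zero => simp
  | succ a ih =>
    have h1 : (2 * (a + 1) - 1).doubleFactorial = (2 * a + 1) * (2 * a - 1).doubleFactorial := by
      have : 2 * (a + 1) - 1 = 2 * a + 1 := by omega
      rw [this, Nat.doubleFactorial_add_one]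
    have h2 : 2 ^ (a + 1) * (a + 1).factorial = (2 * a + 2) * (2 ^ a * a.factorial) := by
      rw [pow_succ, Nat.factorial_succ]
      ring
    rw [h1, h2]
    constructor
    · exact Nat.mul_le_mul (by omega) ih.1
    · exact Nat.mul_le_mul (by omega) ih.2

theorem log_factorial_bound : ∃ C : ℝ, ∀ m : ℕ,
    |Real.log (m.factorial : ℝ) - (m * Real.log m - m) - Real.log (2 * m) / 2| ≤ C := by
  have h := (Real.continuousAt_log (Real.sqrt_pos.2 Real.pi_pos).ne').tendsto.comp
    Stirling.tendsto_stirlingSeq_sqrt_pi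
  have h1 := h.abs.bddAbove_range
  obtain ⟨C, hC⟩ := h1
  refine ⟨max C 0, fun m => ?_⟩
  rcases Nat.eq_zero_or_pos m with rfl | hm
  · simp
  · refine le_trans (le_of_eq ?_) ((hC ⟨m, rfl⟩).trans (le_max_left _ _))
    have hm' : (0 : ℝ) < m := by exact_mod_cast hm
    simp only [Function.comp]
    rw [Stirling.log_stirlingSeq_formula, Real.log_div hm'.ne' (Real.exp_pos 1).ne', Real.log_exp]
    congr 1
    ring

theorem tendsto_log_div {u : ℕ → ℝ} {a : ℝ} (hu : Tendsto (fun n : ℕ => u n / n) atTop (𝓝 a))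
    (h1 : ∀ n, u n = 0 ∨ 1 ≤ u n) : Tendsto (fun n : ℕ => Real.log (u n) / n) atTop (𝓝 0) := by
  have hb : ∀ᶠ n : ℕ in atTop, u n / n ≤ |a| + 1 :=
    hu.eventually_le_const (by linarith [le_abs_self a])
  have hlog : Tendsto (fun n : ℕ => Real.log ((|a| + 1) * n) / n) atTop (𝓝 0) := by
    have h2 : Tendsto (fun n : ℕ => Real.log (n : ℝ) / n) atTop (𝓝 0) := by
      have := Real.isLittleO_log_id_atTop.tendsto_div_nhds_zero.comp tendsto_natCast_atTop_atTop
      exact this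
    have h3 : Tendsto (fun n : ℕ => Real.log (|a| + 1) / (n : ℝ)) atTop (𝓝 0) :=
      tendsto_const_div_atTop_nhds_zero_nat _
    have h4 := h3.add h2
    rw [add_zero] at h4
    refine h4.congr' ?_
    filter_upwards [eventually_gt_atTop 0] with n hn
    have : (0 : ℝ) < n := by exact_mod_cast hn
    rw [Real.log_mul (by positivity) this.ne', add_div]
  refine tendsto_of_tendsto_of_tendsto_of_le_of_le' tendsto_const_nhds
    (hlog.abs.trans (by simp)) ?_ ?_
  · refine Eventually.of_forall fun n => div_nonneg ?_ (Nat.cast_nonneg _)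
    rcases h1 n with h | h
    · simp [h]
    · exact Real.log_nonneg h
  · filter_upwards [hb, eventually_gt_atTop 0] with n hn hn0
    have hn' : (0 : ℝ) < n := by exact_mod_cast hn0
    rcases h1 n with h | h
    · rw [h, Real.log_zero, zero_div]
      exact abs_nonneg _
    · refine le_trans ?_ (le_abs_self _)
      rw [div_le_iff₀ hn'] at hn
      exact div_le_div_of_nonneg_right (Real.log_le_log (by linarith) hn) hn'.le

theorem tendsto_log_factorial {a : ℕ → ℕ} {α : ℝ}
    (h : Tendsto (fun n : ℕ => (a n : ℝ) / n) atTop (𝓝 α)) :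
    Tendsto (fun n : ℕ => (Real.log ((a n).factorial : ℝ) - a n * Real.log n) / n) atTop
      (𝓝 (α * Real.log α - α)) := by
  obtain ⟨C, hC⟩ := log_factorial_bound
  have h1 : Tendsto (fun n : ℕ => Real.log (2 * (a n : ℝ)) / n) atTop (𝓝 0) := by
    refine tendsto_log_div (a := 2 * α) ?_ fun n => ?_
    · refine (h.const_mul 2).congr fun n => by ring
    · rcases Nat.eq_zero_or_pos (a n) with h0 | h0
      · left
        simp [h0]
      · right
        have : (1 : ℝ) ≤ a n := by exact_mod_cast h0
        linarith
  have h2 : Tendsto (fun n : ℕ => (Real.log ((a n).factorial : ℝ) -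
      (a n * Real.log (a n) - a n) - Real.log (2 * (a n : ℝ)) / 2) / n) atTop (𝓝 0) := by
    have hz : Tendsto (fun n : ℕ => C / (n : ℝ)) atTop (𝓝 0) :=
      tendsto_const_div_atTop_nhds_zero_nat C
    refine squeeze_zero_norm (fun n => ?_) hz
    rw [norm_div, Real.norm_eq_abs, Real.norm_natCast]
    exact div_le_div_of_nonneg_right (hC _) (Nat.cast_nonneg _)
  have h3 := (Real.continuous_mul_log.tendsto α).comp h
  have h4 := ((h2.add (h1.div_const 2)).add h3).sub h
  simp only [zero_div, zero_add] at h4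
  refine h4.congr' ?_
  filter_upwards [eventually_gt_atTop 0] with n hn
  have hn' : (0 : ℝ) < n := by exact_mod_cast hn
  rcases Nat.eq_zero_or_pos (a n) with h0 | h0
  · simp [h0]
  · have h0' : (0 : ℝ) < a n := by exact_mod_cast h0
    simp only [Function.comp]
    rw [Real.log_div h0'.ne' hn'.ne']
    field_simp
    ring

theorem choose_mul_le_one {x : ℝ} (h0 : 0 ≤ x) (h1 : x ≤ 1) (a b : ℕ) :
    ((a + b).choose b : ℝ) * ((1 - x) ^ a * x ^ b) ≤ 1 := by
  have h := add_pow (1 - x) x (a + b)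
  rw [sub_add_cancel, one_pow] at h
  refine le_trans ?_ h.ge
  have hm : a ∈ Finset.range (a + b + 1) := Finset.mem_range.2 (by omega)
  refine le_trans (le_of_eq ?_) (Finset.single_le_sum (f := fun m => (1 - x) ^ m *
    x ^ (a + b - m) * ((a + b).choose m : ℝ)) (fun m _ => ?_) hm)
  · simp only [Nat.add_sub_cancel_left]
    rw [← Nat.choose_symm_add]
    ring
  · have : 0 ≤ 1 - x := by linarith
    positivity

end Asymptotics

section UpperLog

variable {V : Type} [Fintype V] {dV : V → ℕ}

theorem log_upper (v₀ : V) {h T : ℕ} (hh : ∑ v, dV v = 2 * h)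
    (hpos : 0 < Nat.card {g : HE dV → HE dV // Cfg g ∧ Conn Sigma.fst g}) (r : ℕ → ℕ)
    {x : ℝ} (hx0 : 0 < x) (hx1 : x < 1) :
    Real.log ((Nat.card {g : HE dV → HE dV // Cfg g ∧ Conn Sigma.fst g} : ℝ) /
      ((2 * h - 1).doubleFactorial : ℝ)) ≤
    Real.log (Fintype.card V + ∑ k ∈ Finset.range (T + 1), 2 * r k : ℕ) + Real.log (2 * h + 1 : ℕ) +
      Real.log (2 * (∑ k ∈ Finset.range (T + 1), k * r k) + 1 : ℕ) - h * Real.log (1 - x)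
      - (∑ k ∈ Finset.range (T + 1), k * r k : ℕ) * Real.log x
      + ∑ k ∈ Finset.range (T + 1),
        (Real.log ((Nat.card {v // dV v = k}).factorial : ℝ) + Real.log ((2 * r k).factorial : ℝ)
          - Real.log ((Nat.card {v // dV v = k} + 2 * r k).factorial : ℝ)) := by
  classical
  let R := Σ k : Fin (T + 1), Fin (2 * r k)
  let dR : R → ℕ := fun y => y.1
  set j := ∑ k ∈ Finset.range (T + 1), k * r k with hj
  have cR : Fintype.card R = ∑ k ∈ Finset.range (T + 1), 2 * r k := by
    rw [Fintype.card_sigma, Finset.sum_range]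
    simp
  have sR : ∑ y, dR y = 2 * j := by
    rw [Fintype.sum_sigma, hj, Finset.mul_sum, Finset.sum_range]
    refine Finset.sum_congr rfl fun k _ => ?_
    simp [dR]
    ring
  have fR : ∀ k < T + 1, Nat.card {y // dR y = k} = 2 * r k := by
    intro k hk
    have e : {y // dR y = k} ≃ Fin (2 * r k) :=
      { toFun := fun y => finCongr (congrArg (fun k => 2 * r k) y.2) y.1.2
        invFun := fun i => ⟨⟨⟨k, hk⟩, i⟩, rfl⟩
        left_inv := by
          rintro ⟨⟨k', i⟩, rfl⟩
          rfl
        right_inv := fun i => rfl }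
    rw [Nat.card_congr e, Nat.card_eq_fintype_card, Fintype.card_fin]
  obtain ⟨B, hB⟩ : ∃ B, ∀ v, dV v ≤ B := by
    obtain ⟨B, hB⟩ := (Set.finite_range dV).bddAbove
    exact ⟨B, fun v => hB ⟨v, rfl⟩⟩
  have key := upper_count (dV := dV) (dR := dR) v₀ (Finset.range (T + 1 + B + 1)) (by
    rintro (v | y)
    · have := hB v
      simp only [Sum.elim_inl, Finset.mem_range]
      omega
    · have := y.1.2
      simp only [Sum.elim_inr, Finset.mem_range, dR]
      omega)
  have hsum : ∀ k, Nat.card {w // Sum.elim dV dR w = k} =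
      Nat.card {v // dV v = k} + Nat.card {y // dR y = k} := by
    intro k
    rw [← Nat.card_sum]
    exact Nat.card_congr (Equiv.subtypeSum)
  rw [card_cfg (H := HE dR) (h := j) (by rw [Fintype.card_sigma]; simpa using sR),
    card_cfg (H := HE (Sum.elim dV dR)) (h := h + j) (by
      have : ∑ a, Sum.elim dV dR a = 2 * (h + j) := by
        rw [Fintype.sum_sum_type]
        simp only [Sum.elim_inl, Sum.elim_inr]
        rw [hh, sR]
        ring
      rw [Fintype.card_sigma]
      simpa only [Fintype.card_fin] using this), Nat.card_sum, Nat.card_eq_fintype_card (α := V),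
    Nat.card_eq_fintype_card (α := R), cR] at key
  simp only [hsum] at key
  have tail : ∀ k, T + 1 ≤ k → Nat.card {y // dR y = k} = 0 := by
    intro k hk
    rw [Nat.card_eq_zero]
    left
    refine ⟨?_⟩
    rintro ⟨y, hy⟩
    have := y.1.2
    simp only [dR] at hy
    omega
  set X := Nat.card {g : HE dV → HE dV // Cfg g ∧ Conn Sigma.fst g}
  have hXl : (0 : ℝ) < X := by exact_mod_cast hpos
  have hW : 0 < Fintype.card V + ∑ k ∈ Finset.range (T + 1), 2 * r k :=
    Nat.add_pos_left (Fintype.card_pos_iff.2 ⟨v₀⟩) _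
  have hWl : (0 : ℝ) < (Fintype.card V + ∑ k ∈ Finset.range (T + 1), 2 * r k : ℕ) := by
    exact_mod_cast hW
  have dfp : ∀ m : ℕ, (0 : ℝ) < (m.doubleFactorial : ℝ) := fun m => by
    exact_mod_cast Nat.doubleFactorial_pos m
  have fp : ∀ m : ℕ, (0 : ℝ) < (m.factorial : ℝ) := fun m => by
    exact_mod_cast Nat.factorial_pos m
  have key2 := Real.log_le_log (by
    push_cast
    exact mul_pos (mul_pos hXl (dfp _)) (Finset.prod_pos fun k _ => fp _)) (Nat.cast_le (α := ℝ).2 key)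
  simp only [Nat.cast_mul, Nat.cast_prod] at key2
  rw [Real.log_mul (mul_pos hXl (dfp _)).ne' (Finset.prod_pos fun k _ => fp _).ne',
    Real.log_mul hXl.ne' (dfp _).ne', Real.log_mul (mul_pos (dfp _) hWl).ne'
      (Finset.prod_pos fun k _ => mul_pos (fp _) (fp _)).ne', Real.log_mul (dfp _).ne' hWl.ne',
    Real.log_prod (fun k _ => (fp _).ne'),
    Real.log_prod (fun k _ => (mul_pos (fp _) (fp _)).ne')] at key2
  have hsplit : ∑ k ∈ Finset.range (T + 1 + B + 1), (Real.log ((Nat.card {v // dV v = k}).factorial *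
        (Nat.card {y // dR y = k}).factorial : ℝ) -
        Real.log ((Nat.card {v // dV v = k} + Nat.card {y // dR y = k}).factorial : ℝ)) =
      ∑ k ∈ Finset.range (T + 1),
        (Real.log ((Nat.card {v // dV v = k}).factorial : ℝ) + Real.log ((2 * r k).factorial : ℝ)
          - Real.log ((Nat.card {v // dV v = k} + 2 * r k).factorial : ℝ)) := by
    rw [← Finset.sum_subset (s₁ := Finset.range (T + 1)) (Finset.range_mono (by omega))]
    · refine Finset.sum_congr rfl fun k hk => ?_
      rw [fR k (Finset.mem_range.1 hk), Real.log_mul (fp _).ne' (fp _).ne']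
    · intro k _ hk
      rw [tail k (by simpa using hk)]
      simp
  rw [Finset.sum_sub_distrib] at hsplit
  have b1 := (doubleFactorial_odd_le (h + j)).1
  have b2 := (doubleFactorial_odd_le h).2
  have b3 := (doubleFactorial_odd_le j).2
  have l1 := Real.log_le_log (dfp _) (Nat.cast_le (α := ℝ).2 b1)
  have l2 := Real.log_le_log (by push_cast; have := fp h; positivity) (Nat.cast_le (α := ℝ).2 b2)
  have l3 := Real.log_le_log (by push_cast; have := fp j; positivity) (Nat.cast_le (α := ℝ).2 b3)
  simp only [Nat.cast_mul, Nat.cast_pow, Nat.cast_ofNat] at l1 l2 l3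
  have c1 := choose_mul_le_one hx0.le hx1.le h j
  have hfac : ((h + j).factorial : ℝ) = ((h + j).choose j : ℝ) * h.factorial * j.factorial := by
    have := Nat.add_choose_mul_factorial_mul_factorial h j
    exact_mod_cast this.symm
  have hch : (0 : ℝ) < ((h + j).choose j : ℝ) := by
    exact_mod_cast Nat.choose_pos (Nat.le_add_left _ _)
  have hx1' : 0 < 1 - x := by linarith
  have c2 := Real.log_nonpos (by positivity) c1
  rw [Real.log_mul hch.ne' (by positivity), Real.log_mul (by positivity) (by positivity),
    Real.log_pow, Real.log_pow] at c2
  have p2 : ∀ m : ℕ, (0 : ℝ) < 2 ^ m := fun m => by positivity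
  have c3 : ∀ m : ℕ, ((2 * m + 1 : ℕ) : ℝ) ≠ 0 := fun m => by positivity
  rw [hfac, Real.log_mul (p2 _).ne' (mul_pos (mul_pos hch (fp _)) (fp _)).ne',
    Real.log_mul (mul_pos hch (fp _)).ne' (fp _).ne', Real.log_mul hch.ne' (fp _).ne',
    Real.log_pow] at l1
  rw [Real.log_mul (p2 _).ne' (fp _).ne', Real.log_mul (c3 _) (dfp _).ne', Real.log_pow] at l2 l3
  rw [Real.log_div hXl.ne' (dfp _).ne']
  push_cast at *
  linarith [key2, hsplit, l1, l2, l3, c2]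

end UpperLog

end PaperCM

namespace PaperCM

set_option linter.unusedSectionVars false

open Filter Topology

/-- A sequence of degree functions with limiting degree distribution `p`. -/
structure Regime (V : ℕ → Type) [∀ n, Fintype (V n)] (deg : ∀ n, V n → ℕ) (p : ℕ → ℝ) : Prop where
  card : ∀ n, Fintype.card (V n) = n
  pos : ∀ n v, 0 < deg n v
  even : ∀ n, Even (∑ v, deg n v)
  lim : ∀ k, Tendsto (fun n : ℕ => (Nat.card {v // deg n v = k} : ℝ) / n) atTop (𝓝 (p k))
  mean : Tendsto (fun n : ℕ => ((∑ v, deg n v : ℕ) : ℝ) / n) atTop (𝓝 (∑' k : ℕ, (k : ℝ) * p k))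
  zero : p 0 = 0
  nonneg : ∀ k, 0 ≤ p k
  sum : HasSum p 1
  moment : Summable fun k : ℕ => (k : ℝ) * p k
  one : 0 < p 1
  two : 2 < ∑' k : ℕ, (k : ℝ) * p k

/-- The number of connected configurations. -/
noncomputable def numConn {V : Type} (d : V → ℕ) : ℕ :=
  Nat.card {g : HE d → HE d // Cfg g ∧ Conn Sigma.fst g}

section UpperAsymp

variable {V : ℕ → Type} [∀ n, Fintype (V n)] {deg : ∀ n, V n → ℕ} {p : ℕ → ℝ}

theorem log_nat_div_tendsto {u : ℕ → ℕ} {a : ℝ}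
    (h : Tendsto (fun n : ℕ => (u n : ℝ) / n) atTop (𝓝 a)) :
    Tendsto (fun n : ℕ => Real.log (u n : ℝ) / n) atTop (𝓝 0) :=
  tendsto_log_div h fun n => by
    rcases Nat.eq_zero_or_pos (u n) with h0 | h0
    · exact Or.inl (by exact_mod_cast h0)
    · exact Or.inr (by exact_mod_cast h0)

theorem tendsto_natCast_div_self : Tendsto (fun n : ℕ => (n : ℝ) / n) atTop (𝓝 1) := by
  refine tendsto_const_nhds.congr' ?_
  filter_upwards [eventually_gt_atTop 0] with n hn
  have : (n : ℝ) ≠ 0 := by exact_mod_cast hn.ne'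
  rw [div_self this]

theorem Regime.half (R : Regime V deg p) :
    Tendsto (fun n : ℕ => (((∑ v, deg n v) / 2 : ℕ) : ℝ) / n) atTop
      (𝓝 ((∑' k : ℕ, (k : ℝ) * p k) / 2)) := by
  refine (R.mean.div_const 2).congr fun n => ?_
  rw [Nat.cast_div (R.even n).two_dvd (by norm_num)]
  push_cast
  ring

theorem entropy_term {a b : ℝ} (ha : 0 ≤ a) (hb0 : 0 < b) (hb1 : b < 1) :
    (a * Real.log a - a) + (a * b / (1 - b) * Real.log (a * b / (1 - b)) - a * b / (1 - b)) -
      ((a + a * b / (1 - b)) * Real.log (a + a * b / (1 - b)) - (a + a * b / (1 - b))) =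
    a * Real.log (1 - b) + a * b / (1 - b) * Real.log b := by
  rcases ha.eq_or_lt with rfl | ha
  · simp
  · have hb : 0 < 1 - b := by linarith
    have e : a + a * b / (1 - b) = a / (1 - b) := by
      field_simp
      ring
    rw [e, Real.log_div ha.ne' hb.ne', mul_div_assoc, Real.log_mul ha.ne' (by positivity),
      Real.log_div hb0.ne' hb.ne']
    field_simp
    ring

theorem Regime.upper (R : Regime V deg p) {β : ℝ} (h0 : 0 < β) (h1 : β < 1) (T : ℕ) :
    ∃ u : ℕ → ℝ, Tendsto u atTop (𝓝 (-(∑' k : ℕ, (k : ℝ) * p k) / 2 * Real.log (1 - β ^ 2) +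
      ∑ k ∈ Finset.range (T + 1), p k * Real.log (1 - β ^ k))) ∧
      ∀ᶠ n : ℕ in atTop, 0 < numConn (deg n) → (1 / (n : ℝ)) *
        Real.log ((numConn (deg n) : ℝ) / ((∑ v, deg n v) - 1).doubleFactorial) ≤ u n := by
  set μ := ∑' k : ℕ, (k : ℝ) * p k with hμ
  let ρ : ℕ → ℝ := fun k => p k * β ^ k / (1 - β ^ k)
  have hρ : ∀ k, 0 ≤ ρ k := fun k =>
    div_nonneg (mul_nonneg (R.nonneg k) (pow_nonneg h0.le k)) (by
      have := pow_le_one₀ (n := k) h0.le h1.le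
      linarith)
  let r : ℕ → ℕ → ℕ := fun n k => ⌊ρ k / 2 * n⌋₊
  let L : ℕ → ℕ → ℕ := fun n k => Nat.card {v // deg n v = k}
  let h : ℕ → ℕ := fun n => (∑ v, deg n v) / 2
  have lr : ∀ k, Tendsto (fun n : ℕ => (r n k : ℝ) / n) atTop (𝓝 (ρ k / 2)) := fun k =>
    (tendsto_nat_floor_mul_div_atTop (div_nonneg (hρ k) two_pos.le)).comp
      tendsto_natCast_atTop_atTop
  have l2r : ∀ k, Tendsto (fun n : ℕ => ((2 * r n k : ℕ) : ℝ) / n) atTop (𝓝 (ρ k)) := fun k => by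
    have := (lr k).const_mul 2
    rw [mul_div_cancel₀ _ two_ne_zero] at this
    refine this.congr fun n => ?_
    push_cast
    ring
  have lj : Tendsto (fun n : ℕ => ((∑ k ∈ Finset.range (T + 1), k * r n k : ℕ) : ℝ) / n) atTop
      (𝓝 (∑ k ∈ Finset.range (T + 1), (k : ℝ) * (ρ k / 2))) := by
    refine (tendsto_finsetSum (Finset.range (T + 1)) fun k _ => (lr k).const_mul (k : ℝ)).congr
      fun n => ?_
    push_cast
    rw [Finset.sum_div]
    exact Finset.sum_congr rfl fun k _ => by ring
  have inv0 : Tendsto (fun n : ℕ => 1 / (n : ℝ)) atTop (𝓝 0) :=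
    tendsto_const_div_atTop_nhds_zero_nat 1
  have lA : Tendsto (fun n : ℕ => Real.log (Fintype.card (V n) +
      ∑ k ∈ Finset.range (T + 1), 2 * r n k : ℕ) / n) atTop (𝓝 0) := by
    refine log_nat_div_tendsto (a := 1 + ∑ k ∈ Finset.range (T + 1), ρ k) ?_
    refine (tendsto_natCast_div_self.add (tendsto_finsetSum (Finset.range (T + 1))
      fun k _ => l2r k)).congr fun n => ?_
    rw [R.card]
    push_cast
    rw [add_div, Finset.sum_div]
  have lB : Tendsto (fun n : ℕ => Real.log (2 * h n + 1 : ℕ) / n) atTop (𝓝 0) := by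
    refine log_nat_div_tendsto (a := 2 * (μ / 2) + 0) ?_
    refine ((R.half.const_mul 2).add inv0).congr fun n => ?_
    push_cast
    rw [add_div, mul_div_assoc]
  have lC : Tendsto (fun n : ℕ => Real.log (2 * (∑ k ∈ Finset.range (T + 1), k * r n k) + 1 : ℕ) / n)
      atTop (𝓝 0) := by
    refine log_nat_div_tendsto (a := 2 * (∑ k ∈ Finset.range (T + 1), (k : ℝ) * (ρ k / 2)) + 0) ?_
    refine ((lj.const_mul 2).add inv0).congr fun n => ?_
    push_cast
    rw [add_div, mul_div_assoc]
  have lF : ∀ k, Tendsto (fun n : ℕ => (Real.log ((L n k).factorial : ℝ) +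
      Real.log ((2 * r n k).factorial : ℝ) - Real.log ((L n k + 2 * r n k).factorial : ℝ)) / n) atTop
      (𝓝 ((p k * Real.log (p k) - p k) + (ρ k * Real.log (ρ k) - ρ k) -
        ((p k + ρ k) * Real.log (p k + ρ k) - (p k + ρ k)))) := by
    intro k
    have f1 := tendsto_log_factorial (R.lim k)
    have f2 := tendsto_log_factorial (l2r k)
    have f3 := tendsto_log_factorial (a := fun n => L n k + 2 * r n k) (α := p k + ρ k) (by
      refine ((R.lim k).add (l2r k)).congr fun n => ?_
      push_cast
      rw [add_div])
    refine ((f1.add f2).sub f3).congr fun n => ?_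
    push_cast
    ring
  have lF' : ∀ k, (p k * Real.log (p k) - p k) + (ρ k * Real.log (ρ k) - ρ k) -
        ((p k + ρ k) * Real.log (p k + ρ k) - (p k + ρ k)) =
      p k * Real.log (1 - β ^ k) + k * (ρ k * Real.log β) := by
    intro k
    rcases Nat.eq_zero_or_pos k with rfl | hk
    · simp [ρ, R.zero]
    · rw [entropy_term (R.nonneg k) (pow_pos h0 k) (pow_lt_one₀ h0.le h1 hk.ne'), Real.log_pow]
      ring
  let u : ℕ → ℝ := fun n => (1 / (n : ℝ)) * (
    Real.log (Fintype.card (V n) + ∑ k ∈ Finset.range (T + 1), 2 * r n k : ℕ) +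
      Real.log (2 * h n + 1 : ℕ) +
      Real.log (2 * (∑ k ∈ Finset.range (T + 1), k * r n k) + 1 : ℕ) - h n * Real.log (1 - β ^ 2)
      - (∑ k ∈ Finset.range (T + 1), k * r n k : ℕ) * Real.log (β ^ 2)
      + ∑ k ∈ Finset.range (T + 1), (Real.log ((L n k).factorial : ℝ) +
        Real.log ((2 * r n k).factorial : ℝ) - Real.log ((L n k + 2 * r n k).factorial : ℝ)))
  refine ⟨u, ?_, ?_⟩
  · have lim := ((((lA.add lB).add lC).sub (R.half.mul_const (Real.log (1 - β ^ 2)))).sub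
      (lj.mul_const (Real.log (β ^ 2)))).add
      (tendsto_finsetSum (Finset.range (T + 1)) fun k _ => lF k)
    refine (lim.congr fun n => ?_).trans (le_of_eq ?_)
    · simp only [u]
      rw [← Finset.sum_div]
      ring
    · congr 1
      simp only [lF']
      rw [Finset.sum_add_distrib, Real.log_pow, Finset.sum_mul]
      have : ∑ k ∈ Finset.range (T + 1), (k : ℝ) * (ρ k / 2) * ((2 : ℕ) * Real.log β) =
          ∑ k ∈ Finset.range (T + 1), k * (ρ k * Real.log β) :=
        Finset.sum_congr rfl fun k _ => by
          push_cast
          ring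
      rw [this]
      ring
  · filter_upwards [eventually_gt_atTop 0] with n hn hpos
    have hne : Nonempty (V n) := Fintype.card_pos_iff.1 (by rw [R.card]; exact hn)
    have hh : ∑ v, deg n v = 2 * h n := (Nat.mul_div_cancel' (R.even n).two_dvd).symm
    refine mul_le_mul_of_nonneg_left ?_ (by positivity)
    rw [hh]
    exact log_upper (Classical.arbitrary _) hh hpos (r n) (pow_pos h0 2)
      (pow_lt_one₀ h0.le h1 two_ne_zero)

end UpperAsymp

end PaperCM

namespace PaperCM

set_option linter.unusedSectionVars false

open Filter Topology

section FixedPoint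

/-- `((1 - x ^ 2) / (1 - x ^ k) - 1) * k / x`, extended continuously to `[0, 1]`. -/
noncomputable def excess (k : ℕ) (x : ℝ) : ℝ :=
  if k = 1 then 1
  else -(k * x * (∑ i ∈ Finset.range (k - 2), x ^ i) / ∑ i ∈ Finset.range k, x ^ i)

theorem one_le_geom {x : ℝ} (h0 : 0 ≤ x) {k : ℕ} (hk : 0 < k) :
    1 ≤ ∑ i ∈ Finset.range k, x ^ i := by
  refine le_trans ?_ (Finset.single_le_sum (f := fun i => x ^ i) (fun i _ => pow_nonneg h0 i)
    (Finset.mem_range.2 hk))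
  simp

theorem geom_nonneg {x : ℝ} (h0 : 0 ≤ x) (k : ℕ) : 0 ≤ ∑ i ∈ Finset.range k, x ^ i :=
  Finset.sum_nonneg fun i _ => pow_nonneg h0 i

theorem continuousOn_excess (k : ℕ) : ContinuousOn (excess k) (Set.Icc 0 1) := by
  unfold excess
  split_ifs with h
  · exact continuousOn_const
  · rcases Nat.eq_zero_or_pos k with rfl | hk
    · simp [continuousOn_const]
    · refine ContinuousOn.neg (ContinuousOn.div (by fun_prop) (by fun_prop) fun x hx => ?_)
      have := one_le_geom hx.1 hk
      linarith

theorem abs_excess_le (k : ℕ) {x : ℝ} (hx : x ∈ Set.Icc (0 : ℝ) 1) : |excess k x| ≤ k := by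
  unfold excess
  split_ifs with h
  · simp [h]
  · rcases Nat.eq_zero_or_pos k with rfl | hk
    · simp
    · have h1 := one_le_geom hx.1 hk
      have h2 := geom_nonneg hx.1 (k - 2)
      have h3 : ∑ i ∈ Finset.range (k - 2), x ^ i ≤ ∑ i ∈ Finset.range k, x ^ i :=
        Finset.sum_le_sum_of_subset_of_nonneg (Finset.range_mono (by omega))
          fun i _ _ => pow_nonneg hx.1 i
      have hx0 := hx.1
      rw [abs_neg, abs_of_nonneg (by positivity), div_le_iff₀ (by linarith), mul_assoc]
      refine mul_le_mul_of_nonneg_left ?_ (Nat.cast_nonneg k)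
      nlinarith [hx.2]

theorem excess_eq (k : ℕ) {x : ℝ} (hx : x ∈ Set.Ioo (0 : ℝ) 1) :
    (1 - x ^ 2) * (k / (1 - x ^ k)) - k = x * excess k x := by
  obtain ⟨h0, h1⟩ := hx
  have hx1 : 1 - x ≠ 0 := by linarith
  have hx2 : x - 1 ≠ 0 := by linarith
  unfold excess
  split_ifs with h
  · subst h
    field_simp
    push_cast
    field_simp
    ring
  · rcases k with _ | _ | k
    · simp
    · exact absurd rfl h
    · have hk : 1 - x ^ (k + 1 + 1) ≠ 0 := by
        have := pow_lt_one₀ h0.le h1 (n := k + 1 + 1) (by omega)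
        linarith
      have hk' : x ^ (k + 1 + 1) - 1 ≠ 0 := by
        intro h
        apply hk
        linarith
      rw [geom_sum_eq h1.ne, geom_sum_eq h1.ne, show k + 1 + 1 - 2 = k by omega]
      field_simp
      ring

theorem excess_one (k : ℕ) (hk : 0 < k) : excess k 1 = 2 - k := by
  unfold excess
  split_ifs with h
  · subst h
    norm_num
  · have : (k : ℝ) ≠ 0 := by exact_mod_cast hk.ne'
    have h2 : 2 ≤ k := by omega
    simp [Nat.cast_sub h2]
    field_simp
    ring

theorem excess_zero (k : ℕ) : excess k 0 = if k = 1 then 1 else 0 := by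
  unfold excess
  split_ifs <;> simp

variable {p : ℕ → ℝ}

theorem summable_div_one_sub_pow {a : ℕ → ℝ} (ha : Summable a) (hnn : ∀ k, 0 ≤ a k) (h00 : a 0 = 0)
    {x : ℝ} (hx : x ∈ Set.Ioo (0 : ℝ) 1) : Summable fun k => a k / (1 - x ^ k) := by
  have h1 : 0 < 1 - x := by linarith [hx.2]
  refine Summable.of_nonneg_of_le (fun k => ?_) (fun k => ?_) (ha.mul_right (1 - x)⁻¹)
  · have := pow_le_one₀ (n := k) hx.1.le hx.2.le
    exact div_nonneg (hnn k) (by linarith)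
  · rcases Nat.eq_zero_or_pos k with rfl | hk
    · simp [h00]
    · rw [← div_eq_mul_inv]
      refine div_le_div_of_nonneg_left (hnn k) h1 ?_
      have := pow_le_of_le_one hx.1.le hx.2.le hk.ne'
      linarith

theorem betaOf_spec (h0 : p 0 = 0) (hnn : ∀ k, 0 ≤ p k) (hsum : HasSum p 1)
    (hmom : Summable fun k : ℕ => (k : ℝ) * p k) (h1 : 0 < p 1)
    (h2 : 2 < ∑' k : ℕ, (k : ℝ) * p k) :
    betaOf p ∈ Set.Ioo (0 : ℝ) 1 ∧
      HasSum (fun k : ℕ => (k : ℝ) * p k / (1 - betaOf p ^ k))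
        ((∑' k : ℕ, (k : ℝ) * p k) / (1 - betaOf p ^ 2)) := by
  let H : ℝ → ℝ := fun x => ∑' k, p k * excess k x
  have bound : ∀ k, ∀ x ∈ Set.Icc (0 : ℝ) 1, ‖p k * excess k x‖ ≤ k * p k := by
    intro k x hx
    rw [norm_mul, Real.norm_of_nonneg (hnn k), mul_comm]
    exact mul_le_mul_of_nonneg_right (abs_excess_le k hx) (hnn k)
  have hH : ContinuousOn H (Set.Icc 0 1) :=
    continuousOn_tsum (fun k => continuousOn_const.mul (continuousOn_excess k)) hmom bound
  have sH : ∀ x ∈ Set.Icc (0 : ℝ) 1, Summable fun k => p k * excess k x := fun x hx =>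
    Summable.of_norm_bounded hmom fun k => bound k x hx
  have H0 : H 0 = p 1 := by
    simp only [H, excess_zero]
    rw [tsum_eq_single 1]
    · simp
    · intro k hk
      simp [hk]
  have H1 : H 1 = 2 - ∑' k : ℕ, (k : ℝ) * p k := by
    have e : ∀ k, p k * excess k 1 = 2 * p k - k * p k := by
      intro k
      rcases Nat.eq_zero_or_pos k with rfl | hk
      · simp [h0]
      · rw [excess_one k hk]
        ring
    simp only [H, e]
    rw [((hsum.mul_left 2).sub hmom.hasSum).tsum_eq, mul_one]
  have key : ∀ x ∈ Set.Ioo (0 : ℝ) 1, (1 - x ^ 2) * ∑' k : ℕ, (k : ℝ) * p k / (1 - x ^ k) =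
      ∑' k : ℕ, (k : ℝ) * p k + x * H x := by
    intro x hx
    rw [← tsum_mul_left, ← tsum_mul_left, ← hmom.tsum_add ((sH x ⟨hx.1.le, hx.2.le⟩).mul_left x)]
    refine tsum_congr fun k => ?_
    have := excess_eq k hx
    linear_combination p k * this
  have set_eq : {β : ℝ | β ∈ Set.Ioo 0 1 ∧
      ∑' k : ℕ, (k : ℝ) * p k = (1 - β ^ 2) * ∑' k : ℕ, (k : ℝ) * p k / (1 - β ^ k)} =
      Set.Icc 0 1 ∩ H ⁻¹' {0} := by
    ext x
    constructor
    · rintro ⟨hx, h⟩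
      rw [key x hx] at h
      have : x * H x = 0 := by linarith
      exact ⟨⟨hx.1.le, hx.2.le⟩, (mul_eq_zero.1 this).resolve_left hx.1.ne'⟩
    · rintro ⟨hx, h⟩
      have h : H x = 0 := h
      have hx' : x ∈ Set.Ioo (0 : ℝ) 1 := by
        refine ⟨lt_of_le_of_ne hx.1 ?_, lt_of_le_of_ne hx.2 ?_⟩
        · rintro rfl
          linarith
        · rintro rfl
          linarith
      refine ⟨hx', ?_⟩
      rw [key x hx', h]
      ring
  have hne : (Set.Icc 0 1 ∩ H ⁻¹' {0}).Nonempty := by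
    obtain ⟨x, hx, h⟩ := intermediate_value_Icc' zero_le_one hH
      (show (0 : ℝ) ∈ Set.Icc (H 1) (H 0) from ⟨by linarith, by linarith⟩)
    exact ⟨x, hx, h⟩
  have hcpt : IsCompact (Set.Icc 0 1 ∩ H ⁻¹' {0}) :=
    isCompact_Icc.of_isClosed_subset (hH.preimage_isClosed_of_isClosed isClosed_Icc
      isClosed_singleton) Set.inter_subset_left
  have hmem := hcpt.sInf_mem hne
  rw [← set_eq] at hmem
  obtain ⟨hb, he⟩ := hmem
  change betaOf p ∈ Set.Ioo (0 : ℝ) 1 at hb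
  refine ⟨hb, ?_⟩
  have hs := summable_div_one_sub_pow hmom (fun k => mul_nonneg (Nat.cast_nonneg k) (hnn k))
    (by simp) hb
  have hpos : 1 - betaOf p ^ 2 ≠ 0 := by
    have := pow_lt_one₀ hb.1.le hb.2 two_ne_zero
    linarith
  have he : ∑' k : ℕ, (k : ℝ) * p k =
    (1 - betaOf p ^ 2) * ∑' k : ℕ, (k : ℝ) * p k / (1 - betaOf p ^ k) := he
  rw [he, mul_div_cancel_left₀ _ hpos]
  exact hs.hasSum

end FixedPoint

end PaperCM

namespace PaperCM

set_option linter.unusedSectionVars false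

open Filter Topology

/-- The number of connected simple configurations. -/
noncomputable def numSmp {V : Type} (d : V → ℕ) : ℕ :=
  Nat.card {g : HE d → HE d // Cfg g ∧ Conn Sigma.fst g ∧ Smp Sigma.fst g}

/-- The possible labels of a vertex of degree `k`. -/
def Lab (k : ℕ) : Finset (Finset ℕ) := (Finset.range k).powerset.erase ∅

theorem mem_Lab {k : ℕ} {B : Finset ℕ} : B ∈ Lab k ↔ B ⊆ Finset.range k ∧ B.Nonempty := by
  rw [Lab, Finset.mem_erase, Finset.mem_powerset, Finset.nonempty_iff_ne_empty, and_comm]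

section Labelling

theorem exists_fun_card {W γ : Type} [Fintype W] [DecidableEq γ] (S : Finset γ) (x : γ → ℕ)
    (h : ∑ B ∈ S, x B = Nat.card W) :
    ∃ g : W → γ, (∀ w, g w ∈ S) ∧ ∀ B ∈ S, Nat.card {w // g w = B} = x B := by
  have e : W ≃ Σ B : S, Fin (x B) := Fintype.equivOfCardEq (by
    rw [← Nat.card_eq_fintype_card, ← h, Fintype.card_sigma, ← Finset.sum_coe_sort]
    simp)
  refine ⟨fun w => (e w).1, fun w => (e w).1.2, fun B hB => ?_⟩
  have e2 : {w // ((e w).1 : γ) = B} ≃ Fin (x B) :=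
    (e.subtypeEquiv (q := fun y => (y.1 : γ) = B) fun w => Iff.rfl).trans
      { toFun := fun y => finCongr (congrArg x y.2) y.1.2
        invFun := fun i => ⟨⟨⟨B, hB⟩, i⟩, rfl⟩
        left_inv := by
          rintro ⟨⟨⟨B', hB'⟩, i⟩, rfl⟩
          rfl
        right_inv := fun i => rfl }
  rw [Nat.card_congr e2, Nat.card_eq_fintype_card, Fintype.card_fin]

variable {V : Type} [Fintype V] {deg : V → ℕ}

theorem exists_label (hpos : ∀ v, 0 < deg v) (T : ℕ) (x : ℕ → Finset ℕ → ℕ)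
    (hx : ∀ k ≤ T, ∑ B ∈ Lab k, x k B = Nat.card {v // deg v = k}) :
    ∃ φ : V → Finset ℕ, (∀ v, φ v ∈ Lab (deg v)) ∧ (∀ v, T < deg v → φ v = {0}) ∧
      (∀ k ≤ T, ∀ B ∈ Lab k, Nat.card {v // (deg v, φ v) = (k, B)} = x k B) ∧
      ∀ k, T < k → Nat.card {v // (deg v, φ v) = (k, {0})} = Nat.card {v // deg v = k} := by
  classical
  have hg : ∀ k, ∃ g : {v // deg v = k} → Finset ℕ, k ≤ T → (∀ w, g w ∈ Lab k) ∧
      ∀ B ∈ Lab k, Nat.card {w // g w = B} = x k B := by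
    intro k
    by_cases hk : k ≤ T
    · obtain ⟨g, hg⟩ := exists_fun_card (Lab k) (x k) (hx k hk)
      exact ⟨g, fun _ => hg⟩
    · exact ⟨fun _ => ∅, fun h => absurd h hk⟩
  choose g hg using hg
  refine ⟨fun v => if deg v ≤ T then g (deg v) ⟨v, rfl⟩ else {0}, fun v => ?_, fun v hv => ?_,
    fun k hk B hB => ?_, fun k hk => ?_⟩
  · by_cases h : deg v ≤ T
    · simp only [h, if_true]
      exact (hg _ h).1 _
    · simp only [h, if_false]
      rw [mem_Lab]
      simp [hpos v]
  · simp [not_le.2 hv]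
  · rw [← (hg k hk).2 B hB]
    refine Nat.card_congr
      { toFun := fun v => ⟨⟨v.1, (Prod.ext_iff.1 v.2).1⟩, ?_⟩
        invFun := fun u => ⟨u.1.1, ?_⟩
        left_inv := fun v => rfl
        right_inv := fun u => rfl }
    · obtain ⟨v, hv⟩ := v
      have e : deg v = k := (Prod.ext_iff.1 hv).1
      subst e
      simpa [hk] using (Prod.ext_iff.1 hv).2
    · obtain ⟨⟨v, rfl⟩, h⟩ := u
      simpa [hk] using h
  · refine Nat.card_congr (Equiv.subtypeEquivRight fun v => ?_)
    constructor
    · intro h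
      exact (Prod.ext_iff.1 h).1
    · rintro rfl
      simp [not_le.2 hk]

theorem sum_label {T : ℕ} {x : ℕ → Finset ℕ → ℕ} {φ : V → Finset ℕ}
    (h1 : ∀ v, φ v ∈ Lab (deg v)) (h2 : ∀ v, T < deg v → φ v = {0})
    (h3 : ∀ k ≤ T, ∀ B ∈ Lab k, Nat.card {v // (deg v, φ v) = (k, B)} = x k B)
    (F : Finset ℕ → ℕ) (hF : F {0} = 0) :
    ∑ v, F (φ v) = ∑ k ∈ Finset.range (T + 1), ∑ B ∈ Lab k, x k B * F B := by
  classical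
  have e1 : ∑ v, F (φ v) = ∑ v with deg v ∈ Finset.range (T + 1), F (φ v) := by
    rw [Finset.sum_filter]
    refine Finset.sum_congr rfl fun v _ => ?_
    split_ifs with h
    · rfl
    · rw [h2 v (by simpa using h), hF]
  rw [e1, ← Finset.sum_fiberwise_of_maps_to (g := deg) (t := Finset.range (T + 1))
    (fun v hv => (Finset.mem_filter.1 hv).2)]
  refine Finset.sum_congr rfl fun k hk => ?_
  have hk' : k ≤ T := Nat.lt_succ_iff.1 (Finset.mem_range.1 hk)
  rw [← Finset.sum_fiberwise_of_maps_to (g := φ) (t := Lab k) (fun v hv => by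
    rw [← (Finset.mem_filter.1 hv).2]
    exact h1 v)]
  refine Finset.sum_congr rfl fun B hB => ?_
  rw [← h3 k hk' B hB, Nat.card_eq_fintype_card, Fintype.card_subtype, ← smul_eq_mul,
    ← Finset.sum_const]
  refine Finset.sum_congr ?_ fun v hv => ?_
  · ext v
    simp only [Finset.mem_filter, Finset.mem_univ, true_and, Prod.mk.injEq]
    constructor
    · rintro ⟨⟨_, h⟩, h'⟩
      exact ⟨h, h'⟩
    · rintro ⟨h, h'⟩
      exact ⟨⟨h ▸ hk, h⟩, h'⟩
  · have e : φ v = B := (Prod.ext_iff.1 (Finset.mem_filter.1 hv).2).2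
    rw [e]

theorem label_bound (hpos : ∀ v, 0 < deg v) {T : ℕ} {x : ℕ → Finset ℕ → ℕ}
    (hx : ∀ k ≤ T, ∑ B ∈ Lab k, x k B = Nat.card {v // deg v = k})
    (hc : ∑ k ∈ Finset.range (T + 1), ∑ B ∈ Lab k, x k B * (B.card - 2) + 2 * Fintype.card V =
      ∑ v, deg v)
    {k₀ : ℕ} {B₀ : Finset ℕ} (hk₀ : k₀ ≤ T) (hB₀ : B₀ ∈ Lab k₀) (h2 : 2 ≤ B₀.card)
    (hlt : B₀.card < k₀) (hbig : 2 * (1 + T + T * T) < x k₀ B₀) {s M N : ℕ}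
    (hs : s + ∑ k ∈ Finset.range (T + 1), ∑ B ∈ Lab k, x k B * (if B.card = 1 then 0 else 1) =
      Fintype.card V) (hN : N + 1 = s) (hM : 2 * M + 2 * s = ∑ v, deg v) :
    (∏ k ∈ Finset.range (T + 1), (Nat.card {v // deg v = k}).factorial) *
      ((2 * M - 2 * (1 + T + T * T)).doubleFactorial * N.factorial) ≤
    (∏ k ∈ Finset.range (T + 1), ∏ B ∈ Lab k, (x k B).factorial) *
      (((2 * M) ^ 2 + 1) ^ (2 * (1 + T + T * T)) * numSmp deg) := by
  classical
  obtain ⟨φ, h1, hT, h3, h4⟩ := exists_label hpos T x hx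
  have hle : ∀ v, (φ v).card ≤ deg v := fun v => by
    simpa using Finset.card_le_card (mem_Lab.1 (h1 v)).1
  have hpos' : ∀ v, 0 < (φ v).card := fun v => Finset.card_pos.2 (mem_Lab.1 (h1 v)).2
  have s1 := sum_label h1 hT h3 (fun B => B.card - 2) (by simp)
  have s2 := sum_label h1 hT h3 (fun B => if B.card = 1 then 0 else 1) (by simp)
  rw [← s1] at hc
  rw [← s2] at hs
  have hcs : ∑ v, (if (φ v).card = 1 then 1 else 0) = s := by
    have : ∑ v, (if (φ v).card = 1 then 1 else 0) + ∑ v, (if (φ v).card = 1 then 0 else 1) =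
        Fintype.card V := by
      rw [← Finset.sum_add_distrib, Fintype.card_eq_sum_ones]
      exact Finset.sum_congr rfl fun v _ => by split_ifs <;> rfl
    omega
  have hdown : ∑ v, (deg v - (φ v).card) = s := by
    have e1 : ∑ v, (deg v - (φ v).card) + ∑ v, (φ v).card = ∑ v, deg v := by
      rw [← Finset.sum_add_distrib]
      exact Finset.sum_congr rfl fun v _ => Nat.sub_add_cancel (hle v)
    have e2 : ∑ v, ((φ v).card - 2) + 2 * Fintype.card V =
        ∑ v, (φ v).card + ∑ v, (if (φ v).card = 1 then 1 else 0) := by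
      rw [Fintype.card_eq_sum_ones, Finset.mul_sum, ← Finset.sum_add_distrib,
        ← Finset.sum_add_distrib]
      refine Finset.sum_congr rfl fun v _ => ?_
      have := hpos' v
      split_ifs <;> omega
    omega
  have hbig' : 2 * (1 + T + T * T) < Nat.card {v // (φ v).card ≠ 1} := by
    refine hbig.trans_le ?_
    rw [← h3 k₀ hk₀ B₀ hB₀]
    refine Nat.card_mono (Set.toFinite {v | (φ v).card ≠ 1}) fun v hv => ?_
    have e : φ v = B₀ := (Prod.ext_iff.1 hv).2
    change (φ v).card ≠ 1
    rw [e]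
    omega
  have valid : ValidLabel deg T N φ := by
    refine ⟨fun v => mem_Lab.1 (h1 v), fun v hv => ?_, hdown.trans hN.symm, ?_, ?_, hbig'⟩
    · by_contra h
      refine hv ?_
      rw [hT v (by have := hle v; omega)]
      rfl
    · rw [hN, ← hcs, Nat.card_eq_fintype_card, Fintype.card_subtype, Finset.card_filter]
    · have : 0 < Nat.card {v // (deg v, φ v) = (k₀, B₀)} := by
        rw [h3 k₀ hk₀ B₀ hB₀]
        omega
      obtain ⟨⟨v, hv⟩⟩ := (Nat.card_pos_iff.1 this).1
      have e1 : φ v = B₀ := (Prod.ext_iff.1 hv).2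
      have e2 : deg v = k₀ := (Prod.ext_iff.1 hv).1
      refine ⟨v, ?_, ?_⟩ <;> rw [e1] <;> omega
  obtain ⟨D, hD⟩ : ∃ D, ∀ v, deg v ≤ D := by
    obtain ⟨D, hD⟩ := (Set.finite_range deg).bddAbove
    exact ⟨D, fun v => hD ⟨v, rfl⟩⟩
  let L : ℕ → Finset (Finset ℕ) := fun k => if k ≤ T then Lab k else {{0}}
  let S' : Finset (ℕ × Finset ℕ) := (Finset.range (T + 1 + D)).biUnion fun k => (L k).image (Prod.mk k)
  have memS' : ∀ q, q ∈ S' ↔ q.1 ∈ Finset.range (T + 1 + D) ∧ q.2 ∈ L q.1 := by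
    rintro ⟨k, B⟩
    simp only [S', Finset.mem_biUnion, Finset.mem_image, Prod.mk.injEq]
    constructor
    · rintro ⟨k', h, B', h', rfl, rfl⟩
      exact ⟨h, h'⟩
    · rintro ⟨h, h'⟩
      exact ⟨k, h, B, h', rfl, rfl⟩
  have key := label_count valid (M := M) (by rw [hN, hM]) (Finset.range (T + 1 + D))
    (fun v => Finset.mem_range.2 (by have := hD v; omega)) S' (fun v => by
      rw [memS']
      refine ⟨Finset.mem_range.2 (by have := hD v; simp only []; omega), ?_⟩
      by_cases h : deg v ≤ T
      · simpa only [L, h, if_true] using h1 v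
      · simp only [L, h, if_false, hT v (not_le.1 h), Finset.mem_singleton])
  rw [Finset.prod_finset_product S' _ L memS', Finset.prod_range_add _ (T + 1) D,
    Finset.prod_range_add _ (T + 1) D] at key
  have c1 : ∀ k ∈ Finset.range (T + 1), ∏ B ∈ L k,
      (Nat.card {v // (deg v, φ v) = (k, B)}).factorial = ∏ B ∈ Lab k, (x k B).factorial := by
    intro k hk
    have hk : k ≤ T := Nat.lt_succ_iff.1 (Finset.mem_range.1 hk)
    simp only [L, hk, if_true]
    exact Finset.prod_congr rfl fun B hB => by rw [h3 k hk B hB]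
  have c2 : ∀ k ∈ Finset.range D, ∏ B ∈ L (T + 1 + k),
      (Nat.card {v // (deg v, φ v) = (T + 1 + k, B)}).factorial =
      (Nat.card {v // deg v = T + 1 + k}).factorial := by
    intro k _
    have hk : ¬ T + 1 + k ≤ T := by omega
    simp only [L, hk, if_false]
    rw [Finset.prod_singleton, h4 _ (by omega)]
  rw [Finset.prod_congr rfl c1, Finset.prod_congr rfl c2] at key
  have hp : 0 < ∏ k ∈ Finset.range D, (Nat.card {v // deg v = T + 1 + k}).factorial :=
    Finset.prod_pos fun k _ => Nat.factorial_pos _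
  refine Nat.le_of_mul_le_mul_left ?_ hp
  unfold numSmp
  calc _ = _ := by ring
    _ ≤ _ := key
    _ = _ := by ring

end Labelling

end PaperCM

namespace PaperCM

set_option linter.unusedSectionVars false

open Filter Topology

section LowerLog

variable {V : Type} [Fintype V] {deg : V → ℕ}

theorem log_label_bound (hpos : ∀ v, 0 < deg v) {T : ℕ} {x : ℕ → Finset ℕ → ℕ}
    (hx : ∀ k ≤ T, ∑ B ∈ Lab k, x k B = Nat.card {v // deg v = k})
    (hc : ∑ k ∈ Finset.range (T + 1), ∑ B ∈ Lab k, x k B * (B.card - 2) + 2 * Fintype.card V =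
      ∑ v, deg v)
    {k₀ : ℕ} {B₀ : Finset ℕ} (hk₀ : k₀ ≤ T) (hB₀ : B₀ ∈ Lab k₀) (h2 : 2 ≤ B₀.card)
    (hlt : B₀.card < k₀) (hbig : 2 * (1 + T + T * T) < x k₀ B₀) {s M N h Q : ℕ}
    (hs : s + ∑ k ∈ Finset.range (T + 1), ∑ B ∈ Lab k, x k B * (if B.card = 1 then 0 else 1) =
      Fintype.card V) (hN : N + 1 = s) (hh : ∑ v, deg v = 2 * h) (hM : M + s = h)
    (hQ : Q + (1 + T + T * T) = M) :
    0 < numSmp deg ∧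
    ∑ k ∈ Finset.range (T + 1), (Real.log ((Nat.card {v // deg v = k}).factorial : ℝ) -
      ∑ B ∈ Lab k, Real.log ((x k B).factorial : ℝ)) + Real.log (N.factorial : ℝ) +
      (Q * Real.log 2 + Real.log (Q.factorial : ℝ)) -
      (4 * (1 + T + T * T) : ℕ) * Real.log (2 * M + 1 : ℕ) -
      (h * Real.log 2 + Real.log (h.factorial : ℝ)) ≤
    Real.log ((numSmp deg : ℝ) / ((∑ v, deg v) - 1).doubleFactorial) := by
  have key := label_bound hpos hx hc hk₀ hB₀ h2 hlt hbig hs hN (M := M) (by omega)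
  have e1 : 2 * M - 2 * (1 + T + T * T) = 2 * Q := by omega
  rw [e1, Nat.doubleFactorial_two_mul] at key
  have fp : ∀ m : ℕ, (0 : ℝ) < (m.factorial : ℝ) := fun m => by
    exact_mod_cast Nat.factorial_pos m
  have hX : 0 < numSmp deg := by
    by_contra h0
    have h0 : numSmp deg = 0 := by omega
    rw [h0, mul_zero, mul_zero] at key
    have : 0 < (∏ k ∈ Finset.range (T + 1), (Nat.card {v // deg v = k}).factorial) *
      (2 ^ Q * Q.factorial * N.factorial) :=
      Nat.mul_pos (Finset.prod_pos fun k _ => Nat.factorial_pos _)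
        (Nat.mul_pos (Nat.mul_pos (by positivity) (Nat.factorial_pos _)) (Nat.factorial_pos _))
    omega
  refine ⟨hX, ?_⟩
  have hXl : (0 : ℝ) < numSmp deg := by exact_mod_cast hX
  have p1 : (0 : ℝ) < ∏ k ∈ Finset.range (T + 1), ((Nat.card {v // deg v = k}).factorial : ℝ) :=
    Finset.prod_pos fun k _ => fp _
  have p2 : (0 : ℝ) < ∏ k ∈ Finset.range (T + 1), ∏ B ∈ Lab k, ((x k B).factorial : ℝ) :=
    Finset.prod_pos fun k _ => Finset.prod_pos fun B _ => fp _
  have p3 : (0 : ℝ) < 2 ^ Q := by positivity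
  have p4 : (0 : ℝ) < (2 * M) ^ 2 + 1 := by positivity
  have dfp : (0 : ℝ) < ((2 * h - 1).doubleFactorial : ℝ) := by
    exact_mod_cast Nat.doubleFactorial_pos _
  have key2 := Real.log_le_log (by
    push_cast
    exact mul_pos p1 (mul_pos (mul_pos p3 (fp _)) (fp _))) (Nat.cast_le (α := ℝ).2 key)
  push_cast at key2
  rw [Real.log_mul p1.ne' (mul_pos (mul_pos p3 (fp _)) (fp _)).ne',
    Real.log_mul (mul_pos p3 (fp _)).ne' (fp _).ne', Real.log_mul p3.ne' (fp _).ne', Real.log_pow,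
    Real.log_mul p2.ne' (by positivity), Real.log_mul (by positivity) hXl.ne', Real.log_pow,
    Real.log_prod (fun k _ => (fp _).ne'),
    Real.log_prod (fun k _ => (Finset.prod_pos fun B _ => fp _).ne')] at key2
  have e2 : ∀ k, Real.log (∏ B ∈ Lab k, ((x k B).factorial : ℝ)) =
      ∑ B ∈ Lab k, Real.log ((x k B).factorial : ℝ) := fun k =>
    Real.log_prod (fun B _ => (fp _).ne')
  simp only [e2] at key2
  have b1 := Real.log_le_log dfp (Nat.cast_le (α := ℝ).2 (doubleFactorial_odd_le h).1)
  push_cast at b1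
  rw [Real.log_mul (by positivity) (fp _).ne', Real.log_pow] at b1
  have b2 : Real.log ((2 * M) ^ 2 + 1) ≤ 2 * Real.log (2 * M + 1) := by
    have := Real.log_le_log p4 (show ((2 * M) ^ 2 + 1 : ℝ) ≤ (2 * M + 1) ^ 2 by
      have : (0 : ℝ) ≤ M := Nat.cast_nonneg M
      nlinarith)
    rwa [Real.log_pow] at this
  rw [hh, Real.log_div hXl.ne' dfp.ne', Finset.sum_sub_distrib]
  have b3 := mul_le_mul_of_nonneg_left b2 (show (0 : ℝ) ≤ 2 * (1 + T + T * T) by positivity)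
  push_cast at *
  linarith [key2, b1, b3]

end LowerLog

section LowerLimit

theorem eventually_lt_natCast {a : ℕ → ℕ} {α : ℝ}
    (h : Tendsto (fun n : ℕ => (a n : ℝ) / n) atTop (𝓝 α)) (hα : 0 < α) (C : ℕ) :
    ∀ᶠ n in atTop, C < a n := by
  have h1 := (tendsto_natCast_atTop_atTop (R := ℝ)).atTop_mul_pos hα h
  filter_upwards [h1.eventually_gt_atTop (C : ℝ), eventually_gt_atTop 0] with n hn h0
  have h0' : (n : ℝ) ≠ 0 := by exact_mod_cast h0.ne'
  rw [mul_div_cancel₀ _ h0'] at hn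
  exact_mod_cast hn

theorem eventually_lt_of_tendsto_div {a b : ℕ → ℕ} {α α' : ℝ}
    (h : Tendsto (fun n : ℕ => (a n : ℝ) / n) atTop (𝓝 α))
    (h' : Tendsto (fun n : ℕ => (b n : ℝ) / n) atTop (𝓝 α')) (hα : α' < α) :
    ∀ᶠ n in atTop, b n < a n := by
  filter_upwards [h'.eventually_lt h hα, eventually_gt_atTop 0] with n hn h0
  have h0' : (0 : ℝ) < n := by exact_mod_cast h0
  exact_mod_cast (div_lt_div_iff_of_pos_right h0').1 hn

theorem tendsto_natSub_div {a b : ℕ → ℕ} {α α' : ℝ}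
    (h : Tendsto (fun n : ℕ => (a n : ℝ) / n) atTop (𝓝 α))
    (h' : Tendsto (fun n : ℕ => (b n : ℝ) / n) atTop (𝓝 α')) (hab : ∀ᶠ n in atTop, b n ≤ a n) :
    Tendsto (fun n : ℕ => ((a n - b n : ℕ) : ℝ) / n) atTop (𝓝 (α - α')) := by
  refine (h.sub h').congr' ?_
  filter_upwards [hab] with n hn
  rw [Nat.cast_sub hn, sub_div]

/-- `a log a - a`. -/
noncomputable def ent (a : ℝ) : ℝ := a * Real.log a - a

variable {V : ℕ → Type} [∀ n, Fintype (V n)] {deg : ∀ n, V n → ℕ} {p : ℕ → ℝ}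

theorem Regime.lower_aux (R : Regime V deg p) {T : ℕ} {x : ℕ → ℕ → Finset ℕ → ℕ}
    {ξ : ℕ → Finset ℕ → ℝ}
    (hξ : ∀ k ≤ T, ∀ B ∈ Lab k, Tendsto (fun n : ℕ => (x n k B : ℝ) / n) atTop (𝓝 (ξ k B)))
    (hx : ∀ᶠ n in atTop, ∀ k ≤ T, ∑ B ∈ Lab k, x n k B = Nat.card {v // deg n v = k})
    (hc : ∀ᶠ n in atTop, ∑ k ∈ Finset.range (T + 1), ∑ B ∈ Lab k, x n k B * (B.card - 2) + 2 * n =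
      ∑ v, deg n v)
    {k₀ : ℕ} {B₀ : Finset ℕ} (hk₀ : k₀ ≤ T) (hB₀ : B₀ ∈ Lab k₀) (h2 : 2 ≤ B₀.card)
    (hlt : B₀.card < k₀) (hbig : 0 < ξ k₀ B₀) {ν m : ℝ}
    (hν : ν = 1 - ∑ k ∈ Finset.range (T + 1), ∑ B ∈ Lab k, ξ k B * (if B.card = 1 then 0 else 1))
    (hν0 : 0 < ν) (hm : m = (∑' k : ℕ, (k : ℝ) * p k) / 2 - ν) (hm0 : 0 < m) {l : ℝ}
    (hl : l < ∑ k ∈ Finset.range (T + 1), (ent (p k) - ∑ B ∈ Lab k, ent (ξ k B)) + ent ν +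
      (m * Real.log 2 + ent m) - ((∑' k : ℕ, (k : ℝ) * p k) / 2 * Real.log 2 +
        ent ((∑' k : ℕ, (k : ℝ) * p k) / 2))) :
    ∀ᶠ n : ℕ in atTop, 0 < numSmp (deg n) ∧ l ≤ (1 / (n : ℝ)) *
      Real.log ((numSmp (deg n) : ℝ) / ((∑ v, deg n v) - 1).doubleFactorial) := by
  set c := (∑' k : ℕ, (k : ℝ) * p k) / 2 with hcdef
  let L : ℕ → ℕ → ℕ := fun n k => Nat.card {v // deg n v = k}
  let h : ℕ → ℕ := fun n => (∑ v, deg n v) / 2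
  let y : ℕ → ℕ := fun n => ∑ k ∈ Finset.range (T + 1), ∑ B ∈ Lab k,
    x n k B * (if B.card = 1 then 0 else 1)
  let s : ℕ → ℕ := fun n => n - y n
  let N : ℕ → ℕ := fun n => s n - 1
  let M : ℕ → ℕ := fun n => h n - s n
  let Q : ℕ → ℕ := fun n => M n - (1 + T + T * T)
  have kT : ∀ k ∈ Finset.range (T + 1), k ≤ T := fun k hk => Nat.lt_succ_iff.1 (Finset.mem_range.1 hk)
  have hconst : ∀ C : ℕ, Tendsto (fun n : ℕ => (C : ℝ) / n) atTop (𝓝 0) := fun C =>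
    tendsto_const_div_atTop_nhds_zero_nat _
  have ly : Tendsto (fun n : ℕ => (y n : ℝ) / n) atTop (𝓝 (1 - ν)) := by
    have e : 1 - ν = ∑ k ∈ Finset.range (T + 1), ∑ B ∈ Lab k,
      ξ k B * (if B.card = 1 then 0 else 1) := by rw [hν, sub_sub_cancel]
    rw [e]
    refine (tendsto_finsetSum _ fun k hk => tendsto_finsetSum _ fun B hB =>
      (hξ k (kT k hk) B hB).mul_const (if B.card = 1 then (0 : ℝ) else 1)).congr fun n => ?_
    simp only [y]
    push_cast
    rw [Finset.sum_div]
    refine Finset.sum_congr rfl fun k _ => ?_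
    rw [Finset.sum_div]
    exact Finset.sum_congr rfl fun B _ => by ring
  have ev1 : ∀ᶠ n in atTop, y n < n :=
    eventually_lt_of_tendsto_div (a := fun n => n) tendsto_natCast_div_self ly (by linarith)
  have ls : Tendsto (fun n : ℕ => (s n : ℝ) / n) atTop (𝓝 ν) := by
    have := tendsto_natSub_div (a := fun n => n) tendsto_natCast_div_self ly
      (ev1.mono fun n => le_of_lt)
    rwa [sub_sub_cancel] at this
  have ev2 : ∀ᶠ n in atTop, 1 < s n := eventually_lt_natCast ls hν0 1
  have lN : Tendsto (fun n : ℕ => (N n : ℝ) / n) atTop (𝓝 ν) := by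
    have := tendsto_natSub_div ls (b := fun _ => 1) (by exact_mod_cast hconst 1)
      (ev2.mono fun n => le_of_lt)
    rwa [sub_zero] at this
  have ev3 : ∀ᶠ n in atTop, s n < h n := eventually_lt_of_tendsto_div R.half ls (by linarith)
  have lM : Tendsto (fun n : ℕ => (M n : ℝ) / n) atTop (𝓝 m) := by
    rw [hm]
    exact tendsto_natSub_div R.half ls (ev3.mono fun n => le_of_lt)
  have ev4 : ∀ᶠ n in atTop, 1 + T + T * T < M n := eventually_lt_natCast lM hm0 _
  have lQ : Tendsto (fun n : ℕ => (Q n : ℝ) / n) atTop (𝓝 m) := by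
    have := tendsto_natSub_div lM (b := fun _ => 1 + T + T * T) (hconst _)
      (ev4.mono fun n => le_of_lt)
    rwa [sub_zero] at this
  have ev5 := eventually_lt_natCast (hξ k₀ hk₀ B₀ hB₀) hbig (2 * (1 + T + T * T))
  have lb : Tendsto (fun n : ℕ => Real.log (2 * M n + 1 : ℕ) / n) atTop (𝓝 0) := by
    refine log_nat_div_tendsto (a := 2 * m + 0) ?_
    refine ((lM.const_mul 2).add (hconst 1)).congr fun n => ?_
    push_cast
    rw [add_div, mul_div_assoc]
  have ln : Tendsto (fun n : ℕ => Real.log (n : ℝ) / n) atTop (𝓝 0) :=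
    log_nat_div_tendsto (u := fun n => n) tendsto_natCast_div_self
  have lim := (((((tendsto_finsetSum (Finset.range (T + 1)) fun k hk =>
    (tendsto_log_factorial (R.lim k)).sub (tendsto_finsetSum (Lab k) fun B hB =>
      tendsto_log_factorial (hξ k (kT k hk) B hB))).add (tendsto_log_factorial lN)).add
    ((lQ.mul_const (Real.log 2)).add (tendsto_log_factorial lQ))).sub
    ((R.half.mul_const (Real.log 2)).add (tendsto_log_factorial R.half))).sub
    (lb.const_mul ((4 * (1 + T + T * T) : ℕ) : ℝ))).sub
      (ln.const_mul ((1 + (1 + T + T * T) : ℕ) : ℝ))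
  rw [mul_zero, mul_zero, sub_zero, sub_zero] at lim
  filter_upwards [lim.eventually_const_lt hl, ev1, ev2, ev3, ev4, ev5, hx, hc,
    eventually_gt_atTop 0] with n hl h1 h2' h3 h4 h5 hx hc hn
  have hn' : (0 : ℝ) < n := by exact_mod_cast hn
  have hh : ∑ v, deg n v = 2 * h n := (Nat.mul_div_cancel' (R.even n).two_dvd).symm
  have hs : s n + y n = Fintype.card (V n) := by
    rw [R.card]
    exact Nat.sub_add_cancel h1.le
  have hN : N n + 1 = s n := Nat.sub_add_cancel h2'.le
  have hM : M n + s n = h n := Nat.sub_add_cancel h3.le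
  have hQ : Q n + (1 + T + T * T) = M n := Nat.sub_add_cancel h4.le
  obtain ⟨hp, hb⟩ := log_label_bound (R.pos n) hx (by rw [R.card]; exact hc) hk₀ hB₀ h2 hlt h5 hs hN
    hh hM hQ
  refine ⟨hp, hl.le.trans ?_⟩
  refine le_trans (le_of_eq ?_) (mul_le_mul_of_nonneg_left hb (by positivity))
  have id1 : (N n : ℝ) + Q n - h n = -((1 + (1 + T + T * T) : ℕ) : ℝ) := by
    have : N n + Q n + (1 + (1 + T + T * T)) = h n := by omega
    rw [← this]
    push_cast
    ring
  have id2 : ∑ k ∈ Finset.range (T + 1), (((L n k : ℕ) : ℝ) - ∑ B ∈ Lab k, (x n k B : ℝ)) = 0 :=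
    Finset.sum_eq_zero fun k hk => by
      rw [sub_eq_zero]
      exact_mod_cast (hx k (kT k hk)).symm
  have id3 : ∑ k ∈ Finset.range (T + 1),
      ((Real.log ((L n k).factorial : ℝ) - L n k * Real.log n) / n -
        ∑ B ∈ Lab k, (Real.log ((x n k B).factorial : ℝ) - x n k B * Real.log n) / n) =
      (∑ k ∈ Finset.range (T + 1), (Real.log ((L n k).factorial : ℝ) -
        ∑ B ∈ Lab k, Real.log ((x n k B).factorial : ℝ))) / n := by
    have : ∀ k, (Real.log ((L n k).factorial : ℝ) - L n k * Real.log n) / n -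
        ∑ B ∈ Lab k, (Real.log ((x n k B).factorial : ℝ) - x n k B * Real.log n) / n =
        (Real.log ((L n k).factorial : ℝ) - ∑ B ∈ Lab k, Real.log ((x n k B).factorial : ℝ)) / n -
        (((L n k : ℕ) : ℝ) - ∑ B ∈ Lab k, (x n k B : ℝ)) * (Real.log n / n) := by
      intro k
      rw [← Finset.sum_div, Finset.sum_sub_distrib, ← Finset.sum_mul]
      ring
    simp only [this]
    rw [Finset.sum_sub_distrib, ← Finset.sum_mul, id2, zero_mul, sub_zero, Finset.sum_div]
  simp only [L] at id3
  rw [id3]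
  have id4 := congrArg (fun t => t * (Real.log n / n)) id1
  simp only [h] at id4 ⊢
  linear_combination -id4

end LowerLimit

end PaperCM

namespace PaperCM

set_option linter.unusedSectionVars false

open Filter Topology

section Tuning

variable {V : ℕ → Type} [∀ n, Fintype (V n)] {deg : ∀ n, V n → ℕ} {p : ℕ → ℝ}

theorem range_mem_Lab {k : ℕ} (hk : 0 < k) : Finset.range k ∈ Lab k :=
  mem_Lab.2 ⟨subset_rfl, ⟨0, Finset.mem_range.2 hk⟩⟩

theorem card_le_of_mem_Lab {k : ℕ} {B : Finset ℕ} (h : B ∈ Lab k) : B.card ≤ k := by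
  simpa using Finset.card_le_card (mem_Lab.1 h).1

theorem sum_update_label {R : Type} [CommSemiring R] {T k₀ : ℕ} {B₀ : Finset ℕ} (hk₀ : k₀ ≤ T)
    (hB₀ : B₀ ∈ Lab k₀) (hlt : B₀.card < k₀) (f c : ℕ → Finset ℕ → R) (z : R)
    (hc : c k₀ B₀ = 1) :
    ∑ k ∈ Finset.range (T + 1), ∑ B ∈ (Lab k).erase (Finset.range k),
      (if k = k₀ ∧ B = B₀ then z else f k B) * c k B =
    ∑ k ∈ Finset.range (T + 1), ∑ B ∈ (Lab k).erase (Finset.range k),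
      (if k = k₀ ∧ B = B₀ then 0 else f k B) * c k B + z := by
  have hne : B₀ ≠ Finset.range k₀ := by
    rintro rfl
    simp at hlt
  have h1 : ∑ k ∈ Finset.range (T + 1), ∑ B ∈ (Lab k).erase (Finset.range k),
      (if k = k₀ ∧ B = B₀ then z * c k B else 0) = z := by
    rw [Finset.sum_eq_single_of_mem k₀ (Finset.mem_range.2 (by omega)),
      Finset.sum_eq_single_of_mem B₀ (Finset.mem_erase.2 ⟨hne, hB₀⟩)]
    · simp [hc]
    · intro B _ hB
      simp [hB]
    · intro k _ hk
      simp [hk]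
  conv_rhs => rw [← h1]
  rw [← Finset.sum_add_distrib]
  refine Finset.sum_congr rfl fun k _ => ?_
  rw [← Finset.sum_add_distrib]
  refine Finset.sum_congr rfl fun B _ => ?_
  split_ifs <;> simp

theorem Regime.exists_tuned (R : Regime V deg p) {T : ℕ} {ξ : ℕ → Finset ℕ → ℝ}
    (hξ0 : ∀ k ≤ T, ∀ B ∈ Lab k, 0 ≤ ξ k B) (hξ1 : ∀ k ≤ T, ∑ B ∈ Lab k, ξ k B = p k)
    (hfull : ∀ k ≤ T, 0 < p k → 0 < ξ k (Finset.range k))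
    (hcon : ∑ k ∈ Finset.range (T + 1), ∑ B ∈ Lab k, ξ k B * (B.card - 2 : ℕ) =
      ∑' k : ℕ, (k : ℝ) * p k - 2)
    {k₀ : ℕ} {B₀ : Finset ℕ} (hk₀ : k₀ ≤ T) (hB₀ : B₀ ∈ Lab k₀) (h2 : 2 ≤ B₀.card)
    (hlt : B₀.card + 1 = k₀) (hbig : 0 < ξ k₀ B₀) :
    ∃ x : ℕ → ℕ → Finset ℕ → ℕ,
      (∀ k ≤ T, ∀ B ∈ Lab k, Tendsto (fun n : ℕ => (x n k B : ℝ) / n) atTop (𝓝 (ξ k B))) ∧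
      (∀ᶠ n in atTop, ∀ k ≤ T, ∑ B ∈ Lab k, x n k B = Nat.card {v // deg n v = k}) ∧
      ∀ᶠ n in atTop, ∑ k ∈ Finset.range (T + 1), ∑ B ∈ Lab k, x n k B * (B.card - 2) + 2 * n =
        ∑ v, deg n v := by
  set μ := ∑' k : ℕ, (k : ℝ) * p k with hμ
  have kT : ∀ k ∈ Finset.range (T + 1), k ≤ T := fun k hk => Nat.lt_succ_iff.1 (Finset.mem_range.1 hk)
  let L : ℕ → ℕ → ℕ := fun n k => Nat.card {v // deg n v = k}
  let c : ℕ → Finset ℕ → ℕ := fun k B => (k - 2) - (B.card - 2)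
  have hcB : c k₀ B₀ = 1 := by
    simp only [c]
    omega
  have hcF : ∀ k, c k (Finset.range k) = 0 := fun k => by simp [c]
  have hcadd : ∀ k, ∀ B ∈ Lab k, c k B + (B.card - 2) = k - 2 := fun k B hB => by
    have := card_le_of_mem_Lab hB
    simp only [c]
    omega
  let f : ℕ → ℕ → Finset ℕ → ℕ := fun n k B => ⌊ξ k B * n⌋₊
  let Pn : ℕ → ℕ := fun n => 2 * n + ∑ k ∈ Finset.range (T + 1), L n k * (k - 2)
  let Nn : ℕ → ℕ := fun n => ∑ v, deg n v + ∑ k ∈ Finset.range (T + 1),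
    ∑ B ∈ (Lab k).erase (Finset.range k), (if k = k₀ ∧ B = B₀ then 0 else f n k B) * c k B
  let X : ℕ → ℕ := fun n => Pn n - Nn n
  let a : ℕ → ℕ → Finset ℕ → ℕ := fun n k B => if k = k₀ ∧ B = B₀ then X n else f n k B
  let x : ℕ → ℕ → Finset ℕ → ℕ := fun n k B =>
    if B = Finset.range k then L n k - ∑ B' ∈ (Lab k).erase (Finset.range k), a n k B' else a n k B
  have lf : ∀ k ≤ T, ∀ B ∈ Lab k, Tendsto (fun n : ℕ => (f n k B : ℝ) / n) atTop (𝓝 (ξ k B)) :=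
    fun k hk B hB => (tendsto_nat_floor_mul_div_atTop (hξ0 k hk B hB)).comp
      tendsto_natCast_atTop_atTop
  have lP : Tendsto (fun n : ℕ => (Pn n : ℝ) / n) atTop
      (𝓝 (2 + ∑ k ∈ Finset.range (T + 1), p k * (k - 2 : ℕ))) := by
    have e := (tendsto_natCast_div_self.const_mul 2).add (tendsto_finsetSum (Finset.range (T + 1))
      fun k _ => (R.lim k).mul_const ((k - 2 : ℕ) : ℝ))
    rw [mul_one] at e
    refine e.congr fun n => ?_
    simp only [Pn]
    push_cast
    rw [add_div, Finset.sum_div, mul_div_assoc]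
    congr 1
    exact Finset.sum_congr rfl fun k _ => by ring
  have lN : Tendsto (fun n : ℕ => (Nn n : ℝ) / n) atTop (𝓝 (μ + ∑ k ∈ Finset.range (T + 1),
      ∑ B ∈ (Lab k).erase (Finset.range k), (if k = k₀ ∧ B = B₀ then 0 else ξ k B) * (c k B : ℝ))) := by
    have lg : ∀ k ≤ T, ∀ B ∈ Lab k, Tendsto
        (fun n : ℕ => ((if k = k₀ ∧ B = B₀ then 0 else f n k B : ℕ) : ℝ) / n) atTop
        (𝓝 (if k = k₀ ∧ B = B₀ then 0 else ξ k B)) := by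
      intro k hk B hB
      split_ifs
      · simp
      · exact lf k hk B hB
    have lg' := tendsto_finsetSum (Finset.range (T + 1)) fun k hk =>
      tendsto_finsetSum ((Lab k).erase (Finset.range k)) fun B hB =>
        (lg k (kT k hk) B (Finset.mem_of_mem_erase hB)).mul_const (c k B : ℝ)
    refine (R.mean.add lg').congr fun n => ?_
    simp only [Nn]
    push_cast
    rw [add_div]
    congr 1
    rw [Finset.sum_div]
    refine Finset.sum_congr rfl fun k _ => ?_
    rw [Finset.sum_div]
    exact Finset.sum_congr rfl fun B _ => by ring
  have hdiff : 2 + ∑ k ∈ Finset.range (T + 1), p k * (k - 2 : ℕ) -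
      (μ + ∑ k ∈ Finset.range (T + 1), ∑ B ∈ (Lab k).erase (Finset.range k),
        (if k = k₀ ∧ B = B₀ then 0 else ξ k B) * (c k B : ℝ)) = ξ k₀ B₀ := by
    have e1 := sum_update_label hk₀ hB₀ (by omega) ξ (fun k B => (c k B : ℝ)) (ξ k₀ B₀)
      (by rw [hcB]; norm_num)
    have e2 : ∑ k ∈ Finset.range (T + 1), ∑ B ∈ (Lab k).erase (Finset.range k),
        (if k = k₀ ∧ B = B₀ then ξ k₀ B₀ else ξ k B) * (c k B : ℝ) =
        ∑ k ∈ Finset.range (T + 1), p k * (k - 2 : ℕ) -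
          ∑ k ∈ Finset.range (T + 1), ∑ B ∈ Lab k, ξ k B * (B.card - 2 : ℕ) := by
      rw [← Finset.sum_sub_distrib]
      refine Finset.sum_congr rfl fun k hk => ?_
      rw [← hξ1 k (kT k hk), Finset.sum_mul, ← Finset.sum_sub_distrib,
        Finset.sum_erase _ (by rw [hcF, Nat.cast_zero, mul_zero])]
      refine Finset.sum_congr rfl fun B hB => ?_
      rw [← hcadd k B hB]
      have : (if k = k₀ ∧ B = B₀ then ξ k₀ B₀ else ξ k B) = ξ k B := by
        split_ifs with h
        · rw [h.1, h.2]
        · rfl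
      rw [this]
      push_cast
      ring
    rw [e2, hcon] at e1
    linarith
  have evX : ∀ᶠ n in atTop, Nn n < Pn n := eventually_lt_of_tendsto_div lP lN (by linarith)
  have lX : Tendsto (fun n : ℕ => (X n : ℝ) / n) atTop (𝓝 (ξ k₀ B₀)) := by
    rw [← hdiff]
    exact tendsto_natSub_div lP lN (evX.mono fun n => le_of_lt)
  have la : ∀ k ≤ T, ∀ B ∈ Lab k, Tendsto (fun n : ℕ => (a n k B : ℝ) / n) atTop (𝓝 (ξ k B)) := by
    intro k hk B hB
    by_cases h : k = k₀ ∧ B = B₀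
    · simp only [a, h, and_self, if_true]
      exact lX
    · simp only [a, h, if_false]
      exact lf k hk B hB
  have lsum : ∀ k ≤ T, Tendsto (fun n : ℕ =>
      ((∑ B ∈ (Lab k).erase (Finset.range k), a n k B : ℕ) : ℝ) / n) atTop
      (𝓝 (∑ B ∈ (Lab k).erase (Finset.range k), ξ k B)) := by
    intro k hk
    refine (tendsto_finsetSum _ fun B hB => la k hk B (Finset.mem_of_mem_erase hB)).congr fun n => ?_
    push_cast
    rw [Finset.sum_div]
  have hxi : ∀ k ≤ T, 0 < k →
      p k - ∑ B ∈ (Lab k).erase (Finset.range k), ξ k B = ξ k (Finset.range k) := by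
    intro k hk h0
    rw [← hξ1 k hk, ← Finset.add_sum_erase _ _ (range_mem_Lab h0), add_sub_cancel_right]
  have evk : ∀ k ∈ Finset.range (T + 1), ∀ᶠ n in atTop,
      ∑ B ∈ (Lab k).erase (Finset.range k), a n k B ≤ L n k := by
    intro k hk
    have hk := kT k hk
    rcases (R.nonneg k).eq_or_lt with hp | hp
    · refine Eventually.of_forall fun n => ?_
      have h0 : ∀ B ∈ Lab k, ξ k B = 0 :=
        (Finset.sum_eq_zero_iff_of_nonneg (hξ0 k hk)).1 ((hξ1 k hk).trans hp.symm)
      rw [Finset.sum_eq_zero fun B hB => ?_]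
      · exact Nat.zero_le _
      · have hB := Finset.mem_of_mem_erase hB
        have hne : ¬ (k = k₀ ∧ B = B₀) := by
          rintro ⟨rfl, rfl⟩
          exact hbig.ne' (h0 B hB)
        simp only [a, hne, if_false, f, h0 B hB, zero_mul, Nat.floor_zero]
    · have hk0 : 0 < k := by
        rcases Nat.eq_zero_or_pos k with rfl | h
        · exact absurd R.zero hp.ne'
        · exact h
      refine (eventually_lt_of_tendsto_div (R.lim k) (lsum k hk) ?_).mono fun n => le_of_lt
      have := hxi k hk hk0
      have := hfull k hk hp
      linarith
  have evk' := (Filter.eventually_all_finset (Finset.range (T + 1))).2 evk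
  have evsum : ∀ᶠ n in atTop, ∀ k ≤ T, ∑ B ∈ Lab k, x n k B = Nat.card {v // deg n v = k} := by
    filter_upwards [evk'] with n hn k hk
    rcases Nat.eq_zero_or_pos k with rfl | h0
    · have : IsEmpty {v // deg n v = 0} := ⟨fun v => (R.pos n v.1).ne' v.2⟩
      rw [Nat.card_of_isEmpty]
      rfl
    · rw [← Finset.add_sum_erase _ _ (range_mem_Lab h0)]
      have e : ∑ B ∈ (Lab k).erase (Finset.range k), x n k B =
          ∑ B ∈ (Lab k).erase (Finset.range k), a n k B :=
        Finset.sum_congr rfl fun B hB => if_neg (Finset.ne_of_mem_erase hB)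
      rw [e]
      simp only [x, if_true]
      exact Nat.sub_add_cancel (hn k (Finset.mem_range.2 (by omega)))
  refine ⟨x, fun k hk B hB => ?_, evsum, ?_⟩
  · by_cases h : B = Finset.range k
    · subst h
      have hk0 : 0 < k := Nat.pos_of_ne_zero (by simpa using (mem_Lab.1 hB).2)
      simp only [x, if_true]
      rw [← hxi k hk hk0]
      exact tendsto_natSub_div (R.lim k) (lsum k hk) (evk k (Finset.mem_range.2 (by omega)))
    · simp only [x, h, if_false]
      exact la k hk B hB
  · filter_upwards [evsum, evX] with n hs hX
    have e1 := sum_update_label hk₀ hB₀ (by omega) (f n) c (X n) hcB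
    have e2 : ∑ k ∈ Finset.range (T + 1), ∑ B ∈ Lab k, x n k B * (B.card - 2) +
        ∑ k ∈ Finset.range (T + 1), ∑ B ∈ (Lab k).erase (Finset.range k), a n k B * c k B =
        ∑ k ∈ Finset.range (T + 1), L n k * (k - 2) := by
      rw [← Finset.sum_add_distrib]
      refine Finset.sum_congr rfl fun k hk => ?_
      have e : ∑ B ∈ (Lab k).erase (Finset.range k), a n k B * c k B =
          ∑ B ∈ Lab k, x n k B * c k B := by
        rw [← Finset.sum_erase (Lab k) (a := Finset.range k) (by rw [hcF, mul_zero])]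
        refine Finset.sum_congr rfl fun B hB => ?_
        simp only [x, Finset.ne_of_mem_erase hB, if_false]
      rw [e, ← Finset.sum_add_distrib]
      simp only [L]
      rw [← hs k (kT k hk), Finset.sum_mul]
      refine Finset.sum_congr rfl fun B hB => ?_
      rw [← hcadd k B hB]
      ring
    have e3 : X n + Nn n = Pn n := Nat.sub_add_cancel hX.le
    simp only [a] at e2
    simp only [Nn, Pn] at e3
    omega

end Tuning

end PaperCM

namespace PaperCM

set_option linter.unusedSectionVars false

open Filter Topology

section Weights

/-- The asymptotic proportion of the label `B` among the vertices of degree `k`. -/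
noncomputable def labWeight (β : ℝ) (k : ℕ) (B : Finset ℕ) : ℝ :=
  (1 - β) ^ B.card * β ^ (k - B.card) / (1 - β ^ k)

variable {β : ℝ}

theorem one_sub_pow_pos (h0 : 0 < β) (h1 : β < 1) {k : ℕ} (hk : 0 < k) : 0 < 1 - β ^ k := by
  have := pow_lt_one₀ h0.le h1 hk.ne'
  linarith

theorem labWeight_pos (h0 : 0 < β) (h1 : β < 1) {k : ℕ} (hk : 0 < k) (B : Finset ℕ) :
    0 < labWeight β k B := by
  have h2 : 0 < 1 - β := by linarith
  have h3 := one_sub_pow_pos h0 h1 hk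
  unfold labWeight
  positivity

theorem sum_labWeight (h0 : 0 < β) (h1 : β < 1) {k : ℕ} (hk : 0 < k) :
    ∑ B ∈ Lab k, labWeight β k B = 1 := by
  have h3 := one_sub_pow_pos h0 h1 hk
  have h := Finset.sum_pow_mul_eq_add_pow (1 - β) β (Finset.range k)
  rw [← Finset.add_sum_erase _ _ (Finset.empty_mem_powerset _)] at h
  simp only [Finset.card_range, Finset.card_empty, pow_zero, Nat.sub_zero, one_mul,
    sub_add_cancel, one_pow] at h
  unfold labWeight
  rw [← Finset.sum_div, div_eq_one_iff_eq h3.ne']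
  unfold Lab
  linarith

theorem sum_powerset_card_mul (β : ℝ) (k : ℕ) :
    ∑ B ∈ (Finset.range k).powerset, (B.card : ℝ) * ((1 - β) ^ B.card * β ^ (k - B.card)) =
      k * (1 - β) := by
  induction k with
  | zero => simp
  | succ k ih =>
    rw [Finset.range_add_one, Finset.sum_powerset_insert (by simp), ← Finset.sum_add_distrib]
    have h := Finset.sum_pow_mul_eq_add_pow (1 - β) β (Finset.range k)
    rw [sub_add_cancel, one_pow, Finset.card_range] at h
    have e : ((k + 1 : ℕ) : ℝ) * (1 - β) = k * (1 - β) + (1 - β) *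
        ∑ B ∈ (Finset.range k).powerset, (1 - β) ^ B.card * β ^ (k - B.card) := by
      rw [h]
      push_cast
      ring
    rw [e, ← ih, Finset.mul_sum, ← Finset.sum_add_distrib]
    refine Finset.sum_congr rfl fun B hB => ?_
    have hB' := Finset.mem_powerset.1 hB
    have hc : B.card ≤ k := by simpa using Finset.card_le_card hB'
    have hn : k ∉ B := fun h => by simpa using hB' h
    rw [Finset.card_insert_of_notMem hn, Nat.add_sub_add_right, Nat.sub_add_comm hc]
    push_cast
    ring

/-- The mean size of the label of a vertex of degree `k`. -/
noncomputable def labMean (β : ℝ) (k : ℕ) : ℝ := (1 - β) * (k / (1 - β ^ k))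

/-- The probability that the label of a vertex of degree `k` is a singleton. -/
noncomputable def labSingle (β : ℝ) (k : ℕ) : ℝ := (1 - β) / β * (k / (1 - β ^ k) - k)

theorem sum_labWeight_card (k : ℕ) :
    ∑ B ∈ Lab k, labWeight β k B * B.card = labMean β k := by
  have h := sum_powerset_card_mul β k
  rw [← Finset.add_sum_erase _ _ (Finset.empty_mem_powerset _), Finset.card_empty, Nat.cast_zero,
    zero_mul, zero_add] at h
  have e : labMean β k = (k * (1 - β)) / (1 - β ^ k) := by
    unfold labMean
    ring
  rw [e, ← h, Finset.sum_div]
  refine Finset.sum_congr rfl fun B _ => ?_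
  unfold labWeight
  ring

theorem sum_labWeight_single (h0 : 0 < β) (h1 : β < 1) {k : ℕ} (hk : 0 < k) :
    ∑ B ∈ Lab k, labWeight β k B * (if B.card = 1 then 1 else 0) = labSingle β k := by
  have h3 := one_sub_pow_pos h0 h1 hk
  have h := Finset.sum_powerset_apply_card (fun m : ℕ => (1 - β) ^ m * β ^ (k - m) / (1 - β ^ k) *
    (if m = 1 then (1 : ℝ) else 0)) (x := Finset.range k)
  rw [← Finset.add_sum_erase _ _ (Finset.empty_mem_powerset _)] at h
  simp only [Finset.card_empty, zero_ne_one, if_false, mul_zero, zero_add] at h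
  refine h.trans ?_
  rw [Finset.sum_eq_single_of_mem 1 (Finset.mem_range.2 (by simp [hk]))]
  · obtain ⟨k, rfl⟩ := Nat.exists_eq_add_of_lt hk
    simp only [zero_add, Finset.card_range, Nat.choose_one_right, if_true, pow_one,
      Nat.add_sub_cancel, nsmul_eq_mul, mul_one, labSingle] at h3 ⊢
    have := h3.ne'
    field_simp
    ring
  · intro m _ hm
    simp [hm]

theorem sum_labWeight_not_single (h0 : 0 < β) (h1 : β < 1) {k : ℕ} (hk : 0 < k) :
    ∑ B ∈ Lab k, labWeight β k B * (if B.card = 1 then 0 else 1) = 1 - labSingle β k := by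
  rw [eq_sub_iff_add_eq, ← sum_labWeight_single h0 h1 hk, ← Finset.sum_add_distrib]
  refine (Finset.sum_congr rfl fun B _ => ?_).trans (sum_labWeight h0 h1 hk)
  split_ifs <;> ring

theorem sum_labWeight_excess (h0 : 0 < β) (h1 : β < 1) {k : ℕ} (hk : 0 < k) :
    ∑ B ∈ Lab k, labWeight β k B * (B.card - 2 : ℕ) = labMean β k - 2 + labSingle β k := by
  have e : ∀ B ∈ Lab k, labWeight β k B * (B.card - 2 : ℕ) = labWeight β k B * B.card -
      labWeight β k B * 2 + labWeight β k B * (if B.card = 1 then 1 else 0) := by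
    intro B hB
    have hpos := Finset.card_pos.2 (mem_Lab.1 hB).2
    split_ifs with h
    · rw [h]
      norm_num
      ring
    · rw [Nat.cast_sub (by omega)]
      push_cast
      ring
  rw [Finset.sum_congr rfl e, Finset.sum_add_distrib, Finset.sum_sub_distrib, sum_labWeight_card,
    sum_labWeight_single h0 h1 hk, ← Finset.sum_mul, sum_labWeight h0 h1 hk, one_mul]

theorem sum_labWeight_log (h0 : 0 < β) (h1 : β < 1) {k : ℕ} (hk : 0 < k) :
    ∑ B ∈ Lab k, labWeight β k B * Real.log (labWeight β k B) =
      labMean β k * Real.log (1 - β) + (k - labMean β k) * Real.log β - Real.log (1 - β ^ k) := by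
  have h2 : 0 < 1 - β := by linarith
  have h3 := one_sub_pow_pos h0 h1 hk
  have e : ∀ B ∈ Lab k, labWeight β k B * Real.log (labWeight β k B) =
      labWeight β k B * B.card * (Real.log (1 - β) - Real.log β) +
        labWeight β k B * (k * Real.log β - Real.log (1 - β ^ k)) := by
    intro B hB
    have hc := card_le_of_mem_Lab hB
    have : Real.log (labWeight β k B) = B.card * Real.log (1 - β) + (k - B.card) * Real.log β -
        Real.log (1 - β ^ k) := by
      unfold labWeight
      rw [Real.log_div (by positivity) h3.ne', Real.log_mul (by positivity) (by positivity),
        Real.log_pow, Real.log_pow, Nat.cast_sub hc]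
    rw [this]
    ring
  rw [Finset.sum_congr rfl e, Finset.sum_add_distrib, ← Finset.sum_mul, ← Finset.sum_mul,
    sum_labWeight_card, sum_labWeight h0 h1 hk]
  ring

theorem ent_zero : ent 0 = 0 := by simp [ent]

theorem continuous_ent : Continuous ent := Real.continuous_mul_log.sub continuous_id

theorem ent_sub_sum (h0 : 0 < β) (h1 : β < 1) {k : ℕ} {a : ℝ} (ha : 0 ≤ a) (hk : k = 0 → a = 0) :
    ent a - ∑ B ∈ Lab k, ent (a * labWeight β k B) =
      a * Real.log (1 - β ^ k) - a * labMean β k * Real.log (1 - β) -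
        (k * a - a * labMean β k) * Real.log β := by
  rcases ha.eq_or_lt with rfl | ha
  · simp [ent_zero]
  · have hk : 0 < k := Nat.pos_of_ne_zero fun h => ha.ne' (hk h)
    have e : ∀ B, ent (a * labWeight β k B) = labWeight β k B * ent a +
        a * (labWeight β k B * Real.log (labWeight β k B)) := by
      intro B
      unfold ent
      rw [Real.log_mul ha.ne' (labWeight_pos h0 h1 hk B).ne']
      ring
    simp only [e]
    rw [Finset.sum_add_distrib, ← Finset.sum_mul, ← Finset.mul_sum, sum_labWeight h0 h1 hk,
      sum_labWeight_log h0 h1 hk]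
    ring

end Weights

end PaperCM

namespace PaperCM

set_option linter.unusedSectionVars false

open Filter Topology

section LowerAsymp

variable {V : ℕ → Type} [∀ n, Fintype (V n)] {deg : ∀ n, V n → ℕ} {p : ℕ → ℝ}

theorem hasSum_of_eq {f g : ℕ → ℝ} {a b : ℝ} (h : HasSum f a) (hf : ∀ k, g k = f k) (hb : b = a) :
    HasSum g b := by
  rwa [funext hf, hb]

theorem Regime.exists_three_le (R : Regime V deg p) : ∃ k, 3 ≤ k ∧ 0 < p k := by
  by_contra! h
  have h2 : ∀ k : ℕ, (k : ℝ) * p k ≤ 2 * p k := by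
    intro k
    rcases Nat.lt_or_ge k 3 with hk | hk
    · have : (k : ℝ) ≤ 2 := by exact_mod_cast Nat.lt_succ_iff.1 hk
      exact mul_le_mul_of_nonneg_right this (R.nonneg k)
    · rw [le_antisymm (h k hk) (R.nonneg k)]
      simp
  have := hasSum_le h2 R.moment.hasSum (R.sum.mul_left 2)
  linarith [R.two]

/-- Moving the mass `δ` from the label `B₀` to the full label at degree `k₀`. -/
noncomputable def tilted (p : ℕ → ℝ) (β δ : ℝ) (k₀ : ℕ) (B₀ : Finset ℕ) (k : ℕ) (B : Finset ℕ) : ℝ :=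
  p k * labWeight β k B + if k = k₀ then
    δ * ((if B = Finset.range k₀ then 1 else 0) - if B = B₀ then 1 else 0) else 0

theorem sum_tilted_mul {β δ : ℝ} {k₀ : ℕ} {B₀ : Finset ℕ} (hk₀ : 0 < k₀) (hB₀ : B₀ ∈ Lab k₀) (k : ℕ)
    (f : Finset ℕ → ℝ) :
    ∑ B ∈ Lab k, tilted p β δ k₀ B₀ k B * f B = p k * ∑ B ∈ Lab k, labWeight β k B * f B +
      if k = k₀ then δ * (f (Finset.range k₀) - f B₀) else 0 := by
  unfold tilted
  split_ifs with h
  · subst h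
    simp only [add_mul, sub_mul, mul_assoc, ite_mul, one_mul, zero_mul, Finset.sum_add_distrib,
      ← Finset.mul_sum, Finset.sum_sub_distrib, Finset.sum_ite_eq', hB₀, range_mem_Lab hk₀, if_true]
  · simp only [add_zero, mul_assoc, ← Finset.mul_sum]

theorem log_limit_identity {β μ S : ℝ} (h0 : 0 < β) (h1 : β < 1) (hμ : 0 < μ) :
    S - μ / (1 + β) * Real.log (1 - β) - μ * β / (1 + β) * Real.log β + ent (μ * β / (1 + β)) +
      ((μ / 2 - μ * β / (1 + β)) * Real.log 2 + ent (μ / 2 - μ * β / (1 + β))) -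
      (μ / 2 * Real.log 2 + ent (μ / 2)) = -μ / 2 * Real.log (1 - β ^ 2) + S := by
  have h2 : 0 < 1 - β := by linarith
  have h3 : 0 < 1 + β := by linarith
  have e1 : 1 - β ^ 2 = (1 - β) * (1 + β) := by ring
  have e2 : μ / 2 - μ * β / (1 + β) = μ * (1 - β) / (2 * (1 + β)) := by
    field_simp
    ring
  rw [e1, e2]
  unfold ent
  rw [Real.log_mul h2.ne' h3.ne', Real.log_div (by positivity) (by positivity),
    Real.log_div (by positivity) (by positivity), Real.log_div (by positivity) (by positivity),
    Real.log_mul (by positivity) (by positivity), Real.log_mul (by positivity) (by positivity),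
    Real.log_mul (by positivity) (by positivity)]
  field_simp
  ring

theorem hasSum_labMean {β : ℝ} (h0 : 0 < β) (h1 : β < 1)
    (hβ : HasSum (fun k : ℕ => (k : ℝ) * p k / (1 - β ^ k))
      ((∑' k : ℕ, (k : ℝ) * p k) / (1 - β ^ 2))) :
    HasSum (fun k => p k * labMean β k) ((∑' k : ℕ, (k : ℝ) * p k) / (1 + β)) := by
  have h2 : 0 < 1 - β := by linarith
  have h3 : 0 < 1 + β := by linarith
  have e1 : 1 - β ^ 2 = (1 - β) * (1 + β) := by ring
  refine hasSum_of_eq (hβ.mul_left (1 - β)) (fun k => ?_) ?_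
  · unfold labMean
    ring
  · rw [e1]
    field_simp

theorem Regime.hasSum_labSingle (R : Regime V deg p) {β : ℝ} (h0 : 0 < β) (h1 : β < 1)
    (hβ : HasSum (fun k : ℕ => (k : ℝ) * p k / (1 - β ^ k))
      ((∑' k : ℕ, (k : ℝ) * p k) / (1 - β ^ 2))) :
    HasSum (fun k => p k * labSingle β k) ((∑' k : ℕ, (k : ℝ) * p k) * β / (1 + β)) := by
  have h2 : 0 < 1 - β := by linarith
  have h3 : 0 < 1 + β := by linarith
  have e1 : 1 - β ^ 2 = (1 - β) * (1 + β) := by ring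
  refine hasSum_of_eq ((hβ.sub R.moment.hasSum).mul_left ((1 - β) / β)) (fun k => ?_) ?_
  · unfold labSingle
    ring
  · rw [e1]
    field_simp
    ring

theorem Regime.summable_log (R : Regime V deg p) {β : ℝ} (h0 : 0 < β) (h1 : β < 1) :
    Summable fun k => p k * Real.log (1 - β ^ k) := by
  refine Summable.of_norm_bounded (g := fun k => p k * -Real.log (1 - β))
    (R.sum.summable.mul_right _) fun k => ?_
  rcases Nat.eq_zero_or_pos k with rfl | hk
  · simp [R.zero]
  · have h2 : 0 < 1 - β := by linarith
    have h3 := one_sub_pow_pos h0 h1 hk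
    have h4 : β ^ k ≤ β := pow_le_of_le_one h0.le h1.le hk.ne'
    rw [norm_mul, Real.norm_of_nonneg (R.nonneg k), Real.norm_eq_abs,
      abs_of_nonpos (Real.log_nonpos h3.le (by linarith [pow_pos h0 k]))]
    exact mul_le_mul_of_nonneg_left (neg_le_neg (Real.log_le_log h2 (by linarith))) (R.nonneg k)

theorem Regime.lower (R : Regime V deg p) {β : ℝ} (h0 : 0 < β) (h1 : β < 1)
    (hβ : HasSum (fun k : ℕ => (k : ℝ) * p k / (1 - β ^ k))
      ((∑' k : ℕ, (k : ℝ) * p k) / (1 - β ^ 2))) {l : ℝ}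
    (hl : l < -(∑' k : ℕ, (k : ℝ) * p k) / 2 * Real.log (1 - β ^ 2) +
      ∑' k : ℕ, p k * Real.log (1 - β ^ k)) :
    ∀ᶠ n : ℕ in atTop, 0 < numSmp (deg n) ∧ l ≤ (1 / (n : ℝ)) *
      Real.log ((numSmp (deg n) : ℝ) / ((∑ v, deg n v) - 1).doubleFactorial) := by
  obtain ⟨k₀, hk3, hpk⟩ := R.exists_three_le
  have hk₀ : 0 < k₀ := by omega
  set B₀ := Finset.range (k₀ - 1) with hB₀def
  have hcard : B₀.card = k₀ - 1 := Finset.card_range _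
  have hB₀ : B₀ ∈ Lab k₀ := mem_Lab.2 ⟨Finset.range_subset_range.2 (by omega),
    Finset.nonempty_range_iff.2 (by omega)⟩
  have hne : B₀ ≠ Finset.range k₀ := fun h => by
    have := congrArg Finset.card h
    rw [hcard, Finset.card_range] at this
    omega
  have hM := hasSum_labMean h0 h1 hβ
  have hS := R.hasSum_labSingle h0 h1 hβ
  have hlog := (R.summable_log h0 h1).hasSum
  have hmom := R.moment.hasSum
  set μ := ∑' k : ℕ, (k : ℝ) * p k with hμ
  have hμ2 : 2 < μ := R.two
  have lim : ∀ {f : ℕ → ℝ} {a : ℝ}, HasSum f a →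
      Tendsto (fun T => ∑ k ∈ Finset.range (T + 1), f k) atTop (𝓝 a) := fun h =>
    h.tendsto_sum_nat.comp (tendsto_add_atTop_nat 1)
  let δ : ℕ → ℝ := fun T => μ - 2 -
    ∑ k ∈ Finset.range (T + 1), p k * (labMean β k - 2 + labSingle β k)
  let ν : ℕ → ℝ := fun T => 1 - ∑ k ∈ Finset.range (T + 1), p k * (1 - labSingle β k)
  have h3 : 0 < 1 + β := by linarith
  have hδ : Tendsto δ atTop (𝓝 0) := by
    have h : HasSum (fun k => p k * (labMean β k - 2 + labSingle β k)) (μ - 2) := by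
      refine hasSum_of_eq ((hM.sub (R.sum.mul_right 2)).add hS) (fun k => ?_) ?_
      · ring
      · field_simp
        ring
    simpa using (lim h).const_sub (μ - 2)
  have hν : Tendsto ν atTop (𝓝 (μ * β / (1 + β))) := by
    have h : HasSum (fun k => p k * (1 - labSingle β k)) (1 - μ * β / (1 + β)) := by
      refine hasSum_of_eq (R.sum.sub hS) (fun k => ?_) rfl
      ring
    simpa using (lim h).const_sub 1
  have hm : Tendsto (fun T => μ / 2 - ν T) atTop (𝓝 (μ / 2 - μ * β / (1 + β))) := hν.const_sub _
  have ment := continuous_ent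
  let ξ : ℝ → ℕ → Finset ℕ → ℝ := fun δ => tilted p β δ k₀ B₀
  let C : ℝ → ℝ := fun δ => ∑ B ∈ Lab k₀, (ent (ξ δ k₀ B) - ent (p k₀ * labWeight β k₀ B))
  have hξk : ∀ δ k B, k ≠ k₀ → ξ δ k B = p k * labWeight β k B := fun δ k B hk => by
    simp [ξ, tilted, hk]
  have hC : Tendsto (fun T => C (δ T)) atTop (𝓝 0) := by
    have hc : Continuous C := by
      simp only [C, ξ, tilted, if_true]
      fun_prop
    have := (hc.tendsto 0).comp hδ
    have hC0 : C 0 = 0 := by simp [C, ξ, tilted]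
    rwa [hC0] at this
  have hE : ∀ T, k₀ ≤ T → ∑ k ∈ Finset.range (T + 1), (ent (p k) - ∑ B ∈ Lab k, ent (ξ (δ T) k B)) =
      ∑ k ∈ Finset.range (T + 1), (p k * Real.log (1 - β ^ k) - p k * labMean β k * Real.log (1 - β) -
        (k * p k - p k * labMean β k) * Real.log β) - C (δ T) := by
    intro T hT
    have : C (δ T) = ∑ k ∈ Finset.range (T + 1), if k = k₀ then C (δ T) else 0 := by
      rw [Finset.sum_ite_eq', if_pos (Finset.mem_range.2 (by omega))]
    rw [this, ← Finset.sum_sub_distrib]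
    refine Finset.sum_congr rfl fun k _ => ?_
    rw [← ent_sub_sum h0 h1 (R.nonneg k) (by
      rintro rfl
      exact R.zero)]
    split_ifs with h
    · subst h
      simp only [C, Finset.sum_sub_distrib]
      ring
    · simp only [hξk _ _ _ h, sub_zero]
  have hL : Tendsto (fun T => ∑ k ∈ Finset.range (T + 1), (ent (p k) - ∑ B ∈ Lab k, ent (ξ (δ T) k B)) +
      ent (ν T) + ((μ / 2 - ν T) * Real.log 2 + ent (μ / 2 - ν T)) -
      (μ / 2 * Real.log 2 + ent (μ / 2))) atTop (𝓝 (-μ / 2 * Real.log (1 - β ^ 2) +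
      ∑' k : ℕ, p k * Real.log (1 - β ^ k))) := by
    rw [← log_limit_identity h0 h1 (by linarith : 0 < μ)]
    refine Tendsto.sub_const (Tendsto.add (Tendsto.add ?_ ((ment.tendsto _).comp hν))
      (Tendsto.add (hm.mul_const _) ((ment.tendsto _).comp hm))) _
    have h := (lim ((hlog.sub (hM.mul_right (Real.log (1 - β)))).sub
      ((hmom.sub hM).mul_right (Real.log β)))).sub hC
    have e : ∑' k : ℕ, p k * Real.log (1 - β ^ k) - μ / (1 + β) * Real.log (1 - β) -
        μ * β / (1 + β) * Real.log β = ∑' k : ℕ, p k * Real.log (1 - β ^ k) -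
        μ / (1 + β) * Real.log (1 - β) - (μ - μ / (1 + β)) * Real.log β - 0 := by
      have : μ * β / (1 + β) = μ - μ / (1 + β) := by
        field_simp
        ring
      rw [this, sub_zero]
    rw [e]
    refine h.congr' ?_
    filter_upwards [eventually_ge_atTop k₀] with T hT
    rw [hE T hT]
  have hm0 : 0 < μ / 2 - μ * β / (1 + β) := by
    have : μ / 2 - μ * β / (1 + β) = μ * (1 - β) / (2 * (1 + β)) := by
      field_simp
      ring
    have h2 : 0 < 1 - β := by linarith
    rw [this]
    positivity
  have hwF : 0 < p k₀ * labWeight β k₀ (Finset.range k₀) := mul_pos hpk (labWeight_pos h0 h1 hk₀ _)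
  have hwB : 0 < p k₀ * labWeight β k₀ B₀ := mul_pos hpk (labWeight_pos h0 h1 hk₀ _)
  obtain ⟨T, hT, hLT, hνT, hmT, hδ1, hδ2⟩ := ((eventually_ge_atTop k₀).and
    ((hL.eventually (lt_mem_nhds hl)).and ((hν.eventually (lt_mem_nhds (by positivity))).and
    ((hm.eventually (lt_mem_nhds hm0)).and ((hδ.eventually (lt_mem_nhds (neg_lt_zero.2 hwF))).and
    (hδ.eventually (gt_mem_nhds hwB))))))).exists
  have hξF : 0 < ξ (δ T) k₀ (Finset.range k₀) := by
    simp only [ξ, tilted, if_true, hne.symm, if_false]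
    linarith
  have hξB : 0 < ξ (δ T) k₀ B₀ := by
    simp only [ξ, tilted, if_true, hne, if_false]
    linarith
  have hpw : ∀ k, ∀ B ∈ Lab k, 0 ≤ p k * labWeight β k B := by
    intro k B hB
    have : 0 < k := by
      have := card_le_of_mem_Lab hB
      have := Finset.card_pos.2 (mem_Lab.1 hB).2
      omega
    exact mul_nonneg (R.nonneg k) (labWeight_pos h0 h1 this B).le
  have hξ0 : ∀ k ≤ T, ∀ B ∈ Lab k, 0 ≤ ξ (δ T) k B := by
    intro k _ B hB
    by_cases hk : k = k₀
    · subst hk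
      by_cases hBF : B = Finset.range k
      · exact hBF ▸ hξF.le
      · by_cases hBB : B = B₀
        · exact hBB ▸ hξB.le
        · simpa [ξ, tilted, hBF, hBB] using hpw k B hB
    · rw [hξk _ _ _ hk]
      exact hpw k B hB
  have key : ∀ (k : ℕ) (f : Finset ℕ → ℝ), ∑ B ∈ Lab k, ξ (δ T) k B * f B =
      p k * ∑ B ∈ Lab k, labWeight β k B * f B +
        if k = k₀ then δ T * (f (Finset.range k₀) - f B₀) else 0 := fun k f =>
    sum_tilted_mul hk₀ hB₀ k f
  have hp : ∀ (k : ℕ) (a b : ℝ), (0 < k → a = b) → p k * a = p k * b := by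
    intro k a b h
    rcases Nat.eq_zero_or_pos k with rfl | hk
    · simp [R.zero]
    · rw [h hk]
  have hξ1 : ∀ k ≤ T, ∑ B ∈ Lab k, ξ (δ T) k B = p k := by
    intro k _
    have := key k fun _ => 1
    simp only [mul_one, sub_self, mul_zero, ite_self, add_zero] at this
    rw [this, hp k _ 1 fun hk => sum_labWeight h0 h1 hk, mul_one]
  have hfull : ∀ k ≤ T, 0 < p k → 0 < ξ (δ T) k (Finset.range k) := by
    intro k _ hpk'
    by_cases hk : k = k₀
    · exact hk ▸ hξF
    · rw [hξk _ _ _ hk]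
      have : 0 < k := Nat.pos_of_ne_zero fun h => hpk'.ne' (h ▸ R.zero)
      exact mul_pos hpk' (labWeight_pos h0 h1 this _)
  have hmem : k₀ ∈ Finset.range (T + 1) := Finset.mem_range.2 (by omega)
  have hcon : ∑ k ∈ Finset.range (T + 1), ∑ B ∈ Lab k, ξ (δ T) k B * (B.card - 2 : ℕ) = μ - 2 := by
    simp only [key _ fun B => ((B.card - 2 : ℕ) : ℝ)]
    rw [Finset.sum_add_distrib, Finset.sum_ite_eq', if_pos hmem, hcard, Finset.card_range,
      Finset.sum_congr rfl fun k _ => hp k _ _ fun hk => sum_labWeight_excess h0 h1 hk]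
    have : ((k₀ - 2 : ℕ) : ℝ) - (k₀ - 1 - 2 : ℕ) = 1 := by
      rw [show k₀ - 2 = (k₀ - 1 - 2) + 1 by omega]
      push_cast
      ring
    rw [this]
    simp only [δ]
    ring
  have hν' : ν T = 1 - ∑ k ∈ Finset.range (T + 1), ∑ B ∈ Lab k,
      ξ (δ T) k B * (if B.card = 1 then 0 else 1) := by
    simp only [key _ fun B => (if B.card = 1 then (0 : ℝ) else 1)]
    rw [Finset.sum_add_distrib, Finset.sum_ite_eq', if_pos hmem, hcard, Finset.card_range,
      Finset.sum_congr rfl fun k _ => hp k _ _ fun hk => sum_labWeight_not_single h0 h1 hk,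
      if_neg (by omega), if_neg (by omega)]
    simp [ν]
  obtain ⟨x, hx1, hx2, hx3⟩ := R.exists_tuned hξ0 hξ1 hfull hcon hT hB₀ (by omega) (by omega) hξB
  exact R.lower_aux hx1 hx2 hx3 hT hB₀ (by omega) (by omega) hξB hν' hνT rfl hmT hLT

end LowerAsymp

end PaperCM

namespace PaperCM

set_option linter.unusedSectionVars false

open Filter Topology

section TypeSequence

theorem sum_Icc_le_numV (m : ℕ →₀ ℕ) (j : ℕ) : ∑ k ∈ Finset.Icc 1 j, m k ≤ numV m := by
  classical
  unfold numV
  rw [Finsupp.sum_of_support_subset m (Finset.subset_union_left (s₂ := Finset.Icc 1 j)) _ (by simp)]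
  exact Finset.sum_le_sum_of_subset Finset.subset_union_right

theorem exists_sum_Icc_eq_numV {m : ℕ →₀ ℕ} (h0 : m 0 = 0) :
    ∃ j, ∑ k ∈ Finset.Icc 1 j, m k = numV m := by
  refine ⟨m.support.sup id, ?_⟩
  unfold numV
  refine (Finsupp.sum_of_support_subset m ?_ (fun _ c => c) fun _ _ => rfl).symm
  intro k hk
  refine Finset.mem_Icc.2 ⟨Nat.one_le_iff_ne_zero.2 ?_, Finset.le_sup (f := id) hk⟩
  rintro rfl
  exact Finsupp.mem_support_iff.1 hk h0

theorem degOf_eq_succ_iff {m : ℕ →₀ ℕ} (h0 : m 0 = 0) {i k : ℕ} (hi : i < numV m) :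
    degOf m i = k + 1 ↔
      ∑ j ∈ Finset.Icc 1 k, m j ≤ i ∧ i < ∑ j ∈ Finset.Icc 1 (k + 1), m j := by
  have hmono : Monotone fun j => ∑ k ∈ Finset.Icc 1 j, m k := fun a b h =>
    Finset.sum_le_sum_of_subset (Finset.Icc_subset_Icc_right h)
  have hne : {j : ℕ | i < ∑ k ∈ Finset.Icc 1 j, m k}.Nonempty := by
    obtain ⟨j, hj⟩ := exists_sum_Icc_eq_numV h0
    exact ⟨j, by simpa [hj] using hi⟩
  constructor
  · intro h
    constructor
    · by_contra! hlt
      have : degOf m i ≤ k := Nat.sInf_le hlt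
      omega
    · rw [← h]
      exact Nat.sInf_mem hne
  · rintro ⟨h1, h2⟩
    refine le_antisymm (Nat.sInf_le h2) ?_
    by_contra! hlt
    have h3 : i < ∑ k ∈ Finset.Icc 1 (degOf m i), m k := Nat.sInf_mem hne
    have h4 := hmono (Nat.lt_succ_iff.1 hlt)
    simp only at h4
    omega

theorem degOf_pos {m : ℕ →₀ ℕ} (h0 : m 0 = 0) {i : ℕ} (hi : i < numV m) : 0 < degOf m i := by
  have hne : {j : ℕ | i < ∑ k ∈ Finset.Icc 1 j, m k}.Nonempty := by
    obtain ⟨j, hj⟩ := exists_sum_Icc_eq_numV h0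
    exact ⟨j, by simpa [hj] using hi⟩
  refine Nat.pos_of_ne_zero fun h => ?_
  have h3 : i < ∑ k ∈ Finset.Icc 1 (degOf m i), m k := Nat.sInf_mem hne
  simp [h] at h3

theorem card_degOf_eq {m : ℕ →₀ ℕ} (h0 : m 0 = 0) (k : ℕ) :
    (Finset.univ.filter fun v : Fin (numV m) => degOf m v = k).card = m k := by
  rcases k with _ | k
  · rw [h0, Finset.card_eq_zero, Finset.filter_eq_empty_iff]
    exact fun v _ => (degOf_pos h0 v.2).ne'
  · rw [← Finset.card_map Fin.valEmbedding]
    have : (Finset.univ.filter fun v : Fin (numV m) => degOf m v = k + 1).map Fin.valEmbedding =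
        Finset.Ico (∑ j ∈ Finset.Icc 1 k, m j) (∑ j ∈ Finset.Icc 1 (k + 1), m j) := by
      ext i
      simp only [Finset.mem_map, Finset.mem_filter, Finset.mem_univ, true_and, Fin.valEmbedding_apply,
        Finset.mem_Ico]
      constructor
      · rintro ⟨v, hv, rfl⟩
        exact (degOf_eq_succ_iff h0 v.2).1 hv
      · intro h
        have hi : i < numV m := h.2.trans_le (sum_Icc_le_numV m _)
        exact ⟨⟨i, hi⟩, (degOf_eq_succ_iff h0 hi).2 h, rfl⟩
    rw [this, Nat.card_Ico, Finset.sum_Icc_succ_top (by omega), Nat.add_sub_cancel_left]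

theorem sum_degOf {m : ℕ →₀ ℕ} (h0 : m 0 = 0) : ∑ v : Fin (numV m), degOf m v = totalDeg m := by
  rw [← Finset.sum_fiberwise_of_maps_to (s := Finset.univ) (t := m.support)
    (g := fun v : Fin (numV m) => degOf m v)]
  · refine Finset.sum_congr rfl fun k _ => ?_
    rw [Finset.sum_congr rfl fun v hv => (Finset.mem_filter.1 hv).2, Finset.sum_const,
      card_degOf_eq h0, smul_eq_mul, mul_comm]
  · intro v _
    rw [Finsupp.mem_support_iff, ← card_degOf_eq h0]
    exact (Finset.card_pos.2 ⟨v, by simp⟩).ne'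

theorem numV_typeOf (d : (n : ℕ) → Fin n → ℕ) (n : ℕ) : numV (typeOf d n) = n := by
  unfold numV typeOf
  rw [← Finsupp.sum_finsetSum_index (by simp) (by simp)]
  simp

theorem totalDeg_typeOf (d : (n : ℕ) → Fin n → ℕ) (n : ℕ) : totalDeg (typeOf d n) = ℓTot d n := by
  unfold totalDeg typeOf ℓTot
  rw [← Finsupp.sum_finsetSum_index (by simp) (by simp [mul_add])]
  simp

theorem typeOf_zero {d : (n : ℕ) → Fin n → ℕ} (hd : ∀ n j, 0 < d n j) (n : ℕ) :
    typeOf d n 0 = 0 := by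
  simp only [typeOf, Finsupp.finsetSum_apply]
  exact Finset.sum_eq_zero fun j _ => by simp [(hd n j).ne']

theorem adj_iff {m : ℕ →₀ ℕ} {f : HalfEdges m → HalfEdges m} {u v : Fin (numV m)} :
    adj m f u v ↔ Adj Sigma.fst f u v := by
  constructor
  · rintro ⟨j, j', h⟩
    exact ⟨⟨u, j⟩, rfl, by rw [h]⟩
  · rintro ⟨⟨u, j⟩, rfl, rfl⟩
    exact ⟨j, (f ⟨u, j⟩).2, rfl⟩

theorem isConn_iff {m : ℕ →₀ ℕ} {f : HalfEdges m → HalfEdges m} :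
    IsConn m f ↔ Conn Sigma.fst f := by
  have : adj m f = Adj Sigma.fst f := by
    ext
    exact adj_iff
  unfold IsConn Conn
  rw [this]

theorem cCc_eq (m : ℕ →₀ ℕ) : cCc m = numConn fun v : Fin (numV m) => degOf m v := by
  unfold cCc numConn
  rw [← Nat.card_coe_set_eq]
  simp only [isConn_iff]
  rfl

theorem cSc_le_cCc (m : ℕ →₀ ℕ) : cSc m ≤ cCc m :=
  Set.ncard_le_ncard (fun _ h => ⟨h.1, h.2.2⟩) (Set.toFinite _)

theorem numSmp_le_cSc (m : ℕ →₀ ℕ) : numSmp (fun v : Fin (numV m) => degOf m v) ≤ cSc m := by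
  have h : numSmp (fun v : Fin (numV m) => degOf m v) =
      {f : HalfEdges m → HalfEdges m | Cfg f ∧ Conn Sigma.fst f ∧ Smp Sigma.fst f}.ncard :=
    Nat.card_coe_set_eq _
  rw [h]
  exact Set.ncard_le_ncard (fun _ h => ⟨h.1, ⟨h.2.2.1, fun x y h1 h2 => Or.inl (h.2.2.2 x y h1 h2)⟩,
    isConn_iff.2 h.2.1⟩) (Set.toFinite _)

theorem regime_typeOf {d : (n : ℕ) → Fin n → ℕ} {p : ℕ → ℝ}
    (hdpos : ∀ n j, 0 < d n j) (hdeven : ∀ n, Even (ℓTot d n))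
    (hp0 : p 0 = 0) (hpnn : ∀ i, 0 ≤ p i) (hpsum : ∑' i : ℕ, p i = 1)
    (ha : ∀ i : ℕ, Tendsto (fun n : ℕ => (typeOf d n i : ℝ) / (n : ℝ)) atTop (𝓝 (p i)))
    (hmom : Summable fun i : ℕ => (i : ℝ) * p i)
    (hb : Tendsto (fun n : ℕ => (ℓTot d n : ℝ) / (n : ℝ)) atTop (𝓝 (∑' i : ℕ, (i : ℝ) * p i)))
    (hP1 : 0 < p 1) (hP2 : 2 < ∑' i : ℕ, (i : ℝ) * p i) :
    Regime (fun n => Fin (numV (typeOf d n))) (fun n v => degOf (typeOf d n) v) p := by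
  have h0 := typeOf_zero hdpos
  have hsum : ∀ n, ∑ v : Fin (numV (typeOf d n)), degOf (typeOf d n) v = ℓTot d n := fun n => by
    rw [sum_degOf (h0 n), totalDeg_typeOf]
  have hcard : ∀ n k, Nat.card {v : Fin (numV (typeOf d n)) // degOf (typeOf d n) v = k} =
      typeOf d n k := fun n k => by
    rw [Nat.card_eq_fintype_card, Fintype.card_subtype, card_degOf_eq (h0 n)]
  have hs : Summable p := by
    by_contra h
    rw [tsum_eq_zero_of_not_summable h] at hpsum
    exact zero_ne_one hpsum
  exact
    { card := fun n => by rw [Fintype.card_fin, numV_typeOf]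
      pos := fun n v => degOf_pos (h0 n) v.2
      even := fun n => by
        rw [hsum]
        exact hdeven n
      lim := fun k => by simpa only [hcard] using ha k
      mean := by simpa only [hsum] using hb
      zero := hp0
      nonneg := hpnn
      sum := hpsum ▸ hs.hasSum
      moment := hmom
      one := hP1
      two := hP2 }

end TypeSequence

section Squeeze

variable {V : ℕ → Type} [∀ n, Fintype (V n)] {deg : ∀ n, V n → ℕ} {p : ℕ → ℝ}

/-- Any count between the simple connected and the connected configurations has the same
exponential rate. -/
theorem Regime.tendsto_log_count (R : Regime V deg p) {c : ℕ → ℕ}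
    (h1 : ∀ n, numSmp (deg n) ≤ c n) (h2 : ∀ n, c n ≤ numConn (deg n)) :
    Tendsto (fun n : ℕ => (1 / (n : ℝ)) *
      Real.log ((c n : ℝ) / ((∑ v, deg n v) - 1).doubleFactorial)) atTop (𝓝 (-(Kof p))) := by
  obtain ⟨⟨hβ0, hβ1⟩, hβ⟩ := betaOf_spec R.zero R.nonneg R.sum R.moment R.one R.two
  have hK : -Kof p = -(∑' k : ℕ, (k : ℝ) * p k) / 2 * Real.log (1 - betaOf p ^ 2) +
      ∑' k : ℕ, p k * Real.log (1 - betaOf p ^ k) := by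
    unfold Kof
    ring
  have mono : ∀ (n : ℕ) {a b : ℕ}, 0 < a → a ≤ b →
      (1 / (n : ℝ)) * Real.log ((a : ℝ) / ((∑ v, deg n v) - 1).doubleFactorial) ≤
        (1 / (n : ℝ)) * Real.log ((b : ℝ) / ((∑ v, deg n v) - 1).doubleFactorial) := by
    intro n a b ha hab
    have hf : (0 : ℝ) < ((∑ v, deg n v) - 1).doubleFactorial := by
      exact_mod_cast Nat.doubleFactorial_pos _
    have ha' : (0 : ℝ) < a := by exact_mod_cast ha
    have hab' : (a : ℝ) ≤ b := by exact_mod_cast hab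
    gcongr
  refine tendsto_order.2 ⟨fun l hl => ?_, fun r hr => ?_⟩
  · obtain ⟨l', hl1, hl2⟩ := exists_between hl
    rw [hK] at hl2
    filter_upwards [R.lower hβ0 hβ1 hβ hl2] with n hn
    exact hl1.trans_le (hn.2.trans (mono n hn.1 (h1 n)))
  · have hT : Tendsto (fun T => -(∑' k : ℕ, (k : ℝ) * p k) / 2 * Real.log (1 - betaOf p ^ 2) +
        ∑ k ∈ Finset.range (T + 1), p k * Real.log (1 - betaOf p ^ k)) atTop (𝓝 (-Kof p)) := by
      rw [hK]
      exact ((R.summable_log hβ0 hβ1).hasSum.tendsto_sum_nat.comp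
        (tendsto_add_atTop_nat 1)).const_add _
    obtain ⟨T, hTr⟩ := (hT.eventually (gt_mem_nhds hr)).exists
    obtain ⟨u, hu, hle⟩ := R.upper hβ0 hβ1 T
    have hlow := sub_one_lt (-Kof p)
    rw [hK] at hlow
    filter_upwards [hle, hu.eventually (gt_mem_nhds hTr), R.lower hβ0 hβ1 hβ hlow] with n hn hun hsn
    have hc : 0 < c n := hsn.1.trans_le (h1 n)
    exact (mono n hc (h2 n)).trans_lt ((hn (hc.trans_le (h2 n))).trans_lt hun)

end Squeeze

end PaperCM

namespace PaperCM

/-- Theorem 4.1 of the paper: `|𝒞c_{n(n)}| = e^{−K(p)n+o(n)}·(ℓ_n−1)!!`,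
and, under the additional Condition (c), `|𝒮c_{n(n)}| = e^{−K(p)n+o(n)}·(ℓ_n−1)!!`. -/
theorem switchings_exact_type_sequence
    (d : (n : ℕ) → Fin n → ℕ) (p : ℕ → ℝ)
    (hdpos : ∀ n j, 0 < d n j) (hdeven : ∀ n, Even (ℓTot d n))
    (hp0 : p 0 = 0) (hpnn : ∀ i, 0 ≤ p i) (hpsum : ∑' i : ℕ, p i = 1)
    (ha : ∀ i : ℕ, Filter.Tendsto (fun n : ℕ => (typeOf d n i : ℝ) / (n : ℝ))
      Filter.atTop (nhds (p i)))
    (hmom : Summable fun i : ℕ => (i : ℝ) * p i)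
    (hb : Filter.Tendsto (fun n : ℕ => (ℓTot d n : ℝ) / (n : ℝ)) Filter.atTop
      (nhds (∑' i : ℕ, (i : ℝ) * p i)))
    (hP1 : 0 < p 1) (hP2 : 2 < ∑' i : ℕ, (i : ℝ) * p i) :
    Filter.Tendsto (fun n : ℕ =>
        (1 / (n : ℝ)) * Real.log
          ((cCc (typeOf d n) : ℝ) / (Nat.doubleFactorial (ℓTot d n - 1) : ℝ)))
      Filter.atTop (nhds (-(Kof p)))
    ∧ ((Summable fun i : ℕ => (i : ℝ) ^ 2 * p i) →
        Filter.Tendsto (fun n : ℕ => (∑ j : Fin n, (d n j : ℝ) ^ 2) / (n : ℝ))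
          Filter.atTop (nhds (∑' i : ℕ, (i : ℝ) ^ 2 * p i)) →
        Filter.Tendsto (fun n : ℕ =>
            (1 / (n : ℝ)) * Real.log
              ((cSc (typeOf d n) : ℝ) / (Nat.doubleFactorial (ℓTot d n - 1) : ℝ)))
          Filter.atTop (nhds (-(Kof p)))) := by
  have hs : ∀ n, ∑ v : Fin (numV (typeOf d n)), degOf (typeOf d n) v = ℓTot d n := fun n => by
    rw [sum_degOf (typeOf_zero hdpos n), totalDeg_typeOf]
  have R := regime_typeOf hdpos hdeven hp0 hpnn hpsum ha hmom hb hP1 hP2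
  have h1 := R.tendsto_log_count (c := fun n => cCc (typeOf d n))
    (fun n => (numSmp_le_cSc _).trans (cSc_le_cCc _)) fun n => (cCc_eq _).le
  have h2 := R.tendsto_log_count (c := fun n => cSc (typeOf d n))
    (fun n => numSmp_le_cSc _) fun n => (cSc_le_cCc _).trans (cCc_eq _).le
  simp only [hs] at h1 h2
  exact ⟨h1, fun _ _ => h2⟩

end PaperCM
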